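/- There exist an absolute constant c > 0 and a function m : ℝ → ℕ such that the following holds. Let K ≥ 1, let G be a residually nilpotent group, and let A be a K-approximate subgroup of G. Then there is a coset nilprogression P ⊆ A^{m(K)} of rank at most exp(exp(K^c)) and step at most K^6 such that A can be covered by at most exp(K^c) left translates of P. -/

import Mathlib

open Pointwise

universe u

/-- A finite symmetric subset `A` (with `1 ∈ A`) of a group `G` is a `K`-approximate
subgroup if there is a set `X ⊆ G` with `|X| ≤ K` and `A·A ⊆ X·A`. -/
def IsKApproximateSubgroup {G : Type*} [Group G] (K : ℝ) (A : Set G) : Prop :=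
  A.Finite ∧ A⁻¹ = A ∧ (1 : G) ∈ A ∧
    ∃ X : Set G, X.Finite ∧ (X.ncard : ℝ) ≤ K ∧ A * A ⊆ X * A

/-- A group is residually nilpotent if every nontrivial element survives in some
nilpotent quotient. -/
def ResiduallyNilpotent (G : Type u) [Group G] : Prop :=
  ∀ g : G, g ≠ 1 → ∃ (N : Type u) (_ : Group N) (π : G →* N),
    Group.IsNilpotent N ∧ π g ≠ 1

/-- `P(x₁,…,x_r;L)`: the set of elements expressible as words in the `xᵢ` and their
inverses in which `xᵢ` and `xᵢ⁻¹` appear at most `L i` times between them. -/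
def GenProgression {G : Type*} [Group G] {r : ℕ} (x : Fin r → G) (L : Fin r → ℕ) : Set G :=
  { g | ∃ w : List (Fin r × Bool),
      (∀ i : Fin r, (w.map Prod.fst).count i ≤ L i) ∧
      (w.map fun p => if p.2 then x p.1 else (x p.1)⁻¹).prod = g }

/-- `Q` is a nilprogression of rank `r` and step `s`: it is of the form `P(x₁,…,x_r;L)`
where the `xᵢ` generate an (at most) `s`-step nilpotent subgroup. -/
def IsNilprogression {G : Type*} [Group G] (r s : ℕ) (Q : Set G) : Prop :=
  ∃ (x : Fin r → G) (L : Fin r → ℕ), (∀ i, 0 < L i) ∧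
    upperCentralSeries ↥(Subgroup.closure (Set.range x)) s = ⊤ ∧
    Q = GenProgression x L

/-- `P` is a coset nilprogression of rank `r` and step `s` in `G`: there are a subgroup
`C` of `G`, a normal subgroup `H` of `C`, and a nilprogression `Q` of rank `r` and step
`s` in `C/H`, such that `P` is the preimage of `Q` in `C`. -/
def IsCosetNilprogression {G : Type*} [Group G] (r s : ℕ) (P : Set G) : Prop :=
  ∃ (C : Subgroup G) (H : Subgroup ↥C) (_ : H.Normal) (Q : Set (↥C ⧸ H)),
    IsNilprogression r s Q ∧
    P = Subtype.val '' ((QuotientGroup.mk : ↥C → ↥C ⧸ H) ⁻¹' Q)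

namespace NilApprox

open scoped commutatorElement

/-- Formal commutators in the letters `j` and their inverses. -/
inductive Tr (r : ℕ) : Type
  | leaf (j : Fin r) (s : Bool) : Tr r
  | br (a b : Tr r) : Tr r

namespace Tr

noncomputable instance {r : ℕ} : DecidableEq (Tr r) := Classical.decEq _

variable {r : ℕ} {G : Type*} [Group G]

/-- The value of a formal commutator, with `[a, b] = a⁻¹ b⁻¹ a b`. -/
def val (x : Fin r → G) : Tr r → G
  | leaf j s => if s then x j else (x j)⁻¹
  | br a b => (val x a)⁻¹ * (val x b)⁻¹ * val x a * val x b

/-- The weight of a formal commutator. -/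
def wt : Tr r → ℕ
  | leaf _ _ => 1
  | br a b => wt a + wt b

/-- The product of the lengths of the letters of a formal commutator. -/
def size (L : Fin r → ℕ) : Tr r → ℕ
  | leaf j _ => L j
  | br a b => size L a * size L b

/-- The formal inverse. -/
def inv : Tr r → Tr r
  | leaf j s => leaf j (!s)
  | br a b => br b a

theorem wt_pos (t : Tr r) : 0 < wt t := by
  induction t with
  | leaf => simp [wt]
  | br a b iha ihb => simp only [wt]; omega

@[simp] theorem inv_inv (t : Tr r) : inv (inv t) = t := by cases t <;> simp [inv]
@[simp] theorem wt_inv (t : Tr r) : wt (inv t) = wt t := by cases t <;> simp [inv, wt, add_comm]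
@[simp] theorem size_inv (L : Fin r → ℕ) (t : Tr r) : size L (inv t) = size L t := by
  cases t <;> simp [inv, size, mul_comm]
@[simp] theorem val_inv (x : Fin r → G) (t : Tr r) : val x (inv t) = (val x t)⁻¹ := by
  rcases t with ⟨j, s⟩ | ⟨a, b⟩
  · cases s <;> simp [inv, val]
  · simp only [inv, val]; group

/-- The value of a word in formal commutators. -/
def ev (x : Fin r → G) (l : List (Tr r)) : G := (l.map (val x)).prod

@[simp] theorem ev_nil (x : Fin r → G) : ev x [] = 1 := rfl
@[simp] theorem ev_cons (x : Fin r → G) (t : Tr r) (l : List (Tr r)) :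
    ev x (t :: l) = val x t * ev x l := by simp [ev]
@[simp] theorem ev_append (x : Fin r → G) (l l' : List (Tr r)) :
    ev x (l ++ l') = ev x l * ev x l' := by simp [ev]

/-- The letters `[y, x₁, …, xₖ]`, over nonempty subwords `x₁ … xₖ` of `l`, created when the word
`l` is moved to the left of `y`. -/
def created : Tr r → List (Tr r) → List (Tr r)
  | _, [] => []
  | y, x :: l => created y l ++ br y x :: created (br y x) l

theorem ev_created (x : Fin r → G) (l : List (Tr r)) (y : Tr r) :
    val x y * ev x (created y l) = (ev x l)⁻¹ * val x y * ev x l := by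
  induction l generalizing y with
  | nil => simp [created]
  | cons z l ih =>
    simp only [created, ev_append, ev_cons, ← mul_assoc, ih y]
    rw [mul_assoc _ (val x (br y z)), ih (br y z)]
    simp only [val]; group

/-- The marked letters of a word. -/
def marked (q : List (Bool × Tr r)) : List (Tr r) := (q.filter (fun p => p.1)).map Prod.snd
/-- The unmarked letters of a word. -/
def unmarked (q : List (Bool × Tr r)) : List (Tr r) := (q.filter (fun p => !p.1)).map Prod.snd

/-- The word left over after the marked letters have been moved to the left. -/
def rest : List (Bool × Tr r) → List (Tr r)
  | [] => []
  | (true, _) :: q => rest q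
  | (false, t) :: q => t :: created t (marked q) ++ rest q

theorem ev_rest (x : Fin r → G) (q : List (Bool × Tr r)) :
    ev x (q.map Prod.snd) = ev x (marked q) * ev x (rest q) := by
  induction q with
  | nil => simp [marked, rest]
  | cons p q ih =>
    rcases p with ⟨_ | _, t⟩
    · have := ev_created x (marked q) t
      have hm : marked ((false, t) :: q) = marked q := by simp [marked]
      simp only [List.map_cons, ev_cons, ih, rest, hm, ev_append]
      rw [← mul_assoc (ev x _) (_ * _), this]; group
    · have hm : marked ((true, t) :: q) = t :: marked q := by simp [marked]
      simp only [List.map_cons, ev_cons, ih, rest, hm]; group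

theorem wt_created {w : ℕ} (l : List (Tr r)) (hl : ∀ z ∈ l, w ≤ wt z) (y t : Tr r)
    (ht : t ∈ created y l) : wt y + w ≤ wt t := by
  induction l generalizing y with
  | nil => simp [created] at ht
  | cons z l ih =>
    have hz := hl z (by simp)
    have ih := ih (fun z hz => hl z (by simp [hz]))
    simp only [created, List.mem_append, List.mem_cons] at ht
    rcases ht with h | rfl | h
    · exact ih y h
    · simp only [wt]; omega
    · have := ih _ h
      simp only [wt] at this; omega

theorem count_leaf_created (l : List (Tr r)) (y : Tr r) (j : Fin r) (s : Bool) :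
    (created y l).count (leaf j s) = 0 := by
  induction l generalizing y with
  | nil => simp [created]
  | cons z l ih => simp [created, ih]

theorem count_br_created (l : List (Tr r)) (y a b : Tr r) :
    (created y l).count (br a b) ≤ l.count b * (y :: created y l).count a := by
  induction l generalizing y with
  | nil => simp [created]
  | cons z l ih =>
    have h1 := ih y
    have h2 := ih (br y z)
    simp only [created, List.count_append, List.count_cons, beq_iff_eq] at *
    generalize (if br y z = a then 1 else 0) = e at *
    by_cases hy : y = a <;> by_cases hz : z = b <;> simp only [hy, hz, and_self, and_false, false_and,
      br.injEq, if_true, if_false, add_zero] at * <;> grind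

theorem count_leaf_rest (q : List (Bool × Tr r)) (j : Fin r) (s : Bool) :
    (rest q).count (leaf j s) = (unmarked q).count (leaf j s) := by
  induction q with
  | nil => simp [rest, unmarked]
  | cons p q ih =>
    rcases p with ⟨_ | _, t⟩
    · have hu : unmarked ((false, t) :: q) = t :: unmarked q := by simp [unmarked]
      simp only [hu, rest, List.count_append, List.count_cons, count_leaf_created, ih]; omega
    · simpa [rest, unmarked] using ih

theorem count_br_rest (q : List (Bool × Tr r)) (a b : Tr r) :
    (rest q).count (br a b) ≤
      (unmarked q).count (br a b) + (marked q).count b * (rest q).count a := by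
  induction q with
  | nil => simp [rest]
  | cons p q ih =>
    rcases p with ⟨_ | _, t⟩
    · have hm : marked ((false, t) :: q) = marked q := by simp [marked]
      have hu : unmarked ((false, t) :: q) = t :: unmarked q := by simp [unmarked]
      have := count_br_created (marked q) t a b
      rw [hm, hu, rest]
      simp only [List.count_append, List.count_cons] at *
      nlinarith
    · have hm : marked ((true, t) :: q) = t :: marked q := by simp [marked]
      have hu : unmarked ((true, t) :: q) = unmarked q := by simp [unmarked]
      rw [hm, hu, rest]
      refine ih.trans (Nat.add_le_add_left (Nat.mul_le_mul_right _ ?_) _)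
      simp [List.count_cons]

theorem mem_rest {w : ℕ} (q : List (Bool × Tr r)) (hw : ∀ z ∈ marked q, w ≤ wt z) {t : Tr r}
    (ht : t ∈ rest q) : t ∈ unmarked q ∨ ∃ y ∈ unmarked q, wt y + w ≤ wt t := by
  induction q with
  | nil => simp [rest] at ht
  | cons p q ih =>
    rcases p with ⟨_ | _, y⟩
    · have hm : marked ((false, y) :: q) = marked q := by simp [marked]
      have hu : unmarked ((false, y) :: q) = y :: unmarked q := by simp [unmarked]
      rw [hm] at hw
      rw [hu]
      simp only [rest, List.mem_append, List.mem_cons] at ht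
      rcases ht with (rfl | h) | h
      · simp
      · exact Or.inr ⟨y, by simp, wt_created _ hw _ _ h⟩
      · rcases ih hw h with h | ⟨z, hz, h⟩
        · simp [h]
        · exact Or.inr ⟨z, by simp [hz], h⟩
    · have hm : marked ((true, y) :: q) = y :: marked q := by simp [marked]
      have hu : unmarked ((true, y) :: q) = unmarked q := by simp [unmarked]
      rw [hm] at hw
      rw [hu]
      exact ih (fun z hz => hw z (by simp [hz])) (by simpa [rest] using ht)

/-- A letter of minimal weight occurs in `rest q` only if it is an unmarked letter. -/
theorem count_rest_of_wt_le (q : List (Bool × Tr r)) {t : Tr r}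
    (hu : ∀ y ∈ unmarked q, wt t ≤ wt y) : (rest q).count t = (unmarked q).count t := by
  induction q with
  | nil => simp [rest, unmarked]
  | cons p q ih =>
    rcases p with ⟨_ | _, y⟩
    · have hu' : unmarked ((false, y) :: q) = y :: unmarked q := by simp [unmarked]
      rw [hu'] at hu ⊢
      have hc : (created y (marked q)).count t = 0 := by
        rw [List.count_eq_zero]
        intro h
        have := wt_created (w := 1) _ (fun z _ => wt_pos z) _ _ h
        have := hu y (by simp)
        omega
      have := ih (fun z hz => hu z (by simp [hz]))
      simp only [rest, List.count_append, List.count_cons, hc, this]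
      omega
    · have hu' : unmarked ((true, y) :: q) = unmarked q := by simp [unmarked]
      rw [hu'] at hu ⊢
      exact ih hu

/-- The word whose marked part is `l` and whose value is the conjugate of `l` by `h`. -/
def conjWord (l h : List (Tr r)) : List (Bool × Tr r) :=
  l.flatMap fun y => (true, y) :: (created y h).map fun t => (false, t)

theorem marked_conjWord (l h : List (Tr r)) : marked (conjWord l h) = l := by
  induction l with
  | nil => rfl
  | cons y l ih =>
    have : ∀ m : List (Tr r), (m.map fun t => (false, t)).filter (fun p => p.1) = [] := by
      intro m; simp
    simp only [marked, conjWord, List.flatMap_cons, List.filter_append, List.map_append] at *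
    rw [ih, List.filter_cons]
    simp

theorem unmarked_conjWord (l h : List (Tr r)) :
    unmarked (conjWord l h) = l.flatMap fun y => created y h := by
  induction l with
  | nil => rfl
  | cons y l ih =>
    simp only [unmarked, conjWord, List.flatMap_cons, List.filter_append, List.map_append] at *
    rw [ih, List.filter_cons]
    congr 1
    simp [List.filter_map, Function.comp_def]

theorem ev_conjWord (x : Fin r → G) (l h : List (Tr r)) :
    ev x ((conjWord l h).map Prod.snd) = (ev x h)⁻¹ * ev x l * ev x h := by
  induction l with
  | nil => simp [conjWord]
  | cons y l ih =>
    simp only [conjWord, List.flatMap_cons, List.map_append, ev_append] at *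
    rw [ih]
    simp only [List.map_cons, List.map_map, Function.comp_def, List.map_id', ev_cons, ev_created]
    group

theorem ev_comm (x : Fin r → G) (l h : List (Tr r)) :
    (ev x l)⁻¹ * (ev x h)⁻¹ * ev x l * ev x h = ev x (rest (conjWord l h)) := by
  have h1 := ev_rest x (conjWord l h)
  rw [ev_conjWord, marked_conjWord] at h1
  rw [← inv_mul_eq_iff_eq_mul] at h1
  rw [← h1]; group

/-- The recursive multiplicity bound for `rest`. -/
def bound (c d : Tr r → ℕ) : Tr r → ℕ
  | leaf j s => d (leaf j s)
  | br a b => d (br a b) + c b * bound c d a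

theorem count_rest_le {L : Fin r → ℕ} {c d : Tr r → ℕ} {q : List (Bool × Tr r)}
    (hc : ∀ t, (marked q).count t ≤ c t * size L t)
    (hd : ∀ t, (unmarked q).count t ≤ d t * size L t) (t : Tr r) :
    (rest q).count t ≤ bound c d t * size L t := by
  induction t with
  | leaf j s => rw [count_leaf_rest]; exact hd _
  | br a b iha _ =>
    refine (count_br_rest q a b).trans ?_
    have h1 := hd (br a b)
    have h2 := Nat.mul_le_mul (hc b) iha
    simp only [bound, size] at *
    nlinarith

/-- The recursive multiplicity bound for the letters created by conjugation. -/
def bound' (c d : Tr r → ℕ) : Tr r → ℕ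
  | leaf _ _ => 0
  | br a b => d b * bound d c a

theorem count_conjWord_le {L : Fin r → ℕ} {c d : Tr r → ℕ} {l h : List (Tr r)}
    (hc : ∀ t, l.count t ≤ c t * size L t) (hd : ∀ t, h.count t ≤ d t * size L t) (t : Tr r) :
    (unmarked (conjWord l h)).count t ≤ bound' c d t * size L t := by
  have key : ∀ t, (l.flatMap fun y => y :: created y h).count t ≤ bound d c t * size L t := by
    have e : ∀ l : List (Tr r), (l.flatMap fun y => y :: created y h) =
        rest (l.map (fun t => (false, t)) ++ h.map (fun t => (true, t))) ∧
        marked (l.map (fun t => (false, t)) ++ h.map (fun t => (true, t))) = h ∧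
        unmarked (l.map (fun t => (false, t)) ++ h.map (fun t => (true, t))) = l := by
      intro l
      induction l with
      | nil =>
        refine ⟨?_, ?_, ?_⟩
        · induction h with
          | nil => rfl
          | cons z h ih => 
            simp only [List.flatMap_nil, List.map_nil, List.nil_append, List.map_cons, rest] at *
            have : ∀ h : List (Tr r), rest (h.map fun t => (true, t)) = [] := by
              intro h
              induction h with
              | nil => rfl
              | cons z h ih => simpa [rest] using ih
            rw [this]
        · simp [marked, List.filter_map, Function.comp_def]
        · simp [unmarked, List.filter_map, Function.comp_def]
      | cons y l ih =>
        obtain ⟨h1, h2, h3⟩ := ih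
        refine ⟨?_, ?_, ?_⟩
        · simp only [List.flatMap_cons, List.map_cons, List.cons_append, rest, h1, h2]
        · simpa [marked] using h2
        · simpa [unmarked] using h3
    obtain ⟨h1, h2, h3⟩ := e l
    rw [h1]
    exact count_rest_le (by rwa [h2]) (by rwa [h3])
  rw [unmarked_conjWord]
  cases t with
  | leaf j s => simp [List.count_flatMap, Function.comp_def, count_leaf_created]
  | br a b =>
    have h1 : (l.flatMap fun y => created y h).count (br a b) ≤
        h.count b * (l.flatMap fun y => y :: created y h).count a := by
      clear key hc
      induction l with
      | nil => simp
      | cons y l ih =>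
        simp only [List.flatMap_cons, List.count_append] at *
        have := count_br_created h y a b
        nlinarith
    refine h1.trans ((Nat.mul_le_mul (hd b) (key a)).trans (le_of_eq ?_))
    simp only [bound', size]; ring

theorem count_created_replicate (y z : Tr r) (n : ℕ) :
    (created y (List.replicate n z)).count (br y z) = n := by
  induction n with
  | zero => simp [created]
  | succ n ih =>
    have : (created (br y z) (List.replicate n z)).count (br y z) = 0 := by
      rw [List.count_eq_zero]
      intro h
      have h := wt_created (w := 1) _ (fun z _ => wt_pos z) _ _ h
      omega
    simp only [List.replicate_succ, created, List.count_append, List.count_cons, ih, this]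
    simp

theorem mem_created_replicate {y z t : Tr r} {n : ℕ}
    (ht : t ∈ created y (List.replicate n z)) : t = br y z ∨ wt (br y z) < wt t := by
  induction n with
  | zero => simp [created] at ht
  | succ n ih =>
    simp only [List.replicate_succ, created, List.mem_append, List.mem_cons] at ht
    rcases ht with h | rfl | h
    · exact ih h
    · simp
    · right
      have h := wt_created (w := 1) _ (fun z _ => wt_pos z) _ _ h
      omega

end Tr

namespace Tr

variable {r s : ℕ} {ι : Type*} {G : ι → Type*} [∀ i, Group (G i)]
  (x : ∀ i, Fin r → G i) (L : ι → Fin r → ℕ)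

/-- Families of elements given by words in formal commutators of weight at least `w`, each
occurring boundedly often relative to its size. -/
def W (w : ℕ) : Subgroup (∀ i, G i) where
  carrier := {g | ∃ (c : Tr r → ℕ) (l : ι → List (Tr r)), ∀ i, ev (x i) (l i) = g i ∧
    (∀ t ∈ l i, w ≤ wt t) ∧ ∀ t, (l i).count t ≤ c t * size (L i) t}
  one_mem' := ⟨0, fun _ => [], by simp⟩
  mul_mem' := by
    rintro g h ⟨c, l, hl⟩ ⟨c', l', hl'⟩
    refine ⟨c + c', fun i => l i ++ l' i, fun i => ⟨?_, ?_, fun t => ?_⟩⟩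
    · simp [(hl i).1, (hl' i).1]
    · intro t ht
      rcases List.mem_append.1 ht with h | h
      exacts [(hl i).2.1 t h, (hl' i).2.1 t h]
    · have := (hl i).2.2 t
      have := (hl' i).2.2 t
      simp only [List.count_append, Pi.add_apply, add_mul]; omega
  inv_mem' := by
    rintro g ⟨c, l, hl⟩
    refine ⟨fun t => c (inv t), fun i => (l i).reverse.map inv, fun i => ⟨?_, ?_, fun t => ?_⟩⟩
    · rw [Pi.inv_apply, ← (hl i).1]
      have : ∀ m : List (Tr r), ev (x i) (m.reverse.map inv) = (ev (x i) m)⁻¹ := by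
        intro m
        induction m with
        | nil => simp
        | cons t m ih =>
          rw [List.reverse_cons, List.map_append, ev_append, ih]
          simp
      exact this _
    · intro t ht
      obtain ⟨z, hz, rfl⟩ := List.mem_map.1 ht
      simpa using (hl i).2.1 z (List.mem_reverse.1 hz)
    · have h1 : ((l i).reverse.map inv).count (inv (inv t)) = (l i).reverse.count (inv t) :=
        List.count_map_of_injective _ _ (Function.LeftInverse.injective inv_inv) _
      rw [inv_inv, List.count_reverse] at h1
      rw [h1]
      simpa using (hl i).2.2 (inv t)

variable {x L}

theorem W_mono {w w' : ℕ} (h : w ≤ w') : W x L w' ≤ W x L w := by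
  rintro g ⟨c, l, hl⟩
  exact ⟨c, l, fun i => ⟨(hl i).1, fun t ht => h.trans ((hl i).2.1 t ht), (hl i).2.2⟩⟩

theorem comm_mem_W {a b : ℕ} {g h : ∀ i, G i} (hg : g ∈ W x L a) (hh : h ∈ W x L b) :
    g⁻¹ * h⁻¹ * g * h ∈ W x L (a + b) := by
  obtain ⟨c, l, hl⟩ := hg
  obtain ⟨d, m, hm⟩ := hh
  refine ⟨bound c (bound' c d), fun i => rest (conjWord (l i) (m i)), fun i => ⟨?_, ?_, ?_⟩⟩
  · simp [← ev_comm, (hl i).1, (hm i).1]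
  · have hu : ∀ t ∈ unmarked (conjWord (l i) (m i)), a + b ≤ wt t := by
      intro t ht
      rw [unmarked_conjWord, List.mem_flatMap] at ht
      obtain ⟨y, hy, ht⟩ := ht
      have := wt_created _ (hm i).2.1 _ _ ht
      have := (hl i).2.1 y hy
      omega
    intro t ht
    rcases mem_rest (w := 0) _ (by simp) ht with h | ⟨y, hy, h⟩
    · exact hu t h
    · exact (hu y hy).trans h
  · exact count_rest_le (by rw [marked_conjWord]; exact (hl i).2.2)
      (count_conjWord_le (hl i).2.2 (hm i).2.2)

theorem conj_mem_W {w : ℕ} {g h : ∀ i, G i} (hg : g ∈ W x L w) (hh : h ∈ W x L 1) :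
    h⁻¹ * g * h ∈ W x L w := by
  have := mul_mem hg (W_mono (Nat.le_succ w) (comm_mem_W hg hh))
  convert this using 1
  group

theorem pow_mem_W {t : Tr r} {k : ι → ℕ} {c : ℕ} (hk : ∀ i, k i ≤ c * size (L i) t) :
    (fun i => val (x i) t ^ k i) ∈ W x L (wt t) := by
  refine ⟨fun _ => c, fun i => List.replicate (k i) t, fun i => ⟨by simp [ev], ?_, fun z => ?_⟩⟩
  · intro z hz
    rw [List.eq_of_mem_replicate hz]
  · rw [List.count_replicate]
    split_ifs with h
    · rw [← show t = z by simpa using h]; exact hk i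
    · exact Nat.zero_le _

/-- Words in a finite set of formal commutators of weight `w` and in formal commutators of larger
weight belong to every subgroup containing the corresponding bounded powers. -/
theorem mem_of_pow_mem {Γ : Subgroup (∀ i, G i)} {w : ℕ} (hW : W x L (w + 1) ≤ Γ) (S : Finset (Tr r))
    (hS : ∀ t ∈ S, wt t = w ∧ ∀ (k : ι → ℕ) (c : ℕ), (∀ i, k i ≤ c * size (L i) t) →
      (fun i => val (x i) t ^ k i) ∈ Γ)
    {c : Tr r → ℕ} {l : ι → List (Tr r)} (hl : ∀ i, ∀ t ∈ l i, t ∈ S ∨ w + 1 ≤ wt t)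
    (hc : ∀ i t, (l i).count t ≤ c t * size (L i) t) : (fun i => ev (x i) (l i)) ∈ Γ := by
  induction S using Finset.induction_on generalizing c l with
  | empty =>
    exact hW ⟨c, l, fun i => ⟨rfl, fun t ht => by simpa using hl i t ht, hc i⟩⟩
  | insert z S hz ih =>
    let q : ι → List (Bool × Tr r) := fun i => (l i).map fun t => (decide (t = z), t)
    have hq : ∀ i, (q i).map Prod.snd = l i := fun i => by simp [q, Function.comp_def]
    have hm : ∀ i, marked (q i) = List.replicate ((l i).count z) z := fun i => by
      simp only [marked, q, List.filter_map, List.map_map, Function.comp_def, List.map_id']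
      rw [← List.filter_beq]
      congr 1
    have hu : ∀ i, unmarked (q i) = (l i).filter (fun t => !decide (t = z)) := fun i => by
      simp [unmarked, q, List.filter_map, Function.comp_def]
    have key : (fun i => ev (x i) (rest (q i))) ∈ Γ := by
      refine ih (c := bound c c) (fun t ht => hS t (by simp [ht])) (fun i t ht => ?_) fun i t => ?_
      · have hwt : ∀ y ∈ l i, w ≤ wt y := by
          intro y hy
          rcases hl i y hy with h | h
          · exact (hS y h).1.ge
          · omega
        rcases mem_rest (w := 1) _ (fun y _ => wt_pos y) ht with h | ⟨y, hy, h⟩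
        · rw [hu, List.mem_filter] at h
          rcases hl i t h.1 with h' | h'
          · left
            exact Finset.mem_of_mem_insert_of_ne h' (by simpa using h.2)
          · exact Or.inr h'
        · rw [hu, List.mem_filter] at hy
          have := hwt y hy.1
          right; omega
      · refine count_rest_le (fun t => ?_) (fun t => ?_) t
        · rw [hm, List.count_replicate]
          split_ifs with h
          · rw [← show z = t by simpa using h]; exact hc i z
          · exact Nat.zero_le _
        · rw [hu]
          exact ((List.filter_sublist).count_le _).trans (hc i t)
    have h2 := mul_mem ((hS z (by simp)).2 (fun i => (l i).count z) (c z) fun i => hc i z) key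
    convert h2 using 1
    funext i
    have := ev_rest (x i) (q i)
    rw [hq, hm] at this
    rw [this]
    simp [ev]

theorem finite_wt (r w : ℕ) : {t : Tr r | wt t ≤ w}.Finite := by
  induction w with
  | zero =>
    refine Set.Finite.subset Set.finite_empty fun t ht => ?_
    have := wt_pos t
    simp only [Set.mem_ofPred_eq] at ht
    omega
  | succ w ih =>
    refine ((Set.finite_range fun p : Fin r × Bool => leaf p.1 p.2).union
      ((ih.prod ih).image fun p => br p.1 p.2)).subset ?_
    rintro (⟨j, s⟩ | ⟨a, b⟩) h
    · exact Or.inl ⟨(j, s), rfl⟩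
    · have := wt_pos a
      have := wt_pos b
      simp only [Set.mem_ofPred_eq, wt] at h
      refine Or.inr ⟨(a, b), ⟨?_, ?_⟩, rfl⟩ <;> simp <;> omega

/-- `[a^α, b^β] ≡ [a, b]^{αβ}` modulo higher weight. -/
theorem comm_pow_mem {a b : Tr r} {α β : ι → ℕ} {c : ℕ} (hα : ∀ i, α i ≤ c * size (L i) a)
    (hβ : ∀ i, β i ≤ c * size (L i) b) :
    (fun i => (val (x i) (br a b) ^ (α i * β i))⁻¹ * ((val (x i) a ^ α i)⁻¹ * (val (x i) b ^ β i)⁻¹ *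
      val (x i) a ^ α i * val (x i) b ^ β i)) ∈ W x L (wt (br a b) + 1) := by
  set t := br a b with ht
  let p : ι → List (Tr r) := fun i => rest (conjWord (List.replicate (α i) a) (List.replicate (β i) b))
  have hp : ∀ i, ev (x i) (p i) = (val (x i) a ^ α i)⁻¹ * (val (x i) b ^ β i)⁻¹ *
      val (x i) a ^ α i * val (x i) b ^ β i := fun i => by
    simp only [p, ← ev_comm]; simp [ev]
  have hu : ∀ i, ∀ z ∈ unmarked (conjWord (List.replicate (α i) a) (List.replicate (β i) b)),
      z = t ∨ wt t < wt z := fun i z hz => by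
    rw [unmarked_conjWord, List.mem_flatMap] at hz
    obtain ⟨y, hy, hz⟩ := hz
    rw [List.eq_of_mem_replicate hy] at hz
    exact mem_created_replicate hz
  have hu' : ∀ i, ∀ z ∈ unmarked (conjWord (List.replicate (α i) a) (List.replicate (β i) b)),
      wt t ≤ wt z := fun i z hz => by
    rcases hu i z hz with rfl | h
    exacts [le_rfl, h.le]
  have hcount : ∀ i, (p i).count t = α i * β i := fun i => by
    simp only [p]
    rw [count_rest_of_wt_le _ (hu' i), unmarked_conjWord, List.count_flatMap]
    simp [Function.comp_def, ht, count_created_replicate]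
  have hrep : ∀ (e : Tr r) (k : ι → ℕ), (∀ i, k i ≤ c * size (L i) e) → ∀ i z,
      (List.replicate (k i) e).count z ≤ (fun _ => c) z * size (L i) z := fun e k hk i z => by
    rw [List.count_replicate]
    split_ifs with h
    · rw [← show e = z by simpa using h]; exact hk i
    · exact Nat.zero_le _
  have hpc : ∀ i z, (p i).count z ≤ bound (fun _ => c) (bound' (fun _ => c) fun _ => c) z * size (L i) z :=
    fun i z => count_rest_le (by rw [marked_conjWord]; exact hrep a α hα i)
      (count_conjWord_le (hrep a α hα i) (hrep b β hβ i)) z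
  let q : ι → List (Bool × Tr r) := fun i => (p i).map fun z => (decide (z = t), z)
  have hq : ∀ i, (q i).map Prod.snd = p i := fun i => by simp [q, Function.comp_def]
  have hm : ∀ i, marked (q i) = List.replicate (α i * β i) t := fun i => by
    rw [← hcount]
    simp only [marked, q, List.filter_map, List.map_map, Function.comp_def, List.map_id']
    rw [← List.filter_beq]
    congr 1
  have hun : ∀ i, unmarked (q i) = (p i).filter (fun z => !decide (z = t)) := fun i => by
    simp [unmarked, q, List.filter_map, Function.comp_def]
  refine ⟨bound (bound (fun _ => c) (bound' (fun _ => c) fun _ => c))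
      (bound (fun _ => c) (bound' (fun _ => c) fun _ => c)), fun i => rest (q i),
      fun i => ⟨?_, ?_, ?_⟩⟩
  · have h1 := ev_rest (x i) (q i)
    rw [hq, hm, hp] at h1
    simp only [h1]
    simp [ev]
  · have hwt : ∀ z ∈ p i, z = t ∨ wt t < wt z := by
      intro z hz
      rcases mem_rest (w := 1) _ (fun y _ => wt_pos y) hz with h | ⟨y, hy, h⟩
      · exact hu i z h
      · have := hu' i y hy
        right; omega
    have hun' : ∀ z ∈ unmarked (q i), wt t + 1 ≤ wt z := by
      intro z hz
      rw [hun, List.mem_filter] at hz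
      rcases hwt z hz.1 with h | h
      · simp [h] at hz
      · exact h
    intro z hz
    rcases mem_rest (w := 0) _ (by simp) hz with h | ⟨y, hy, h⟩
    · exact hun' z h
    · exact (hun' y hy).trans h
  · refine count_rest_le (fun z => ?_) (fun z => ?_)
    · rw [hm, List.count_replicate]
      split_ifs with h
      · rw [← show t = z by simpa using h, ← hcount]; exact hpc i t
      · exact Nat.zero_le _
    · rw [hun]
      exact ((List.filter_sublist).count_le _).trans (hpc i z)

theorem comm_congr {a b : ℕ} (ha : 0 < a) (hb : 0 < b) {u v g h : ∀ i, G i} (hu : u ∈ W x L a)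
    (hv : v ∈ W x L b) (hg : g ∈ W x L (a + 1)) (hh : h ∈ W x L (b + 1)) :
    (u⁻¹ * v⁻¹ * u * v)⁻¹ * ((u * g)⁻¹ * (v * h)⁻¹ * (u * g) * (v * h)) ∈ W x L (a + b + 1) := by
  have h1 : ∀ {n} {y : ∀ i, G i}, 0 < n → y ∈ W x L n → y ∈ W x L 1 := fun hn hy => W_mono hn hy
  have hug : u * g ∈ W x L a := mul_mem hu (W_mono (Nat.le_succ _) hg)
  have e1 : (u * g)⁻¹ * h⁻¹ * (u * g) * h ∈ W x L (a + b + 1) :=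
    (comm_mem_W hug hh :)
  have huv := comm_mem_W hu hv
  have e2 : g⁻¹ * v⁻¹ * g * v ∈ W x L (a + b + 1) :=
    W_mono (by omega) (comm_mem_W hg hv)
  have e3 := W_mono (show a + b + 1 ≤ a + b + (a + 1) by omega) (comm_mem_W huv hg)
  have huv1 := h1 (by omega) huv
  have e4 := conj_mem_W e1 (h1 (by omega) hh)
  -- `[ug, vh] = [ug, h] ([u, v]^g [g, v])^h`
  have hX : (u⁻¹ * v⁻¹ * u * v) * ((u⁻¹ * v⁻¹ * u * v)⁻¹ * g⁻¹ * (u⁻¹ * v⁻¹ * u * v) * g) *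
      (g⁻¹ * v⁻¹ * g * v) ∈ W x L (a + b) :=
    mul_mem (mul_mem huv (W_mono (by omega) e3)) (W_mono (by omega) e2)
  have e5 := W_mono (show a + b + 1 ≤ a + b + (b + 1) by omega) (comm_mem_W hX hh)
  have e6 := conj_mem_W e1 huv1
  have := mul_mem (mul_mem e6 (mul_mem e3 e2)) e5
  convert this using 1
  group

variable (x L)

/-- The subgroup generated by bounded powers of the letters. -/
def segments : Subgroup (∀ i, G i) :=
  Subgroup.closure {g | ∃ (j : Fin r) (k : ι → ℤ) (c : ℕ), (∀ i, (k i).natAbs ≤ c * L i j) ∧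
    g = fun i => x i j ^ k i}

variable {x L}

theorem exists_pow_eq_mul (t : Tr r) (k : ι → ℕ) (c : ℕ) (hk : ∀ i, k i ≤ c * size (L i) t) :
    ∃ u ∈ segments x L, ∃ g ∈ W x L (wt t + 1), (fun i => val (x i) t ^ k i) = u * g := by
  induction t generalizing k c with
  | leaf j s =>
    refine ⟨_, Subgroup.subset_closure ⟨j, fun i => if s then (k i : ℤ) else -(k i : ℤ), c, ?_, rfl⟩,
      1, one_mem _, ?_⟩
    · intro i
      have := hk i
      cases s <;> simpa [size] using this
    · funext i
      cases s <;> simp [val]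
  | br a b iha ihb =>
    have key : ∀ (α β : ι → ℕ) (c : ℕ), (∀ i, α i ≤ c * size (L i) a) →
        (∀ i, β i ≤ c * size (L i) b) → ∃ u ∈ segments x L, ∃ g ∈ W x L (wt (br a b) + 1),
        (fun i => val (x i) (br a b) ^ (α i * β i)) = u * g := by
      intro α β c hα hβ
      obtain ⟨u, hu, g, hg, h1⟩ := iha α c hα
      obtain ⟨v, hv, h, hh, h2⟩ := ihb β c hβ
      have hu' : u ∈ W x L (wt a) := by
        rw [← mul_inv_eq_iff_eq_mul] at h1
        rw [← h1]
        exact mul_mem (pow_mem_W hα) (inv_mem (W_mono (Nat.le_succ _) hg))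
      have hv' : v ∈ W x L (wt b) := by
        rw [← mul_inv_eq_iff_eq_mul] at h2
        rw [← h2]
        exact mul_mem (pow_mem_W hβ) (inv_mem (W_mono (Nat.le_succ _) hh))
      have e1 := comm_congr (wt_pos a) (wt_pos b) hu' hv' hg hh
      have e2 := comm_pow_mem (x := x) hα hβ
      refine ⟨u⁻¹ * v⁻¹ * u * v, mul_mem (mul_mem (mul_mem (inv_mem hu) (inv_mem hv)) hu) hv, _,
        mul_mem e1 (inv_mem e2), ?_⟩
      rw [← h1, ← h2]
      funext i
      simp only [Pi.mul_apply, Pi.inv_apply]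
      group
    obtain ⟨u1, hu1, g1, hg1, h1⟩ := key (fun i => k i / size (L i) b) (fun i => size (L i) b) (c + 1)
      (fun i => by
        rcases Nat.eq_zero_or_pos (size (L i) b) with h | h
        · simp [h]
        · refine Nat.div_le_of_le_mul ((hk i).trans ?_)
          simp only [size]
          nlinarith [Nat.zero_le (size (L i) a * size (L i) b)])
      (fun i => by nlinarith [Nat.zero_le (c * size (L i) b)])
    obtain ⟨u2, hu2, g2, hg2, h2⟩ := key (fun i => min 1 (size (L i) a)) (fun i => k i % size (L i) b) 1
      (fun i => by simp)
      (fun i => by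
        rcases Nat.eq_zero_or_pos (size (L i) b) with h | h
        · have := hk i
          simp only [size, h, mul_zero, Nat.le_zero] at this
          simp [this]
        · simpa using (Nat.mod_lt _ h).le)
    have hu2' : u2 ∈ W x L 1 := by
      rw [← mul_inv_eq_iff_eq_mul] at h2
      rw [← h2]
      refine mul_mem (W_mono (wt_pos (br a b)) (pow_mem_W (c := 1) fun i => ?_))
        (inv_mem (W_mono (by omega) hg2))
      rcases Nat.eq_zero_or_pos (size (L i) b) with h | h
      · have := hk i
        simp only [size, h, mul_zero, Nat.le_zero] at this
        simp [this]
      · simp only [size, one_mul]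
        exact Nat.mul_le_mul (min_le_right _ _) (Nat.mod_lt _ h).le
    refine ⟨u1 * u2, mul_mem hu1 hu2, u2⁻¹ * g1 * u2 * g2,
      mul_mem (conj_mem_W hg1 hu2') hg2, ?_⟩
    have : u1 * u2 * (u2⁻¹ * g1 * u2 * g2) = (u1 * g1) * (u2 * g2) := by group
    rw [this, ← h1, ← h2]
    funext i
    simp only [Pi.mul_apply, ← pow_add]
    congr 1
    have hki := hk i
    rcases Nat.eq_zero_or_pos (size (L i) a) with h | h
    · simp only [size, h, zero_mul, mul_zero, Nat.le_zero] at hki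
      simp [hki]
    · rw [min_eq_left h, one_mul, mul_comm, Nat.div_add_mod]

theorem W_le_segments (hs : ∀ i, ∀ t : Tr r, s < wt t → val (x i) t = 1) {w : ℕ} :
    W x L w ≤ segments x L := by
  suffices ∀ n w, s + 1 ≤ w + n → W x L w ≤ segments x L from this (s + 1) w (by omega)
  intro n
  induction n with
  | zero =>
    rintro w hw g ⟨c, l, hl⟩
    have : g = 1 := by
      funext i
      rw [← (hl i).1]
      refine List.prod_eq_one fun y hy => ?_
      obtain ⟨t, ht, rfl⟩ := List.mem_map.1 hy
      exact hs i t (by have := (hl i).2.1 t ht; omega)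
    rw [this]; exact one_mem _
  | succ n ih =>
    rintro w hw g ⟨c, l, hl⟩
    have hW : W x L (w + 1) ≤ segments x L := ih (w + 1) (by omega)
    have hfin : {t : Tr r | wt t = w}.Finite := (finite_wt r w).subset fun t ht => le_of_eq ht
    have := mem_of_pow_mem hW hfin.toFinset (c := c) (l := l) (fun t ht => ?_) (fun i t ht => ?_)
      (fun i => (hl i).2.2)
    · convert this using 1
      funext i
      exact ((hl i).1).symm
    · rw [Set.Finite.mem_toFinset, Set.mem_ofPred_eq] at ht
      refine ⟨ht, fun k c hk => ?_⟩
      obtain ⟨u, hu, g, hg, h⟩ := exists_pow_eq_mul (x := x) t k c hk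
      rw [h]
      exact mul_mem hu (hW (ht ▸ hg))
    · rw [Set.Finite.mem_toFinset, Set.mem_ofPred_eq]
      have := (hl i).2.1 t ht
      omega

end Tr

theorem commutator_commutator_le_of_rotate {G : Type*} [Group G] {A B C N : Subgroup G} [N.Normal]
    (h1 : ⁅⁅B, C⁆, A⁆ ≤ N) (h2 : ⁅⁅C, A⁆, B⁆ ≤ N) : ⁅⁅A, B⁆, C⁆ ≤ N := by
  have key : ∀ H : Subgroup G, H ≤ N ↔ H.map (QuotientGroup.mk' N) = ⊥ := fun H => by
    rw [Subgroup.map_eq_bot_iff, QuotientGroup.ker_mk']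
  simp only [key, Subgroup.map_commutator] at *
  exact Subgroup.commutator_commutator_eq_bot_of_rotate h1 h2

open Subgroup in
theorem commutator_lowerCentralSeries_le {G : Type*} [Group G] (i j : ℕ) :
    ⁅(⊤ : Subgroup G).lowerCentralSeries i, (⊤ : Subgroup G).lowerCentralSeries j⁆ ≤
      (⊤ : Subgroup G).lowerCentralSeries (i + j + 1) := by
  induction j generalizing i with
  | zero => exact le_of_eq rfl
  | succ j ih =>
    rw [commutator_comm, Subgroup.lowerCentralSeries_succ _ j]
    refine commutator_commutator_le_of_rotate ?_ ?_
    · rw [commutator_comm ⊤, ← Subgroup.lowerCentralSeries_succ]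
      exact (ih (i + 1)).trans (le_of_eq (by congr 1; omega))
    · exact commutator_mono (ih i) le_rfl

theorem val_mem_lowerCentralSeries {r : ℕ} {G : Type*} [Group G] (x : Fin r → G) (t : Tr r) :
    t.val x ∈ (⊤ : Subgroup G).lowerCentralSeries (t.wt - 1) := by
  induction t with
  | leaf j s => simp [Tr.wt]
  | br a b iha ihb =>
    have h := commutator_lowerCentralSeries_le _ _
      (Subgroup.commutator_mem_commutator (inv_mem iha) (inv_mem ihb))
    have := a.wt_pos
    have := b.wt_pos
    rw [show a.wt - 1 + (b.wt - 1) + 1 = (Tr.br a b).wt - 1 by simp only [Tr.wt]; omega] at h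
    simpa [commutatorElement_def, Tr.val] using h

/-- A word with bounded multiplicities in a nilpotent group of bounded class. -/
structure BoundedWord (r s : ℕ) : Type (u + 1) where
  /-- the ambient group -/
  G : Type u
  /-- its group structure -/
  [group : Group G]
  /-- the letters -/
  x : Fin r → G
  /-- the multiplicities -/
  L : Fin r → ℕ
  /-- the value -/
  g : G
  nilpotent : (⊤ : Subgroup G).lowerCentralSeries s = ⊥
  mem : g ∈ GenProgression x L

attribute [instance] BoundedWord.group

open scoped Pointwise in
/-- In a nilpotent group a word in which each letter `xᵢ` occurs at most `Lᵢ` times is a product of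
boundedly many powers `xᵢ ^ j` with `|j| ≤ Lᵢ`. -/
theorem exists_genProgression_subset (r s : ℕ) : ∃ f : ℕ, ∀ (G : Type u) [Group G],
    (⊤ : Subgroup G).lowerCentralSeries s = ⊥ → ∀ (x : Fin r → G) (L : Fin r → ℕ),
    GenProgression x L ⊆ ({1} ∪ {g | ∃ (i : Fin r) (j : ℤ), j.natAbs ≤ L i ∧ g = x i ^ j}) ^ f := by
  let x : ∀ i : BoundedWord.{u} r s, Fin r → i.G := fun i => i.x
  let L : BoundedWord.{u} r s → Fin r → ℕ := fun i => i.L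
  let U : ∀ i : BoundedWord.{u} r s, Set i.G := fun i =>
    {1} ∪ {g | ∃ (j : Fin r) (k : ℤ), k.natAbs ≤ L i j ∧ g = x i j ^ k}
  have hU1 : ∀ i, (1 : i.G) ∈ U i := fun i => Or.inl rfl
  have hUi : ∀ i, (U i)⁻¹ = U i := by
    have : ∀ i, ∀ g ∈ U i, g⁻¹ ∈ U i := by
      rintro i g (rfl | ⟨j, k, hk, rfl⟩)
      · simpa using hU1 i
      · exact Or.inr ⟨j, -k, by simpa using hk, by simp⟩
    intro i
    ext g
    exact ⟨fun h => by simpa using this i _ h, fun h => this i _ h⟩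
  have h1 : (fun i : BoundedWord.{u} r s => i.g) ∈ Tr.W x L 1 := by
    choose w hw hg using fun i : BoundedWord.{u} r s => i.mem
    refine ⟨fun _ => 1, fun i => (w i).map fun p => Tr.leaf p.1 p.2, fun i => ⟨?_, ?_, ?_⟩⟩
    · simp only [← hg i]
      simp [Tr.ev, Function.comp_def, Tr.val, x]
    · intro t _
      exact t.wt_pos
    · rintro (⟨j, e⟩ | ⟨a, b⟩)
      · have h := hw i j
        refine le_trans ?_ (h.trans (by simp [Tr.size, L]))
        simp only [List.count, List.countP_map]
        refine List.countP_mono_left ?_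
        rintro ⟨j', e'⟩ _ h
        simp only [Function.comp_apply, beq_iff_eq, Tr.leaf.injEq] at h ⊢
        exact h.1
      · rw [List.count_eq_zero.2]
        · exact Nat.zero_le _
        · simp
  have h2 := Tr.W_le_segments (s := s) (fun i t ht => by
    have h := val_mem_lowerCentralSeries (x i) t
    have h' := Subgroup.lowerCentralSeries_antitone ⊤ (show s ≤ t.wt - 1 by omega) h
    rwa [i.nilpotent, Subgroup.mem_bot] at h') h1
  have h3 : ∀ g ∈ Tr.segments x L, ∃ f, ∀ i, g i ∈ U i ^ f := by
    intro g hg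
    induction hg using Subgroup.closure_induction with
    | mem g hg =>
      obtain ⟨j, k, c, hk, rfl⟩ := hg
      have key : ∀ (i : BoundedWord.{u} r s) (c : ℕ) (n : ℤ), n.natAbs ≤ c * L i j →
          x i j ^ n ∈ U i ^ c := by
        intro i c
        induction c with
        | zero =>
          intro n hn
          have : n = 0 := by simpa using hn
          simp [this]
        | succ c ih =>
          intro n hn
          rw [Nat.succ_mul] at hn
          obtain ⟨n', m, hnm, hn', hm⟩ : ∃ n' m : ℤ, n = n' + m ∧ n'.natAbs ≤ c * L i j ∧
              m.natAbs ≤ L i j := by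
            generalize c * L i j = q at hn
            rcases le_or_gt n.natAbs (L i j) with h | h
            · exact ⟨0, n, by simp, by simp, h⟩
            · rcases le_total 0 n with h0 | h0
              · exact ⟨n - L i j, L i j, by ring, by omega, by omega⟩
              · exact ⟨n + L i j, -L i j, by ring, by omega, by omega⟩
          rw [hnm, zpow_add, pow_succ]
          exact Set.mul_mem_mul (ih n' hn') (Or.inr ⟨j, m, hm, rfl⟩)
      exact ⟨c, fun i => key i c _ (hk i)⟩
    | one => exact ⟨0, fun i => by simp⟩
    | mul g h _ _ hg hh =>
      obtain ⟨f, hf⟩ := hg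
      obtain ⟨f', hf'⟩ := hh
      exact ⟨f + f', fun i => by rw [pow_add]; exact Set.mul_mem_mul (hf i) (hf' i)⟩
    | inv g _ hg =>
      obtain ⟨f, hf⟩ := hg
      refine ⟨f, fun i => ?_⟩
      have : (U i ^ f)⁻¹ = U i ^ f := by rw [← inv_pow, hUi]
      rw [← this]
      simpa using hf i
  obtain ⟨f, hf⟩ := h3 _ h2
  refine ⟨f, fun G _ hG y M g hg => ?_⟩
  exact hf ⟨G, y, M, g, hG, hg⟩

section Cover
variable {G : Type*} [Group G]

/-- `A` is covered by `n` left translates of `B`. -/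
def Cov (n : ℕ) (A B : Set G) : Prop := ∃ X : Finset G, X.card ≤ n ∧ A ⊆ (X : Set G) * B

theorem Cov.mono {n n' : ℕ} {A A' B B' : Set G} (h : Cov n A B) (hn : n ≤ n') (hA : A' ⊆ A)
    (hB : B ⊆ B') : Cov n' A' B' := by
  obtain ⟨X, hX, hXA⟩ := h
  exact ⟨X, hX.trans hn, hA.trans (hXA.trans (Set.mul_subset_mul_left hB))⟩

theorem Cov.refl (A : Set G) : Cov 1 A A := ⟨{1}, by simp, by simp⟩

open Classical in
theorem Cov.trans {n m : ℕ} {A B C : Set G} (h : Cov n A B) (h' : Cov m B C) :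
    Cov (n * m) A C := by
  obtain ⟨X, hX, hXA⟩ := h
  obtain ⟨Y, hY, hYB⟩ := h'
  refine ⟨X * Y, Finset.card_mul_le.trans (Nat.mul_le_mul hX hY), ?_⟩
  rw [Finset.coe_mul, mul_assoc]
  exact hXA.trans (Set.mul_subset_mul_left hYB)

theorem Cov.mul_right {n : ℕ} {A B : Set G} (h : Cov n A B) (C : Set G) :
    Cov n (A * C) (B * C) := by
  obtain ⟨X, hX, hXA⟩ := h
  exact ⟨X, hX, by rw [← mul_assoc]; exact Set.mul_subset_mul_right hXA⟩

/-- The translating elements may be taken in the covered set at the cost of squaring. -/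
theorem Cov.refine {n : ℕ} {S B : Set G} (h : Cov n S B) :
    ∃ Y : Finset G, Y.card ≤ n ∧ (Y : Set G) ⊆ S ∧ S ⊆ (Y : Set G) * ((B⁻¹ * B) ∩ (S⁻¹ * S)) := by
  classical
  obtain ⟨X, hX, hXA⟩ := h
  have : ∀ x : G, ∃ s : G, (∃ t ∈ S, t ∈ x • B) → s ∈ S ∧ s ∈ x • B := fun x => by
    by_cases h : ∃ t ∈ S, t ∈ x • B
    · obtain ⟨t, ht⟩ := h
      exact ⟨t, fun _ => ht⟩
    · exact ⟨1, fun h' => absurd h' h⟩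
  choose f hf using this
  refine ⟨(X.filter fun x => ∃ t ∈ S, t ∈ x • B).image f, ?_, ?_, ?_⟩
  · exact Finset.card_image_le.trans ((Finset.card_filter_le _ _).trans hX)
  · intro y hy
    simp only [Finset.coe_image, Set.mem_image, Finset.mem_coe, Finset.mem_filter] at hy
    obtain ⟨x, ⟨_, hx⟩, rfl⟩ := hy
    exact (hf x hx).1
  · intro s hs
    obtain ⟨x, hx, b, hb, rfl⟩ := Set.mem_mul.1 (hXA hs)
    have hxb : ∃ t ∈ S, t ∈ x • B := ⟨x * b, hs, b, hb, rfl⟩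
    obtain ⟨h1, b', hb', h2⟩ := hf x hxb
    have h2 : x * b' = f x := h2
    refine Set.mem_mul.2 ⟨f x, ?_, (f x)⁻¹ * (x * b), ⟨?_, ?_⟩, by group⟩
    · exact Finset.mem_coe.2 (Finset.mem_image.2 ⟨x, Finset.mem_filter.2 ⟨hx, hxb⟩, rfl⟩)
    · rw [← h2]
      exact Set.mem_mul.2 ⟨b'⁻¹, Set.inv_mem_inv.2 hb', b, hb, by group⟩
    · exact Set.mem_mul.2 ⟨_, Set.inv_mem_inv.2 h1, _, hs, rfl⟩

theorem Cov.ncard_le {n : ℕ} {A B : Set G} (h : Cov n A B) (hB : B.Finite) :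
    A.ncard ≤ n * B.ncard := by
  classical
  obtain ⟨X, hX, hXA⟩ := h
  refine (Set.ncard_le_ncard hXA (X.finite_toSet.mul hB)).trans ?_
  lift B to Finset G using hB
  rw [← Finset.coe_mul, Set.ncard_coe_finset, Set.ncard_coe_finset]
  exact Finset.card_mul_le.trans (Nat.mul_le_mul_right _ hX)

/-- A finite approximate subgroup with an integral parameter. -/
structure Apx (k : ℕ) (A : Set G) : Prop where
  finite : A.Finite
  inv : A⁻¹ = A
  one : (1 : G) ∈ A
  cov : Cov k (A * A) A

variable {k : ℕ} {A : Set G}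

namespace Apx

theorem inv_mem (hA : Apx k A) {a : G} (ha : a ∈ A) : a⁻¹ ∈ A := by
  rw [← hA.inv]; simpa using ha

theorem pow_inv (hA : Apx k A) (m : ℕ) : (A ^ m)⁻¹ = A ^ m := by rw [← inv_pow, hA.inv]

theorem pow_inv_mem (hA : Apx k A) {m : ℕ} {a : G} (ha : a ∈ A ^ m) : a⁻¹ ∈ A ^ m := by
  rw [← hA.pow_inv m]; simpa using ha

theorem pow_mono (hA : Apx k A) {m n : ℕ} (h : m ≤ n) : A ^ m ⊆ A ^ n :=
  Set.pow_subset_pow_right hA.one h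

theorem one_pow (hA : Apx k A) (m : ℕ) : (1 : G) ∈ A ^ m := Set.one_mem_pow hA.one

theorem mul_mem (_hA : Apx k A) {m n : ℕ} {a b : G} (ha : a ∈ A ^ m) (hb : b ∈ A ^ n) :
    a * b ∈ A ^ (m + n) := by
  rw [pow_add]; exact Set.mul_mem_mul ha hb

theorem pow_finite (hA : Apx k A) (m : ℕ) : (A ^ m).Finite := by
  induction m with
  | zero => simp
  | succ m ih => rw [pow_succ]; exact ih.mul hA.finite

theorem cov_pow (hA : Apx k A) (m : ℕ) : Cov (k ^ m) (A ^ (m + 1)) A := by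
  induction m with
  | zero => simpa using Cov.refl A
  | succ m ih =>
    rw [pow_succ A (m + 1), pow_succ k]
    exact (ih.mul_right A).trans hA.cov

theorem ncard_pow_le (hA : Apx k A) (m : ℕ) : (A ^ (m + 1)).ncard ≤ k ^ m * A.ncard :=
  (hA.cov_pow m).ncard_le hA.finite

theorem ncard_pos (hA : Apx k A) : 0 < A.ncard := (Set.ncard_pos hA.finite).2 ⟨1, hA.one⟩

theorem pos (hA : Apx k A) : 0 < k := by
  rcases Nat.eq_zero_or_pos k with rfl | h
  · have := hA.ncard_pow_le 1
    have h2 := (Set.ncard_pos (hA.pow_finite 2)).2 ⟨1, hA.one_pow 2⟩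
    simp at this
    simp [this] at h2
  · exact h

/-- Powers of `A` meet a subgroup in few translates of `A² ∩ C`. -/
theorem cov_inter (hA : Apx k A) (C : Subgroup G) (m : ℕ) :
    ∃ Y : Finset G, Y.card ≤ k ^ m ∧ (Y : Set G) ⊆ A ^ (m + 1) ∩ C ∧
      A ^ (m + 1) ∩ C ⊆ (Y : Set G) * (A ^ 2 ∩ C) := by
  obtain ⟨Y, h1, h2, h3⟩ :=
    ((hA.cov_pow m).mono le_rfl Set.inter_subset_left le_rfl : Cov _ (A ^ (m + 1) ∩ C) A).refine
  refine ⟨Y, h1, h2, h3.trans (Set.mul_subset_mul_left (Set.inter_subset_inter ?_ ?_))⟩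
  · rw [hA.inv, sq]
  · rintro _ ⟨a, ha, b, hb, rfl⟩
    exact C.mul_mem (by simpa using C.inv_mem ha.2) hb.2

theorem image {G' : Type*} [Group G'] (hA : Apx k A) (f : G →* G') : Apx k (f '' A) := by
  classical
  refine ⟨hA.finite.image f, ?_, ⟨1, hA.one, map_one f⟩, ?_⟩
  · rw [← Set.image_inv, hA.inv]
  · obtain ⟨X, hX, hXA⟩ := hA.cov
    refine ⟨X.image f, Finset.card_image_le.trans hX, ?_⟩
    rw [← Set.image_mul, Finset.coe_image, ← Set.image_mul]
    exact Set.image_mono hXA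

/-- `A^m ∩ C` is an approximate subgroup of `C`. -/
theorem subgroup (hA : Apx k A) (C : Subgroup G) {m : ℕ} (hm : 2 ≤ m) :
    Apx (k ^ (2 * m - 1)) ((↑) ⁻¹' (A ^ m) : Set C) := by
  classical
  refine ⟨(hA.pow_finite m).preimage Subtype.val_injective.injOn, ?_, hA.one_pow m, ?_⟩
  · ext g
    simp only [Set.mem_inv, Set.mem_preimage, Subgroup.coe_inv]
    exact ⟨fun h => by simpa using hA.pow_inv_mem h, fun h => hA.pow_inv_mem h⟩
  · obtain ⟨Y, h1, h2, h3⟩ := hA.cov_inter C (2 * m - 1)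
    rw [show 2 * m - 1 + 1 = m + m by omega] at h2 h3
    refine ⟨Y.preimage (↑) Subtype.val_injective.injOn, ?_, ?_⟩
    · refine le_trans ?_ h1
      rw [Finset.card_preimage]
      exact Finset.card_filter_le _ _
    · rintro _ ⟨a, ha, b, hb, rfl⟩
      obtain ⟨y, hy, c, hc, h⟩ := Set.mem_mul.1 (h3 ⟨hA.mul_mem ha hb, (a * b).2⟩)
      refine Set.mem_mul.2 ⟨⟨y, (h2 hy).2⟩, by simpa using hy, ⟨c, hc.2⟩, hA.pow_mono hm hc.1, ?_⟩
      exact Subtype.ext h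

end Apx

/-- If the translates `B s`, `s ∈ S`, are disjoint then `|S| |B| ≤ |B S|`. -/
theorem card_mul_ncard_le {B D : Set G} (hD : D.Finite) (S : Finset G)
    (hBS : ∀ b ∈ B, ∀ s ∈ S, b * s ∈ D) (hS : ∀ s ∈ S, ∀ t ∈ S, s * t⁻¹ ∈ B⁻¹ * B → s = t) :
    S.card * B.ncard ≤ D.ncard := by
  have hinj : Set.InjOn (fun p : G × G => p.2 * p.1) ((S : Set G) ×ˢ B) := by
    rintro ⟨s, b⟩ ⟨hs, hb⟩ ⟨t, c⟩ ⟨ht, hc⟩ h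
    simp only at h hs hb ht hc
    have : s * t⁻¹ = b⁻¹ * c := by
      rw [eq_inv_mul_iff_mul_eq, ← mul_assoc, h]; group
    have hst := hS s hs t ht (this ▸ Set.mul_mem_mul (Set.inv_mem_inv.2 hb) hc)
    subst hst
    simpa using h
  have h1 := hinj.ncard_image
  rw [Set.ncard_prod, Set.ncard_coe_finset] at h1
  rw [← h1]
  refine Set.ncard_le_ncard ?_ hD
  rintro _ ⟨⟨s, b⟩, ⟨hs, hb⟩, rfl⟩
  exact hBS b hb s hs

end Cover

section Tower
variable {G : Type*} [Group G]

/-- A chain of subgroups normalised by `C` whose steps alternate between extensions covered by `B`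
and central extensions. -/
inductive Tower (B : Set G) (C : Subgroup G) : ℕ → Subgroup G → Prop
  | zero : Tower B C 0 ⊥
  | succ {n : ℕ} {H T H' : Subgroup G} (tower : Tower B C n H) (le : H ≤ T)
      (cover : (T : Set G) ⊆ B * H) (normal : ∀ c ∈ C, ∀ t ∈ T, c * t * c⁻¹ ∈ T) (le' : T ≤ H')
      (central : ∀ c ∈ C, ∀ h ∈ H', ⁅c, h⁆ ∈ T) : Tower B C (n + 1) H'

theorem Tower.anti {B : Set G} {C C' : Subgroup G} (hC : C' ≤ C) {n : ℕ} {H : Subgroup G}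
    (h : Tower B C n H) : Tower B C' n H := by
  induction h with
  | zero => exact .zero
  | succ _ le cover normal le' central ih =>
    exact .succ ih le cover (fun c hc => normal c (hC hc)) le' (fun c hc => central c (hC hc))

theorem conj_mem_of_mem_closure {S : Set G} {T : Subgroup G}
    (h : ∀ s ∈ S, ∀ t ∈ T, s * t * s⁻¹ ∈ T) (h' : ∀ s ∈ S, ∀ t ∈ T, s⁻¹ * t * s ∈ T) {c : G}
    (hc : c ∈ Subgroup.closure S) {t : G} (ht : t ∈ T) : c * t * c⁻¹ ∈ T := by
  have key : ∀ c ∈ Subgroup.closure S, (∀ t ∈ T, c * t * c⁻¹ ∈ T) ∧ ∀ t ∈ T, c⁻¹ * t * c ∈ T := by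
    intro c hc
    induction hc using Subgroup.closure_induction with
    | mem c hc => exact ⟨h c hc, h' c hc⟩
    | one => simp
    | mul a b _ _ ha hb =>
      refine ⟨fun t ht => ?_, fun t ht => ?_⟩
      · convert ha.1 _ (hb.1 t ht) using 1; group
      · convert hb.2 _ (ha.2 t ht) using 1; group
    | inv a _ ha => exact ⟨by simpa using ha.2, by simpa using ha.1⟩
  exact (key c hc).1 t ht

/-- The centraliser of `h` in `C` modulo a subgroup `T` normalised by `C`. -/
def centMod (C T : Subgroup G) (hT : ∀ c ∈ C, ∀ t ∈ T, c * t * c⁻¹ ∈ T) (h : G) : Subgroup G where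
  carrier := {c | c ∈ C ∧ ⁅c, h⁆ ∈ T}
  one_mem' := ⟨C.one_mem, by simp⟩
  mul_mem' := by
    rintro a b ⟨ha, ha'⟩ ⟨hb, hb'⟩
    refine ⟨C.mul_mem ha hb, ?_⟩
    convert T.mul_mem (hT a ha _ hb') ha' using 1
    simp only [commutatorElement_def]; group
  inv_mem' := by
    rintro a ⟨ha, ha'⟩
    refine ⟨C.inv_mem ha, ?_⟩
    convert hT a⁻¹ (C.inv_mem ha) _ (T.inv_mem ha') using 1
    simp only [commutatorElement_def]; group

/-- The state of the construction of the tower. -/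
structure TowerState (k : ℕ) (A : Set G) (C H : Subgroup G) (n : ℕ) : Prop where
  le : H ≤ C
  norm : ∀ c ∈ C, ∀ h ∈ H, c * h * c⁻¹ ∈ H
  gen : H ≤ Subgroup.closure (A ^ 6 ∩ H)
  cgen : C ≤ Subgroup.closure (A ^ 2 ∩ C) ⊔ H
  sep : ∃ S : Finset G, S.card = n ∧ (S : Set G) ⊆ A ^ 6 ∩ H ∧
    ∀ s ∈ S, ∀ t ∈ S, s * t⁻¹ ∈ A ^ 2 → s = t
  cov : Cov (k ^ (15 * n)) A C
  tower : Tower (A ^ 2) C n H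

variable {k n : ℕ} {A : Set G} {C H : Subgroup G}

theorem TowerState.le_pow (hA : Apx k A) (h : TowerState k A C H n) : n ≤ k ^ 6 := by
  obtain ⟨S, rfl, hS, hsep⟩ := h.sep
  have h1 := card_mul_ncard_le (B := A) (hA.pow_finite 7) S
    (fun b hb s hs => hA.mul_mem (m := 1) (by simpa using hb) (hS hs).1)
    (by rw [hA.inv, ← sq]; exact hsep)
  exact Nat.le_of_mul_le_mul_right (h1.trans (hA.ncard_pow_le 6)) hA.ncard_pos

theorem cov_inter_of_cov (hA : Apx k A) {m : ℕ} (h : Cov m A C) : Cov m A (A ^ 2 ∩ C) := by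
  obtain ⟨Y, h1, _, h3⟩ := h.refine
  refine ⟨Y, h1, h3.trans (Set.mul_subset_mul_left ?_)⟩
  rintro _ ⟨⟨a, ha, b, hb, rfl⟩, hab⟩
  rw [hA.inv, ← sq] at hab
  exact ⟨hab, C.mul_mem (by simpa using C.inv_mem ha) hb⟩

theorem TowerState.step [hG : Group.IsNilpotent G] (hA : Apx k A) (h : TowerState k A C H n)
    (hn : ¬ A ^ 6 ∩ C ⊆ A ^ 2 * H) : ∃ C' H' : Subgroup G, TowerState k A C' H' (n + 1) := by
  classical
  let Z := Subgroup.upperCentralSeries G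
  have hZ0 : Z 0 = ⊥ := Subgroup.upperCentralSeries_zero G
  obtain ⟨l, hl⟩ : ∃ l, Z l = ⊤ := hG.nilpotent
  have hex : ∃ j, ¬ A ^ 6 ∩ C ∩ (Z j ⊔ H : Subgroup G) ⊆ A ^ 2 * (H : Set G) :=
    ⟨l, by rw [hl]; simpa using hn⟩
  obtain ⟨i, hi⟩ : ∃ i, Nat.find hex = i + 1 := by
    refine Nat.exists_eq_succ_of_ne_zero fun h0 => ?_
    have := Nat.find_spec hex
    rw [h0, hZ0] at this
    refine this fun g hg => ?_
    exact ⟨1, hA.one_pow 2, g, by simpa using hg.2, one_mul g⟩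
  have hmin : A ^ 6 ∩ C ∩ (Z i ⊔ H : Subgroup G) ⊆ A ^ 2 * (H : Set G) :=
    not_not.1 (Nat.find_min hex (m := i) (by omega))
  have hspec := Nat.find_spec hex
  rw [hi] at hspec
  obtain ⟨x, ⟨⟨hx6, hxC⟩, hxZ⟩, hxH⟩ := Set.not_subset.1 hspec
  set D : Subgroup G := Z i ⊔ H with hD
  have hHD : H ≤ D := le_sup_right
  have hxD : ∀ c ∈ C, ⁅c, x⁆ ∈ D := by
    intro c hc
    rw [SetLike.mem_coe, ← SetLike.mem_coe, Subgroup.normal_mul] at hxZ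
    obtain ⟨z, hz, u, hu, rfl⟩ := hxZ
    have hz' : ∀ y, ⁅z, y⁆ ∈ Z i := Subgroup.mem_upperCentralSeries_succ_iff.1 hz
    have h1 : ⁅c, z⁆ ∈ D := by
      rw [← commutatorElement_inv]
      exact D.inv_mem (le_sup_left (a := Z i) (hz' c))
    have h2 : ⁅c, u⁆ ∈ D := hHD (by
      rw [commutatorElement_def]; exact H.mul_mem (h.norm c hc u hu) (H.inv_mem hu))
    have h3 : ⁅z, ⁅c, u⁆⁆ ∈ D := le_sup_left (a := Z i) (hz' _)
    convert D.mul_mem h1 (D.mul_mem h3 h2) using 1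
    simp only [commutatorElement_def]; group
  have hnD : ∀ c ∈ C, ∀ d ∈ D, c * d * c⁻¹ ∈ D := by
    intro c hc d hd
    rw [← SetLike.mem_coe, Subgroup.normal_mul] at hd
    obtain ⟨z, hz, u, hu, rfl⟩ := hd
    have h1 : c * z * c⁻¹ ∈ Z i := (inferInstance : (Z i).Normal).conj_mem z hz c
    convert D.mul_mem (le_sup_left (a := Z i) h1) (hHD (h.norm c hc u hu)) using 1
    group
  have hmem : ∀ a ∈ A ^ 6, a ∈ C → a ∈ D → a ∈ A ^ 2 * (H : Set G) := fun a h1 h2 h3 =>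
    hmin ⟨⟨h1, h2⟩, h3⟩
  -- the subgroup `A² H ∩ C ∩ D`
  have hdec : ∀ g, g ∈ C → g ∈ D → g ∈ A ^ 2 * (H : Set G) →
      ∃ a ∈ A ^ 2, a ∈ C ∧ a ∈ D ∧ ∃ u ∈ H, g = a * u := by
    rintro _ hC hD ⟨a, ha, u, hu, rfl⟩
    refine ⟨a, ha, ?_, ?_, u, hu, rfl⟩
    · simpa using C.mul_mem hC (C.inv_mem (h.le hu))
    · simpa using D.mul_mem hD (D.inv_mem (hHD hu))
  have hone : (1 : G) ∈ A ^ 2 * (H : Set G) := ⟨1, hA.one_pow 2, 1, H.one_mem, one_mul 1⟩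
  let T : Subgroup G :=
    { carrier := {g | g ∈ C ∧ g ∈ D ∧ g ∈ A ^ 2 * (H : Set G)}
      one_mem' := ⟨C.one_mem, D.one_mem, hone⟩
      mul_mem' := by
        rintro g g' ⟨h1, h2, h3⟩ ⟨h1', h2', h3'⟩
        refine ⟨C.mul_mem h1 h1', D.mul_mem h2 h2', ?_⟩
        obtain ⟨a, ha, haC, haD, u, hu, rfl⟩ := hdec g h1 h2 h3
        obtain ⟨b, hb, hbC, hbD, v, hv, rfl⟩ := hdec g' h1' h2' h3'
        obtain ⟨e, he, w, hw, hew⟩ := hmem (a * b)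
          (hA.pow_mono (by norm_num) (hA.mul_mem ha hb)) (C.mul_mem haC hbC) (D.mul_mem haD hbD)
        have hew : e * w = a * b := hew
        refine ⟨e, he, w * ((b⁻¹ * u * b⁻¹⁻¹) * v), H.mul_mem hw
          (H.mul_mem (h.norm _ (C.inv_mem hbC) u hu) hv), ?_⟩
        change e * (w * ((b⁻¹ * u * b⁻¹⁻¹) * v)) = a * u * (b * v)
        rw [← mul_assoc, hew]; group
      inv_mem' := by
        rintro g ⟨h1, h2, h3⟩
        refine ⟨C.inv_mem h1, D.inv_mem h2, ?_⟩
        obtain ⟨a, ha, haC, haD, u, hu, rfl⟩ := hdec g h1 h2 h3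
        refine ⟨a⁻¹, hA.pow_inv_mem ha, a * u⁻¹ * a⁻¹, h.norm a haC _ (H.inv_mem hu), ?_⟩
        change a⁻¹ * (a * u⁻¹ * a⁻¹) = _
        group }
  have hTmem : ∀ g, g ∈ T ↔ g ∈ C ∧ g ∈ D ∧ g ∈ A ^ 2 * (H : Set G) := fun g => Iff.rfl
  have hTC : T ≤ C := fun g hg => hg.1
  have hHT : H ≤ T := fun g hg => ⟨h.le hg, hHD hg, 1, hA.one_pow 2, g, hg, one_mul g⟩
  have hTA : ∀ a ∈ A ^ 6, a ∈ C → a ∈ D → a ∈ T := fun a h1 h2 h3 => ⟨h2, h3, hmem a h1 h2 h3⟩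
  have hTn : ∀ c ∈ C, ∀ t ∈ T, c * t * c⁻¹ ∈ T := by
    have key : ∀ c ∈ A ^ 2 ∩ C ∪ H, ∀ t ∈ T, c * t * c⁻¹ ∈ T := by
      rintro c (⟨hc2, hcC⟩ | hcH) t ht
      · obtain ⟨a, ha, haC, haD, u, hu, rfl⟩ := hdec t ht.1 ht.2.1 ht.2.2
        have h1 : c * a * c⁻¹ ∈ T := hTA _
          (hA.mul_mem (m := 4) (hA.mul_mem hc2 ha) (hA.pow_inv_mem hc2))
          (C.mul_mem (C.mul_mem hcC haC) (C.inv_mem hcC)) (hnD c hcC a haD)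
        convert T.mul_mem h1 (hHT (h.norm c hcC u hu)) using 1
        group
      · exact T.mul_mem (T.mul_mem (hHT hcH) ht) (T.inv_mem (hHT hcH))
    intro c hc t ht
    have hc' := h.cgen hc
    rw [← Subgroup.closure_eq H, ← Subgroup.closure_union] at hc'
    refine conj_mem_of_mem_closure key (fun s hs t ht => ?_) hc' ht
    have hs' : s⁻¹ ∈ A ^ 2 ∩ C ∪ H := by
      rcases hs with ⟨h1, h2⟩ | h1
      · exact Or.inl ⟨hA.pow_inv_mem h1, C.inv_mem h2⟩
      · exact Or.inr (H.inv_mem h1)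
    simpa using key s⁻¹ hs' t ht
  let C₁ := centMod C T hTn x
  have hC₁ : ∀ g, g ∈ C₁ ↔ g ∈ C ∧ ⁅g, x⁆ ∈ T := fun g => Iff.rfl
  let H₁ : Subgroup G := T ⊔ Subgroup.zpowers x
  have hTH₁ : T ≤ H₁ := le_sup_left
  have hxH₁ : x ∈ H₁ := (le_sup_right : Subgroup.zpowers x ≤ H₁) (Subgroup.mem_zpowers x)
  have hTC₁ : T ≤ C₁ := fun t ht => ⟨hTC ht, by
    have := T.mul_mem ht (hTn x hxC _ (T.inv_mem ht))
    rw [commutatorElement_def]; simpa [mul_assoc] using this⟩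
  have hH₁C₁ : H₁ ≤ C₁ := by
    refine sup_le hTC₁ ?_
    rw [Subgroup.zpowers_le]
    exact ⟨hxC, by simp⟩
  let C' : Subgroup G := Subgroup.closure (A ^ 2 ∩ C₁) ⊔ H₁
  have hC'C₁ : C' ≤ C₁ := sup_le (by rw [Subgroup.closure_le]; exact fun g hg => hg.2) hH₁C₁
  have hC₁C : C₁ ≤ C := fun g hg => hg.1
  have hsub : A ^ 2 ∩ C₁ ⊆ A ^ 2 ∩ C' := fun g hg =>
    ⟨hg.1, (le_sup_left : _ ≤ C') (Subgroup.subset_closure hg)⟩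
  have hcent : ∀ c ∈ C', ∀ g ∈ H₁, ⁅c, g⁆ ∈ T := by
    intro c hc
    have hc := hC'C₁ hc
    have : H₁ ≤ centMod C T hTn c := by
      refine sup_le (fun t ht => ⟨hTC ht, ?_⟩) ?_
      · have := T.mul_mem ht (hTn c hc.1 _ (T.inv_mem ht))
        rw [commutatorElement_def]; simpa [mul_assoc] using this
      · rw [Subgroup.zpowers_le]
        refine ⟨hxC, ?_⟩
        rw [← commutatorElement_inv]
        exact T.inv_mem hc.2
    intro g hg
    rw [← commutatorElement_inv]
    exact T.inv_mem (this hg).2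
  refine ⟨C', H₁, le_sup_right, ?_, ?_, ?_, ?_, ?_, ?_⟩
  · intro c hc g hg
    convert H₁.mul_mem (hTH₁ (hcent c hc g hg)) hg using 1
    simp [commutatorElement_def]
  · refine sup_le (fun t ht => ?_) ?_
    · obtain ⟨a, ha, haC, haD, u, hu, rfl⟩ := hdec t ht.1 ht.2.1 ht.2.2
      have haT : a ∈ T := hTA a (hA.pow_mono (by norm_num) ha) haC haD
      refine Subgroup.mul_mem _ (Subgroup.subset_closure
        ⟨hA.pow_mono (by norm_num) ha, hTH₁ haT⟩) ?_
      exact Subgroup.closure_mono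
        (Set.inter_subset_inter_right _ (fun g hg => hTH₁ (hHT hg))) (h.gen hu)
    · rw [Subgroup.zpowers_le]
      exact Subgroup.subset_closure ⟨hx6, hxH₁⟩
  · exact sup_le_sup_right (Subgroup.closure_mono hsub) _
  · obtain ⟨S, hSn, hS, hsep⟩ := h.sep
    have hxS : ∀ s ∈ S, x * s⁻¹ ∉ A ^ 2 := fun s hs hxs =>
      hxH ⟨_, hxs, s, (hS hs).2, by simp⟩
    refine ⟨insert x S, ?_, ?_, ?_⟩
    · rw [Finset.card_insert_of_notMem, hSn]
      exact fun hx => hxS x hx (by simpa using hA.one_pow 2)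
    · rw [Finset.coe_insert, Set.insert_subset_iff]
      exact ⟨⟨hx6, hxH₁⟩, fun s hs => ⟨(hS hs).1, hTH₁ (hHT (hS hs).2)⟩⟩
    · intro s hs t ht hst
      rw [Finset.mem_insert] at hs ht
      rcases hs with rfl | hs <;> rcases ht with rfl | ht
      · rfl
      · exact absurd hst (hxS t ht)
      · refine absurd (hA.pow_inv_mem hst) ?_
        simpa using hxS s hs
      · exact hsep s hs t ht hst
  · have h1 := cov_inter_of_cov hA h.cov
    have h2 : Cov (k ^ 15) (A ^ 2 ∩ C) C₁ := by
      obtain ⟨Y, hY1, hY2, hY3⟩ := hA.cov_inter (C ⊓ D) 15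
      have : ∀ y : G, ∃ c : G, (∃ g ∈ A ^ 2 ∩ (C : Set G), y⁻¹ * ⁅g, x⁆ ∈ T) →
          c ∈ C ∧ y⁻¹ * ⁅c, x⁆ ∈ T := fun y => by
        by_cases hy : ∃ g ∈ A ^ 2 ∩ (C : Set G), y⁻¹ * ⁅g, x⁆ ∈ T
        · obtain ⟨g, hg, hg'⟩ := hy
          exact ⟨g, fun _ => ⟨hg.2, hg'⟩⟩
        · exact ⟨1, fun h => absurd h hy⟩
      choose f hf using this
      refine ⟨Y.image f, Finset.card_image_le.trans hY1, ?_⟩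
      intro g hg
      have hg1 : ⁅g, x⁆ ∈ A ^ 16 := by
        rw [commutatorElement_def]
        exact hA.mul_mem (m := 10) (hA.mul_mem (m := 8) (hA.mul_mem hg.1 hx6) (hA.pow_inv_mem hg.1))
          (hA.pow_inv_mem hx6)
      have hg2 : ⁅g, x⁆ ∈ C := by
        rw [commutatorElement_def]
        exact C.mul_mem (C.mul_mem (C.mul_mem hg.2 hxC) (C.inv_mem hg.2)) (C.inv_mem hxC)
      obtain ⟨y, hy, d, hd, hyd⟩ := hY3 ⟨hg1, hg2, hxD g hg.2⟩
      have hyd : y * d = ⁅g, x⁆ := hyd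
      have hyT : y⁻¹ * ⁅g, x⁆ ∈ T := by
        rw [← hyd]
        simpa using hTA d (hA.pow_mono (by norm_num) hd.1) hd.2.1 hd.2.2
      obtain ⟨hc, hcT⟩ := hf y ⟨g, hg, hyT⟩
      have hyC : y ∈ C := (hY2 hy).2.1
      refine ⟨f y, by simpa using ⟨y, hy, rfl⟩, (f y)⁻¹ * g, ⟨C.mul_mem (C.inv_mem hc) hg.2, ?_⟩,
        by simp⟩
      have h4 := T.mul_mem hyT (T.inv_mem hcT)
      convert hTn ((f y)⁻¹ * y) (C.mul_mem (C.inv_mem hc) hyC) _ h4 using 1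
      simp only [commutatorElement_def]; group
    have h3 : Cov (k ^ (15 * (n + 1))) A C₁ := by
      rw [show 15 * (n + 1) = 15 * n + 15 by ring, pow_add]
      exact h1.trans h2
    exact (cov_inter_of_cov hA h3).mono le_rfl le_rfl (hsub.trans Set.inter_subset_right)
  · exact .succ (h.tower.anti (hC'C₁.trans hC₁C)) hHT (fun g hg => hg.2.2)
      (fun c hc => hTn c (hC₁C (hC'C₁ hc))) hTH₁ hcent

/-- An approximate subgroup of a nilpotent group is efficiently covered by a subgroup with a short
tower. -/
theorem exists_tower [Group.IsNilpotent G] (hA : Apx k A) :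
    ∃ n ≤ k ^ 6, ∃ C H : Subgroup G, H ≤ C ∧ C ≤ Subgroup.closure (A ^ 6 ∩ C) ∧
      Tower (A ^ 2) C n H ∧ (C : Set G) ⊆ A ^ 2 * H ∧ Cov (k ^ (15 * n)) A (A ^ 2 ∩ C) := by
  classical
  have hterm : ∀ m n (C H : Subgroup G), k ^ 6 ≤ n + m → TowerState k A C H n →
      ∃ n, ∃ C H : Subgroup G, TowerState k A C H n ∧ A ^ 6 ∩ C ⊆ A ^ 2 * H := by
    intro m
    induction m with
    | zero =>
      intro n C H hn h
      by_contra! hc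
      obtain ⟨C', H', h'⟩ := h.step hA (hc n C H h)
      have := h'.le_pow hA
      omega
    | succ m ih =>
      intro n C H hn h
      by_cases hc : A ^ 6 ∩ C ⊆ A ^ 2 * H
      · exact ⟨n, C, H, h, hc⟩
      · obtain ⟨C', H', h'⟩ := h.step hA hc
        exact ih (n + 1) C' H' (by omega) h'
  have hinit : TowerState k A (Subgroup.closure A) ⊥ 0 := by
    refine ⟨bot_le, by simp, bot_le, ?_, ⟨∅, by simp⟩, ?_, .zero⟩
    · refine le_sup_of_le_left (Subgroup.closure_mono fun a ha => ⟨?_, Subgroup.subset_closure ha⟩)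
      exact hA.pow_mono (m := 1) (by norm_num) (by simpa using ha)
    · simpa using (Cov.refl A).mono le_rfl le_rfl Subgroup.subset_closure
  obtain ⟨n, C, H, h, hfin⟩ := hterm (k ^ 6) 0 _ _ (by omega) hinit
  have hone : (1 : G) ∈ A ^ 2 * (H : Set G) := ⟨1, hA.one_pow 2, 1, H.one_mem, one_mul 1⟩
  let C' : Subgroup G :=
    { carrier := {g | g ∈ C ∧ g ∈ A ^ 2 * (H : Set G)}
      one_mem' := ⟨C.one_mem, hone⟩
      mul_mem' := by
        rintro _ _ ⟨h1, a, ha, u, hu, rfl⟩ ⟨h2, b, hb, v, hv, rfl⟩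
        refine ⟨C.mul_mem h1 h2, ?_⟩
        have haC : a ∈ C := by simpa using C.mul_mem h1 (C.inv_mem (h.le hu))
        have hbC : b ∈ C := by simpa using C.mul_mem h2 (C.inv_mem (h.le hv))
        obtain ⟨e, he, w, hw, hew⟩ := hfin ⟨hA.pow_mono (show 2 + 2 ≤ 6 by norm_num)
          (hA.mul_mem ha hb), C.mul_mem haC hbC⟩
        have hew : e * w = a * b := hew
        refine ⟨e, he, w * ((b⁻¹ * u * b⁻¹⁻¹) * v), H.mul_mem hw
          (H.mul_mem (h.norm _ (C.inv_mem hbC) u hu) hv), ?_⟩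
        change e * (w * ((b⁻¹ * u * b⁻¹⁻¹) * v)) = a * u * (b * v)
        rw [← mul_assoc, hew]; group
      inv_mem' := by
        rintro _ ⟨h1, a, ha, u, hu, rfl⟩
        have haC : a ∈ C := by simpa using C.mul_mem h1 (C.inv_mem (h.le hu))
        refine ⟨C.inv_mem h1, a⁻¹, hA.pow_inv_mem ha, a * u⁻¹ * a⁻¹,
          h.norm a haC _ (H.inv_mem hu), ?_⟩
        change a⁻¹ * (a * u⁻¹ * a⁻¹) = (a * u)⁻¹
        group }
  have hHC' : H ≤ C' := fun g hg => ⟨h.le hg, 1, hA.one_pow 2, g, hg, one_mul g⟩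
  have hAC' : A ^ 2 ∩ C ⊆ C' := fun g hg => ⟨hg.2, g, hg.1, 1, H.one_mem, mul_one g⟩
  refine ⟨n, h.le_pow hA, C', H, hHC', ?_, h.tower.anti (C' := C') fun g hg => hg.1, fun g hg => hg.2, ?_⟩
  · rintro _ ⟨h1, a, ha, u, hu, rfl⟩
    have haC : a ∈ C := by simpa using C.mul_mem h1 (C.inv_mem (h.le hu))
    refine Subgroup.mul_mem _ (Subgroup.subset_closure
      ⟨hA.pow_mono (by norm_num) ha, hAC' ⟨ha, haC⟩⟩) ?_
    exact Subgroup.closure_mono (Set.inter_subset_inter_right _ hHC') (h.gen hu)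
  · exact (cov_inter_of_cov hA h.cov).mono le_rfl le_rfl fun g hg => ⟨hg.1, hAC' hg⟩

end Tower

section Collapse
variable {G : Type*} [Group G]

/-- A normal subgroup in a power of an approximate subgroup, modulo which powers of bounded
exponent contain no further normal subgroups. -/
theorem exists_collapse {k : ℕ} {B : Set G} (hB : Apx k B) (q : ℕ) :
    ∃ V : Subgroup G, V.Normal ∧ (V : Set G) ⊆ B ^ (2 + (q + 4) * k ^ (q + 4)) ∧
      ∀ W : Subgroup G, W.Normal → (W : Set G) ⊆ B ^ q * (V : Set G) → W ≤ V := by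
  classical
  set p := q + 4 with hp
  obtain ⟨V₀, hV₀, hV₀B, hV₀W⟩ : ∃ V : Subgroup G, V.Normal ∧ (V : Set G) ⊆ B ^ (p * k ^ p) ∧
      ∀ W : Subgroup G, W.Normal → (W : Set G) ⊆ B ^ p * (V : Set G) →
        (W : Set G) ⊆ B ^ 2 * (V : Set G) := by
    by_contra! hcon
    have key : ∀ j ≤ k ^ p + 1, ∃ V : Subgroup G, V.Normal ∧ (V : Set G) ⊆ B ^ (p * j) ∧
        ∃ S : Finset G, S.card = j ∧ (S : Set G) ⊆ B ^ p ∩ V ∧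
          ∀ s ∈ S, ∀ t ∈ S, s * t⁻¹ ∈ B ^ 2 → s = t := by
      intro j
      induction j with
      | zero => exact fun _ => ⟨⊥, inferInstance, by simp, ∅, by simp⟩
      | succ j ih =>
        intro hj
        obtain ⟨V, hV, hVB, S, hSj, hS, hsep⟩ := ih (by omega)
        obtain ⟨W, hW, hWp, hW2⟩ := hcon V hV (hVB.trans (hB.pow_mono (by gcongr; omega)))
        obtain ⟨w, hwW, hw2⟩ := Set.not_subset.1 hW2
        obtain ⟨x, hx, v, hv, rfl⟩ := hWp hwW
        have hx2 : x ∉ B ^ 2 * (V : Set G) := by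
          rintro ⟨b, hb, u, hu, rfl⟩
          exact hw2 ⟨b, hb, u * v, V.mul_mem hu hv, by simp [mul_assoc]⟩
        have hxW : x ∈ W ⊔ V := by
          have h1 := Subgroup.mul_mem (W ⊔ V) (le_sup_left (a := W) hwW)
            (le_sup_right (b := V) (V.inv_mem hv))
          simpa using h1
        have hxS : ∀ s ∈ S, x * s⁻¹ ∉ B ^ 2 := fun s hs hxs =>
          hx2 ⟨_, hxs, s, (hS hs).2, by simp⟩
        refine ⟨W ⊔ V, inferInstance, ?_, insert x S, ?_, ?_, ?_⟩
        · rw [Subgroup.mul_normal]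
          refine (Set.mul_subset_mul_right hWp).trans ?_
          rw [mul_assoc, coe_mul_coe]
          refine (Set.mul_subset_mul_left hVB).trans ?_
          rw [← pow_add]
          exact hB.pow_mono (by ring_nf; omega)
        · rw [Finset.card_insert_of_notMem, hSj]
          exact fun hx => hxS x hx (by simpa using hB.one_pow 2)
        · rw [Finset.coe_insert, Set.insert_subset_iff]
          exact ⟨⟨hx, hxW⟩, fun s hs => ⟨(hS hs).1, le_sup_right (b := V) (hS hs).2⟩⟩
        · intro s hs t ht hst
          rw [Finset.mem_insert] at hs ht
          rcases hs with rfl | hs <;> rcases ht with rfl | ht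
          · rfl
          · exact absurd hst (hxS t ht)
          · refine absurd (hB.pow_inv_mem hst) ?_
            simpa using hxS s hs
          · exact hsep s hs t ht hst
    obtain ⟨V, -, -, S, hSj, hS, hsep⟩ := key _ le_rfl
    have h1 := card_mul_ncard_le (B := B) (hB.pow_finite (1 + p)) S
      (fun b hb s hs => hB.mul_mem (m := 1) (by simpa using hb) (hS hs).1)
      (by rw [hB.inv, ← sq]; exact hsep)
    rw [add_comm 1 p] at h1
    have := Nat.le_of_mul_le_mul_right (h1.trans (hB.ncard_pow_le p)) hB.ncard_pos
    omega
  let F : Set (Subgroup G) := {W | W.Normal ∧ (W : Set G) ⊆ B ^ p * (V₀ : Set G)}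
  have hV₀F : V₀ ∈ F := ⟨hV₀, fun v hv => ⟨1, hB.one_pow p, v, hv, one_mul v⟩⟩
  have hdir : DirectedOn (· ≤ ·) F := by
    rintro W ⟨hW, hWp⟩ W' ⟨hW', hWp'⟩
    refine ⟨W ⊔ W', ⟨inferInstance, ?_⟩, le_sup_left, le_sup_right⟩
    rw [Subgroup.mul_normal]
    refine (Set.mul_subset_mul (hV₀W W hW hWp) (hV₀W W' hW' hWp')).trans ?_
    rintro _ ⟨_, ⟨a, ha, u, hu, rfl⟩, _, ⟨b, hb, v, hv, rfl⟩, rfl⟩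
    refine ⟨a * b, hB.pow_mono (show 2 + 2 ≤ p by omega) (hB.mul_mem ha hb),
      (b⁻¹ * u * b⁻¹⁻¹) * v, V₀.mul_mem (hV₀.conj_mem u hu _) hv, ?_⟩
    change a * b * ((b⁻¹ * u * b⁻¹⁻¹) * v) = a * u * (b * v)
    group
  have hmem : ∀ g, g ∈ sSup F ↔ ∃ W ∈ F, g ∈ W := fun g =>
    Subgroup.mem_sSup_of_directedOn ⟨V₀, hV₀F⟩ hdir
  have hle : ((sSup F : Subgroup G) : Set G) ⊆ B ^ 2 * (V₀ : Set G) := by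
    intro g hg
    obtain ⟨W, hW, hgW⟩ := (hmem g).1 hg
    exact hV₀W W hW.1 hW.2 hgW
  refine ⟨sSup F, ⟨fun g hg c => ?_⟩, hle.trans ?_, fun W hW hWq => ?_⟩
  · obtain ⟨W, hW, hgW⟩ := (hmem g).1 hg
    exact (hmem _).2 ⟨W, hW, hW.1.conj_mem g hgW c⟩
  · rw [pow_add]
    exact Set.mul_subset_mul_left hV₀B
  · refine le_sSup ⟨hW, hWq.trans ((Set.mul_subset_mul_left hle).trans ?_)⟩
    rw [← mul_assoc, ← pow_add]
    exact Set.mul_subset_mul_right (hB.pow_mono (by omega))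

end Collapse

section Trap
variable {G : Type*} [Group G]

/-- Normal subgroups covered by `B ^ q` modulo the `i`-th centre lie in the `i`-th centre. -/
def Trap (B : Set G) (q i : ℕ) : Prop :=
  ∀ W : Subgroup G, W.Normal → (W : Set G) ⊆ B ^ q * (Subgroup.upperCentralSeries G i : Set G) →
    W ≤ Subgroup.upperCentralSeries G i

theorem Trap.mono {B : Set G} (hB : (1 : G) ∈ B) {q q' i : ℕ} (hq : q' ≤ q) (h : Trap B q i) :
    Trap B q' i := fun W hW hWB =>
  h W hW (hWB.trans (Set.mul_subset_mul_right (Set.pow_subset_pow_right hB hq)))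

theorem normal_of_mem_upperCentralSeries {i : ℕ} {U : Subgroup G}
    (h : Subgroup.upperCentralSeries G i ≤ U) (h' : U ≤ Subgroup.upperCentralSeries G (i + 1)) :
    U.Normal := ⟨fun u hu g => by
  have h1 := Subgroup.mem_upperCentralSeries_succ_iff.1 (h' hu) g
  have h2 := U.mul_mem (U.inv_mem (h h1)) hu
  simpa [commutatorElement_inv, commutatorElement_def, mul_assoc] using h2⟩

theorem Trap.le_of_commutator_mem {k q i : ℕ} {B : Set G} (hB : Apx k B)
    (hgen : Subgroup.closure B = ⊤) (h : Trap B (2 * q + 2) i) {W : Subgroup G}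
    (hW : (W : Set G) ⊆ B ^ q * (Subgroup.upperCentralSeries G (i + 1) : Set G))
    (hc : ∀ b ∈ B, ∀ w ∈ W, ⁅b, w⁆ ∈ Subgroup.upperCentralSeries G (i + 1)) :
    W ≤ Subgroup.upperCentralSeries G (i + 1) := by
  set Z := Subgroup.upperCentralSeries G i with hZ
  have hZn : Z.Normal := inferInstance
  have hsucc : ∀ {x}, x ∈ Subgroup.upperCentralSeries G (i + 1) ↔ ∀ y, ⁅x, y⁆ ∈ Z :=
    Subgroup.mem_upperCentralSeries_succ_iff
  have hZle : Z ≤ Subgroup.upperCentralSeries G (i + 1) :=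
    Subgroup.upperCentralSeries_mono G (Nat.le_succ i)
  have hconj : ∀ g, ∀ z ∈ Subgroup.upperCentralSeries G (i + 1), (g * z * g⁻¹) * z⁻¹ ∈ Z :=
    fun g z hz => by
      rw [← commutatorElement_def, ← commutatorElement_inv]
      exact Z.inv_mem (hsucc.1 hz g)
  have key : ∀ b ∈ B, ∀ w ∈ W, ⁅b, w⁆ ∈ Z := by
    intro b hb
    let f : W →* G ⧸ Z := MonoidHom.mk' (fun w => ((⁅b, (w : G)⁆ : G) : G ⧸ Z)) (by
      rintro ⟨w, hw⟩ ⟨w', hw'⟩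
      rw [← QuotientGroup.mk_mul, QuotientGroup.eq_iff_div_mem]
      have h1 := hZn.conj_mem _ (hconj w _ (hc b hb w' hw')) ⁅b, w⁆
      convert h1 using 1
      simp only [commutatorElement_def, Subgroup.coe_mul, div_eq_mul_inv]; group)
    let U : Subgroup G := f.range.comap (QuotientGroup.mk' Z)
    have hU : ∀ g, g ∈ U ↔ ∃ w ∈ W, ∃ z ∈ Z, g = ⁅b, w⁆ * z := by
      intro g
      constructor
      · rintro ⟨⟨w, hw⟩, hwg⟩
        have hwg : ((⁅b, w⁆ : G) : G ⧸ Z) = (g : G ⧸ Z) := hwg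
        exact ⟨w, hw, ⁅b, w⁆⁻¹ * g, QuotientGroup.eq.1 hwg, by rw [mul_inv_cancel_left]⟩
      · rintro ⟨w, hw, z, hz, rfl⟩
        refine ⟨⟨w, hw⟩, ?_⟩
        change ((⁅b, w⁆ : G) : G ⧸ Z) = ((⁅b, w⁆ * z : G) : G ⧸ Z)
        exact QuotientGroup.eq.2 (by rwa [inv_mul_cancel_left])
    have hZU : Z ≤ U := fun z hz => (hU z).2 ⟨1, W.one_mem, z, hz, by simp⟩
    have hUZ : U ≤ Subgroup.upperCentralSeries G (i + 1) := by
      intro g hg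
      obtain ⟨w, hw, z, hz, rfl⟩ := (hU g).1 hg
      exact Subgroup.mul_mem _ (hc b hb w hw) (hZle hz)
    have hUle : U ≤ Z := h U (normal_of_mem_upperCentralSeries hZU hUZ) (by
      intro g hg
      obtain ⟨w, hw, z, hz, rfl⟩ := (hU g).1 hg
      obtain ⟨a, ha, y, hy, rfl⟩ := hW hw
      have hb1 : b ∈ B ^ 1 := by simpa using hb
      refine ⟨⁅b, a⁆, hB.pow_mono (show 1 + q + 1 + q ≤ 2 * q + 2 by omega) ?_,
        ⁅b, a⁆⁻¹ * ⁅b, a * y⁆ * z, Z.mul_mem ?_ hz, by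
          change ⁅b, a⁆ * (⁅b, a⁆⁻¹ * ⁅b, a * y⁆ * z) = ⁅b, a * y⁆ * z
          group⟩
      · rw [commutatorElement_def]
        exact hB.mul_mem (hB.mul_mem (hB.mul_mem hb1 ha) (hB.pow_inv_mem hb1)) (hB.pow_inv_mem ha)
      · have h1 : ⁅b, y⁆ ∈ Z := by
          rw [← commutatorElement_inv]
          exact Z.inv_mem (hsucc.1 hy b)
        convert hZn.conj_mem _ h1 a using 1
        simp only [commutatorElement_def]; group)
    exact fun w hw => hUle ((hU _).2 ⟨w, hw, 1, Z.one_mem, by simp⟩)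
  intro w hw
  refine hsucc.2 fun y => ?_
  have h1 : (⊤ : Subgroup G) ≤ centMod ⊤ Z (fun c _ z hz => hZn.conj_mem z hz c) w := by
    refine hgen.symm.le.trans ((Subgroup.closure_le _).2 ?_)
    exact fun b hb => ⟨Subgroup.mem_top b, key b hb w hw⟩
  rw [← commutatorElement_inv]
  exact Z.inv_mem (h1 (Subgroup.mem_top y)).2

theorem commutator_mem_of_normal {W : Subgroup G} (hW : W.Normal) (g : G) {w : G} (hw : w ∈ W) :
    ⁅g, w⁆ ∈ W := by
  rw [commutatorElement_def]
  exact W.mul_mem (hW.conj_mem w hw g) (W.inv_mem hw)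

theorem commutator_mem_upperCentralSeries {i : ℕ} (g : G) {w : G}
    (hw : w ∈ Subgroup.upperCentralSeries G (i + 1)) :
    ⁅g, w⁆ ∈ Subgroup.upperCentralSeries G i := by
  rw [← commutatorElement_inv]
  exact Subgroup.inv_mem _ (Subgroup.mem_upperCentralSeries_succ_iff.1 hw g)

theorem Trap.succ [hG : Group.IsNilpotent G] {k q i : ℕ} {B : Set G} (hB : Apx k B)
    (hgen : Subgroup.closure B = ⊤) (h : Trap B (2 * q + 2) i) : Trap B q (i + 1) := by
  classical
  intro W hW hWB
  obtain ⟨l, hl⟩ : ∃ l, Subgroup.upperCentralSeries G l = ⊤ := hG.nilpotent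
  have key : ∀ j, W ⊓ Subgroup.upperCentralSeries G j ≤ Subgroup.upperCentralSeries G (i + 1) := by
    intro j
    induction j with
    | zero => simp [Subgroup.upperCentralSeries_zero]
    | succ j ih =>
      refine h.le_of_commutator_mem hB hgen
        (fun g hg => hWB (hg : g ∈ W ⊓ _).1) fun b _ w hw => ih ⟨?_, ?_⟩
      · exact commutator_mem_of_normal hW b hw.1
      · exact commutator_mem_upperCentralSeries b hw.2
  simpa [hl] using key l

/-- The exponent needed at the bottom to trap `B ^ q` up to level `n`. -/
def trapExp (q : ℕ) : ℕ → ℕ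
  | 0 => q
  | n + 1 => 2 * trapExp q n + 2

theorem le_trapExp (q n : ℕ) : q ≤ trapExp q n := by
  induction n with
  | zero => exact le_rfl
  | succ n ih => rw [trapExp]; omega

theorem trap_of_zero [Group.IsNilpotent G] {k q n : ℕ} {B : Set G} (hB : Apx k B)
    (hgen : Subgroup.closure B = ⊤) (h : Trap B (trapExp q n) 0) {i : ℕ} (hi : i ≤ n) :
    Trap B q i := by
  have key : ∀ i ≤ n, Trap B (trapExp q (n - i)) i := by
    intro i hi
    induction i with
    | zero => exact h
    | succ i ih =>
      have h1 := ih (by omega)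
      rw [show n - i = n - (i + 1) + 1 by omega] at h1
      exact h1.succ hB hgen
  exact (key i hi).mono hB.one (le_trapExp _ _)

/-- If `B ^ q` traps normal subgroups at every level then it traps all subgroups at every level. -/
theorem le_of_trap {k q n : ℕ} {B : Set G} (hB : Apx k B)
    (hgen : Subgroup.closure B = ⊤) (h : ∀ i ≤ n, Trap B (2 * q + 2) i)
    (hn : Subgroup.upperCentralSeries G n = ⊤) {i : ℕ} {W : Subgroup G}
    (hW : (W : Set G) ⊆ B ^ q * (Subgroup.upperCentralSeries G i : Set G)) :
    W ≤ Subgroup.upperCentralSeries G i := by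
  have key : ∀ d, i + d ≤ n → W ≤ Subgroup.upperCentralSeries G (i + d) →
      W ≤ Subgroup.upperCentralSeries G i := by
    intro d
    induction d with
    | zero => exact fun _ h => h
    | succ d ih =>
      intro hd hWd
      refine ih (by omega) ?_
      rcases d with _ | d
      · have h1 : W ⊔ Subgroup.upperCentralSeries G i ≤ Subgroup.upperCentralSeries G i := by
          refine (h i (by omega)).mono hB.one (show q ≤ 2 * q + 2 by omega) _
            (normal_of_mem_upperCentralSeries le_sup_right
              (sup_le hWd (Subgroup.upperCentralSeries_mono G (Nat.le_succ i)))) ?_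
          rw [Subgroup.mul_normal]
          refine (Set.mul_subset_mul_right hW).trans ?_
          rw [mul_assoc, coe_mul_coe]
        exact le_sup_left.trans h1
      · refine (h (i + d) (by omega)).le_of_commutator_mem hB hgen
          (hW.trans (Set.mul_subset_mul_left (Subgroup.upperCentralSeries_mono G (by omega)))) ?_
        intro b _ w hw
        exact commutator_mem_upperCentralSeries b (hWd hw)
  rcases le_or_gt n i with hi | hi
  · have := Subgroup.upperCentralSeries_mono G hi
    rw [hn] at this
    exact le_top.trans this
  · refine key (n - i) (by omega) ?_
    rw [show i + (n - i) = n by omega, hn]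
    exact le_top

/-- A tower bounds the class of a quotient in which normal subgroups are trapped. -/
theorem Tower.map_le {Q : Type*} [Group Q] {A : Set G} {C H : Subgroup G} {n : ℕ}
    (h : Tower A C n H) (hH : H ≤ C) (f : C →* Q) (hf : Function.Surjective f) {B : Set Q}
    (hAB : ∀ g : C, (g : G) ∈ A → f g ∈ B) (hB : ∀ i ≤ n, Trap B 1 i) :
    (H.subgroupOf C).map f ≤ Subgroup.upperCentralSeries Q n := by
  induction h with
  | zero =>
    rintro _ ⟨g, hg, rfl⟩
    have : g = 1 := Subtype.ext (by simpa [Subgroup.mem_subgroupOf] using hg)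
    simp [this]
  | @succ n H T H' tower le cover normal le' central ih =>
    have hT : T ≤ C := le'.trans hH
    have ih := ih (le.trans hT) (fun i hi => hB i (by omega))
    have hTn : (T.subgroupOf C).map f ≤ Subgroup.upperCentralSeries Q n := by
      refine hB n (by omega) _ ⟨?_⟩ ?_
      · rintro _ ⟨t, ht, rfl⟩ y
        obtain ⟨c, rfl⟩ := hf y
        exact ⟨c * t * c⁻¹, normal _ c.2 _ ht, by simp⟩
      · rintro _ ⟨t, ht, rfl⟩
        obtain ⟨a, ha, u, hu, hau⟩ := cover ht
        have hau : a * u = t := hau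
        have huC : u ∈ C := hT (le hu)
        have haC : a ∈ C := by
          have := C.mul_mem t.2 (C.inv_mem huC)
          rwa [← hau, mul_inv_cancel_right] at this
        refine ⟨f ⟨a, haC⟩, by simpa using hAB ⟨a, haC⟩ ha, f ⟨u, huC⟩, ih ⟨_, hu, rfl⟩, ?_⟩
        change f ⟨a, haC⟩ * f ⟨u, huC⟩ = f t
        rw [← map_mul]
        exact congrArg f (Subtype.ext hau)
    rintro _ ⟨u, hu, rfl⟩
    refine Subgroup.mem_upperCentralSeries_succ_iff.2 fun y => ?_
    obtain ⟨c, rfl⟩ := hf y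
    rw [← commutatorElement_inv, ← map_commutatorElement]
    exact Subgroup.inv_mem _ (hTn ⟨_, central c c.2 u hu, rfl⟩)

end Trap

section Sanders
variable {G : Type*} [Group G]

/-- Sanders's lemma: popular differences of a suitable subset `S` of an approximate group almost
stabilise `S * B`. -/
theorem exists_almost_stable [DecidableEq G] {k : ℕ} {B : Finset G} (hB : Apx k (B : Set G))
    {δ : ℝ} (hδ : 0 < δ) (hδ1 : δ < 1) {N : ℕ} (hN : (1 - δ) ^ N * k < 1) :
    ∃ S X : Finset G, S ⊆ B ∧ S.Nonempty ∧
      (B.card : ℝ) ≤ (2 * k : ℝ) ^ (2 ^ (N + 1)) * X.card ∧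
      X ⊆ B * B ∧
      ∀ x ∈ X, (1 - δ) * (S * B).card ≤ ((x • (S * B)) ∩ (S * B)).card := by
  have hk : (1 : ℝ) ≤ k := by exact_mod_cast hB.pos
  have hBpos : (0 : ℝ) < B.card := by
    have : 0 < B.card := Finset.card_pos.2 ⟨1, by exact_mod_cast hB.one⟩
    exact_mod_cast this
  have hBB : ((B * B).card : ℝ) ≤ k * B.card := by
    have h1 := (hB.cov.ncard_le hB.finite)
    rw [← Finset.coe_mul, Set.ncard_coe_finset, Set.ncard_coe_finset] at h1
    exact_mod_cast h1
  let t : ℕ → ℝ := fun i => ((2 * k : ℝ) ^ (2 ^ i - 1))⁻¹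
  have ht : ∀ i, 0 < t i := fun i => by positivity
  have hts : ∀ i, t (i + 1) * (2 * k) = t i ^ 2 := by
    intro i
    have h2 : 2 ^ (i + 1) - 1 = 2 * (2 ^ i - 1) + 1 := by
      have := Nat.one_le_two_pow (n := i); rw [pow_succ]; omega
    simp only [t]
    rw [h2, pow_succ, mul_inv, mul_assoc, inv_mul_cancel₀ (by positivity), mul_one, inv_pow,
      ← pow_mul, mul_comm (2 ^ i - 1) 2]
  by_contra! hcon
  have key : ∀ i ≤ N, ∃ S ⊆ B, t i * B.card ≤ S.card ∧
      ((S * B).card : ℝ) ≤ (1 - δ) ^ i * (k * B.card) := by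
    intro i
    induction i with
    | zero => exact fun _ => ⟨B, subset_rfl, by simp [t], by simpa using hBB⟩
    | succ i ih =>
      intro hi
      obtain ⟨S, hSB, hS, hSB'⟩ := ih (by omega)
      have hSpos : (0 : ℝ) < S.card := lt_of_lt_of_le (mul_pos (ht i) hBpos) hS
      have hSne : S.Nonempty := Finset.card_pos.1 (by exact_mod_cast hSpos)
      have hfib : ∀ x : G, ((S ×ˢ S).filter fun p => p.1 * p.2⁻¹ = x).card = ((x • S) ∩ S).card := by
        intro x
        refine Finset.card_bij (fun p _ => p.1) ?_ ?_ ?_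
        · rintro ⟨a, b⟩ h
          simp only [Finset.mem_filter, Finset.mem_product] at h
          refine Finset.mem_inter.2 ⟨Finset.mem_smul_finset.2 ⟨b, h.1.2, ?_⟩, h.1.1⟩
          rw [← h.2]; simp
        · rintro ⟨a, b⟩ h ⟨a', b'⟩ h' rfl
          simp only [Finset.mem_filter, Finset.mem_product] at h h'
          have := h.2.trans h'.2.symm
          simpa using this
        · intro a ha
          obtain ⟨h1, h2⟩ := Finset.mem_inter.1 ha
          obtain ⟨b, hb, rfl⟩ := Finset.mem_smul_finset.1 h1
          exact ⟨(x • b, b), by simpa using ⟨h2, hb⟩, rfl⟩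
      let X := (B * B).filter fun x => t (i + 1) * B.card ≤ (((x • S) ∩ S).card : ℝ)
      have hsum : (S.card : ℝ) * S.card = ∑ x ∈ B * B, (((x • S) ∩ S).card : ℝ) := by
        have h1 := Finset.card_eq_sum_card_fiberwise (s := S ×ˢ S) (t := B * B)
          (f := fun p => p.1 * p.2⁻¹) (by
            rintro ⟨a, b⟩ h
            have h := Finset.mem_product.1 h
            refine Finset.mul_mem_mul (hSB h.1) ?_
            have := hB.inv_mem (a := b) (by exact_mod_cast hSB h.2)
            exact_mod_cast this)
        simp only [hfib, Finset.card_product] at h1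
        exact_mod_cast h1
      have hXle : (S.card : ℝ) * S.card ≤ X.card * S.card + (k * B.card) * (t (i + 1) * B.card) := by
        rw [hsum, ← Finset.sum_filter_add_sum_filter_not (B * B)
          (fun x => t (i + 1) * B.card ≤ (((x • S) ∩ S).card : ℝ))]
        refine add_le_add ?_ ?_
        · refine (Finset.sum_le_card_nsmul _ _ (S.card : ℝ) fun x _ => ?_).trans (by
            rw [nsmul_eq_mul])
          exact_mod_cast Finset.card_le_card Finset.inter_subset_right
        · refine (Finset.sum_le_card_nsmul _ _ (t (i + 1) * B.card) fun x hx => ?_).trans ?_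
          · exact (not_le.1 (Finset.mem_filter.1 hx).2).le
          · rw [nsmul_eq_mul]
            have := ht (i + 1)
            refine mul_le_mul_of_nonneg_right (le_trans ?_ hBB) (by positivity)
            exact_mod_cast Finset.card_filter_le _ _
      have hSle : (S.card : ℝ) ≤ B.card := by exact_mod_cast Finset.card_le_card hSB
      have hXcard : t i ^ 2 / 2 * B.card ≤ X.card := by
        have h1 : (k * B.card) * (t (i + 1) * B.card) = t i ^ 2 / 2 * B.card * B.card := by
          rw [← hts i]; ring
        have h2 : (t i * B.card) * (t i * B.card) ≤ (S.card : ℝ) * S.card :=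
          mul_le_mul hS hS (by have := ht i; positivity) hSpos.le
        have h3 : (X.card : ℝ) * S.card ≤ X.card * B.card := by gcongr
        have h4 : t i ^ 2 / 2 * B.card * B.card ≤ X.card * B.card := by nlinarith
        exact le_of_mul_le_mul_right h4 hBpos
      have hXB : (B.card : ℝ) ≤ (2 * k : ℝ) ^ (2 ^ (N + 1)) * X.card := by
        have h1 : (2 * k : ℝ) ^ (2 ^ (N + 1)) * (t i ^ 2 / 2) ≥ 1 := by
          rw [← hts i, ge_iff_le]
          have h3 : t (i + 1) * (2 * k : ℝ) ^ (2 ^ (i + 1) - 1) = 1 := by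
            simp only [t]; exact inv_mul_cancel₀ (by positivity)
          calc (1 : ℝ) ≤ k := hk
            _ = (t (i + 1) * (2 * k : ℝ) ^ (2 ^ (i + 1) - 1)) * k := by rw [h3, one_mul]
            _ ≤ (t (i + 1) * (2 * k : ℝ) ^ (2 ^ (N + 1))) * k := by
              have := ht (i + 1)
              gcongr
              · linarith
              · exact (Nat.sub_le _ _).trans (Nat.pow_le_pow_right (by norm_num) (by omega))
            _ = _ := by ring
        calc (B.card : ℝ) ≤ ((2 * k : ℝ) ^ (2 ^ (N + 1)) * (t i ^ 2 / 2)) * B.card := by nlinarith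
          _ = (2 * k : ℝ) ^ (2 ^ (N + 1)) * (t i ^ 2 / 2 * B.card) := by ring
          _ ≤ _ := by gcongr
      obtain ⟨x, hxX, hx⟩ := hcon S X hSB hSne hXB (Finset.filter_subset _ _)
      refine ⟨(x • S) ∩ S, Finset.inter_subset_right.trans hSB, (Finset.mem_filter.1 hxX).2, ?_⟩
      have h1 : ((x • S) ∩ S) * B ⊆ (x • (S * B)) ∩ (S * B) := by
        refine Finset.subset_inter ?_ (Finset.mul_subset_mul_right Finset.inter_subset_right)
        rw [← smul_mul_assoc]
        exact Finset.mul_subset_mul_right Finset.inter_subset_left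
      have h2 : ((((x • S) ∩ S) * B).card : ℝ) ≤ ((x • (S * B)) ∩ (S * B)).card := by
        exact_mod_cast Finset.card_le_card h1
      calc ((((x • S) ∩ S) * B).card : ℝ) ≤ (1 - δ) * (S * B).card := h2.trans hx.le
        _ ≤ (1 - δ) * ((1 - δ) ^ i * (k * B.card)) :=
          mul_le_mul_of_nonneg_left hSB' (by linarith)
        _ = _ := by ring
  obtain ⟨S, hSB, hS, hS'⟩ := key N le_rfl
  have hSpos : (0 : ℝ) < S.card := lt_of_lt_of_le (mul_pos (ht N) hBpos) hS
  have hSne : S.Nonempty := Finset.card_pos.1 (by exact_mod_cast hSpos)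
  have h1 : (B.card : ℝ) ≤ (S * B).card := by
    exact_mod_cast Finset.card_le_card_mul_left hSne
  have h2 : (B.card : ℝ) < B.card := by
    calc (B.card : ℝ) ≤ ((1 - δ) ^ N * k) * B.card := by rw [mul_assoc]; exact h1.trans hS'
      _ < 1 * B.card := mul_lt_mul_of_pos_right hN hBpos
      _ = _ := one_mul _
  exact lt_irrefl _ h2

end Sanders

section Fourier
variable {F : Type*} [AddCommGroup F] [Fintype F]

/-- The Fourier transform of the indicator function of `S`. -/
noncomputable def hat (S : Finset F) (ψ : AddChar F ℂ) : ℂ := ∑ a ∈ S, ψ a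

theorem norm_addChar (ψ : AddChar F ℂ) (a : F) : ‖ψ a‖ = 1 := AddChar.norm_apply ψ a

theorem hat_conj (S : Finset F) (ψ : AddChar F ℂ) :
    (starRingEnd ℂ) (hat S ψ) = ∑ a ∈ S, ψ (-a) := by
  simp [hat, map_sum, AddChar.map_neg_eq_conj]

theorem sum_addChar_sum [DecidableEq F] {ι : Type*} (I : Finset ι) (u : ι → F) :
    ∑ ψ : AddChar F ℂ, ∑ i ∈ I, ψ (u i) = Fintype.card F * (I.filter fun i => u i = 0).card := by
  rw [Finset.sum_comm]
  simp only [AddChar.sum_apply_eq_ite]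
  rw [Finset.sum_ite, Finset.sum_const_zero, add_zero, Finset.sum_const, nsmul_eq_mul, mul_comm]

theorem hat_sq (S : Finset F) (ψ : AddChar F ℂ) :
    ((‖hat S ψ‖ ^ 2 : ℝ) : ℂ) = ∑ p ∈ S ×ˢ S, ψ (p.1 - p.2) := by
  rw [← Complex.normSq_eq_norm_sq, ← Complex.mul_conj, hat_conj, hat, Finset.sum_mul_sum,
    Finset.sum_product]
  simp [sub_eq_add_neg, AddChar.map_add_eq_mul]

theorem hat_fourth (S : Finset F) (ψ : AddChar F ℂ) (x : F) :
    ψ x * ((‖hat S ψ‖ ^ 4 : ℝ) : ℂ) =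
      ∑ p ∈ (S ×ˢ S) ×ˢ (S ×ˢ S), ψ (p.1.1 - p.1.2 + (p.2.1 - p.2.2) + x) := by
  rw [show ‖hat S ψ‖ ^ 4 = ‖hat S ψ‖ ^ 2 * ‖hat S ψ‖ ^ 2 by ring, Complex.ofReal_mul, hat_sq,
    Finset.sum_mul_sum, Finset.sum_product (s := S ×ˢ S), Finset.mul_sum]
  refine Finset.sum_congr rfl fun p _ => ?_
  rw [Finset.mul_sum]
  refine Finset.sum_congr rfl fun q _ => ?_
  simp only [AddChar.map_add_eq_mul]
  ring

theorem sum_hat_sq (S : Finset F) :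
    ∑ ψ : AddChar F ℂ, ‖hat S ψ‖ ^ 2 = Fintype.card F * S.card := by
  classical
  have h1 : ∑ ψ : AddChar F ℂ, ((‖hat S ψ‖ ^ 2 : ℝ) : ℂ) = Fintype.card F * S.card := by
    simp only [hat_sq]
    rw [sum_addChar_sum]
    rw [← Finset.diag_card S]
    congr 3
    ext ⟨a, b⟩
    simp only [Finset.mem_filter, Finset.mem_product, Finset.mem_diag, sub_eq_zero]
    constructor
    · rintro ⟨⟨h1, -⟩, h3⟩; exact ⟨h1, h3⟩
    · rintro ⟨h1, rfl⟩; exact ⟨⟨h1, h1⟩, rfl⟩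
  exact_mod_cast h1

theorem le_sum_hat_fourth [DecidableEq F] (S : Finset F) :
    (Fintype.card F : ℝ) * S.card ^ 4 ≤ (S + S).card * ∑ ψ : AddChar F ℂ, ‖hat S ψ‖ ^ 4 := by
  have h1 : ∑ ψ : AddChar F ℂ, ‖hat S ψ‖ ^ 4 = Fintype.card F * (S.addEnergy S : ℝ) := by
    have h2 : ∑ ψ : AddChar F ℂ, (ψ 0 * ((‖hat S ψ‖ ^ 4 : ℝ) : ℂ)) =
        Fintype.card F * (S.addEnergy S : ℝ) := by
      simp only [hat_fourth]
      rw [sum_addChar_sum, Finset.addEnergy]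
      simp only [add_zero]
      push_cast
      congr 3
      ext p
      constructor
      · simp only [Finset.mem_filter]
        rintro ⟨h, h'⟩
        exact ⟨h, by rw [← sub_eq_zero, ← h']; abel⟩
      · simp only [Finset.mem_filter]
        rintro ⟨h, h'⟩
        rw [← sub_eq_zero] at h'
        exact ⟨h, by rw [← h']; abel⟩
    simp only [AddChar.map_zero_eq_one, one_mul] at h2
    exact_mod_cast h2
  have h3 := Finset.le_card_add_mul_addEnergy S S
  have h3' : ((S.card : ℝ) ^ 2 * S.card ^ 2) ≤ (S + S).card * (S.addEnergy S : ℝ) := by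
    exact_mod_cast h3
  rw [h1]
  calc (Fintype.card F : ℝ) * S.card ^ 4 = Fintype.card F * (S.card ^ 2 * S.card ^ 2) := by ring
    _ ≤ Fintype.card F * ((S + S).card * (S.addEnergy S : ℝ)) := by gcongr
    _ = _ := by ring

/-- Bogolyubov's lemma. -/
theorem bogolyubov [DecidableEq F] {S : Finset F} (hS : S.Nonempty) {ε K : ℝ}
    (hK : ((S + S).card : ℝ) ≤ K * S.card) (hεK : 3 * ε ^ 2 * K < 1) {x : F}
    (hx : ∀ ψ : AddChar F ℂ, ε * S.card ≤ ‖hat S ψ‖ → 1 / 2 ≤ (ψ x).re) :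
    ∃ a ∈ S, ∃ b ∈ S, ∃ c ∈ S, ∃ d ∈ S, x = a - b + (c - d) := by
  by_contra! hcon
  have hSpos : (0 : ℝ) < S.card := by exact_mod_cast hS.card_pos
  have hF : (0 : ℝ) < Fintype.card F := by exact_mod_cast Fintype.card_pos
  have h0 : ∑ ψ : AddChar F ℂ, (ψ x).re * ‖hat S ψ‖ ^ 4 = 0 := by
    have h1 : ∑ ψ : AddChar F ℂ, (ψ x * ((‖hat S ψ‖ ^ 4 : ℝ) : ℂ)) = 0 := by
      simp only [hat_fourth]
      rw [sum_addChar_sum, Finset.filter_false_of_mem, Finset.card_empty, Nat.cast_zero, mul_zero]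
      rintro ⟨⟨a, b⟩, c, d⟩ h h'
      simp only [Finset.mem_product] at h
      refine hcon b h.1.2 a h.1.1 d h.2.2 c h.2.1 ?_
      have h' : a - b + (c - d) + x = 0 := h'
      rw [eq_neg_of_add_eq_zero_right h']; abel
    have h2 := congrArg Complex.re h1
    simpa only [Complex.re_sum, Complex.re_mul_ofReal, Complex.zero_re] using h2
  have hpt : ∀ ψ : AddChar F ℂ,
      ‖hat S ψ‖ ^ 4 / 2 - 3 / 2 * (ε * S.card) ^ 2 * ‖hat S ψ‖ ^ 2 ≤
        (ψ x).re * ‖hat S ψ‖ ^ 4 := by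
    intro ψ
    by_cases hψ : ε * S.card ≤ ‖hat S ψ‖
    · have h1 := mul_le_mul_of_nonneg_right (hx ψ hψ) (show 0 ≤ ‖hat S ψ‖ ^ 4 by positivity)
      have h2 : 0 ≤ 3 / 2 * (ε * S.card) ^ 2 * ‖hat S ψ‖ ^ 2 := by positivity
      linarith
    · have h1 : -1 ≤ (ψ x).re := by
        have h3 := Complex.abs_re_le_norm (ψ x)
        rw [norm_addChar] at h3
        exact (abs_le.1 h3).1
      have h2 := mul_le_mul_of_nonneg_right h1 (show 0 ≤ ‖hat S ψ‖ ^ 4 by positivity)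
      have h4 : ‖hat S ψ‖ ^ 2 ≤ (ε * S.card) ^ 2 :=
        pow_le_pow_left₀ (norm_nonneg _) (not_le.1 hψ).le 2
      have h5 := mul_le_mul_of_nonneg_right h4 (show 0 ≤ ‖hat S ψ‖ ^ 2 by positivity)
      have h6 : ‖hat S ψ‖ ^ 4 = ‖hat S ψ‖ ^ 2 * ‖hat S ψ‖ ^ 2 := by ring
      nlinarith
  have hsum := Finset.sum_le_sum fun ψ (_ : ψ ∈ Finset.univ) => hpt ψ
  rw [h0, Finset.sum_sub_distrib, ← Finset.sum_div, ← Finset.mul_sum, sum_hat_sq] at hsum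
  have hT := le_sum_hat_fourth S
  set T := ∑ ψ : AddChar F ℂ, ‖hat S ψ‖ ^ 4 with hTdef
  have hT0 : 0 ≤ T := Finset.sum_nonneg fun ψ _ => by positivity
  have h7 : T ≤ 3 * ε ^ 2 * (Fintype.card F * S.card ^ 3) := by nlinarith
  have hK0 : 0 ≤ K := by
    by_contra! h
    have : K * S.card < 0 := mul_neg_of_neg_of_pos h hSpos
    have h8 : (0 : ℝ) ≤ (S + S).card := by positivity
    linarith
  have h9 : (Fintype.card F : ℝ) * S.card ^ 4 ≤
      (3 * ε ^ 2 * K) * (Fintype.card F * S.card ^ 4) := by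
    calc (Fintype.card F : ℝ) * S.card ^ 4 ≤ (S + S).card * T := hT
      _ ≤ (K * S.card) * T := by gcongr
      _ ≤ (K * S.card) * (3 * ε ^ 2 * (Fintype.card F * S.card ^ 3)) := by gcongr
      _ = _ := by ring
  have h10 : (0 : ℝ) < Fintype.card F * S.card ^ 4 := by positivity
  nlinarith

/-- Translates which almost preserve `S` are almost in the kernel of the large spectrum of `S`. -/
theorem norm_sub_one_le [DecidableEq F] {S : Finset F} (hS : S.Nonempty) {ε δ : ℝ} (hε : 0 < ε)
    {x : F} (hx : (1 - δ) * S.card ≤ ((x +ᵥ S) ∩ S).card) {ψ : AddChar F ℂ}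
    (hψ : ε * S.card ≤ ‖hat S ψ‖) : ‖ψ x - 1‖ ≤ 2 * δ / ε := by
  have hSpos : (0 : ℝ) < S.card := by exact_mod_cast hS.card_pos
  have h1 : ψ x * hat S ψ = ∑ a ∈ x +ᵥ S, ψ a := by
    rw [hat, Finset.mul_sum]
    change _ = ∑ a ∈ S.image (x +ᵥ ·), ψ a
    rw [Finset.sum_image (by intro a _ b _ h; simpa using h)]
    exact Finset.sum_congr rfl fun a _ => (AddChar.map_add_eq_mul ψ x a).symm
  have hcard : ∀ T U : Finset F, U ⊆ T → ‖∑ a ∈ T, ψ a - ∑ a ∈ U, ψ a‖ ≤ T.card - U.card := by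
    intro T U hU
    rw [← Finset.sum_sdiff hU, add_sub_cancel_right]
    refine (norm_sum_le _ _).trans ?_
    simp only [norm_addChar, Finset.sum_const, nsmul_eq_mul, mul_one]
    rw [Finset.card_sdiff_of_subset hU, Nat.cast_sub (Finset.card_le_card hU)]
  have h2 := hcard (x +ᵥ S) ((x +ᵥ S) ∩ S) Finset.inter_subset_left
  have h3 := hcard S ((x +ᵥ S) ∩ S) Finset.inter_subset_right
  rw [Finset.card_vadd_finset] at h2
  have h4 : ‖(ψ x - 1) * hat S ψ‖ ≤ 2 * δ * S.card := by
    rw [sub_mul, one_mul, h1, hat]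
    calc _ = ‖(∑ a ∈ x +ᵥ S, ψ a - ∑ a ∈ (x +ᵥ S) ∩ S, ψ a) -
          (∑ a ∈ S, ψ a - ∑ a ∈ (x +ᵥ S) ∩ S, ψ a)‖ := by congr 1; ring
      _ ≤ _ := (norm_sub_le _ _).trans (by linarith)
  rw [norm_mul] at h4
  rw [le_div_iff₀ hε]
  have h5 : ‖ψ x - 1‖ * (ε * S.card) ≤ 2 * δ * S.card :=
    (mul_le_mul_of_nonneg_left hψ (norm_nonneg _)).trans h4
  rw [← mul_assoc] at h5
  exact le_of_mul_le_mul_right h5 hSpos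

end Fourier

/-- A finite set that behaves like the intersection of a lattice with the unit ball. -/
structure LocalLattice {E : Type*} [NormedAddCommGroup E] (Λ : Finset E) : Prop where
  zero_mem : 0 ∈ Λ
  neg_mem : ∀ u ∈ Λ, -u ∈ Λ
  add_mem : ∀ u ∈ Λ, ∀ v ∈ Λ, ‖u‖ + ‖v‖ ≤ 1 → u + v ∈ Λ

theorem LocalLattice.sub_mem {E : Type*} [NormedAddCommGroup E] {Λ : Finset E} (h : LocalLattice Λ) {u v : E} (hu : u ∈ Λ)
    (hv : v ∈ Λ) (huv : ‖u‖ + ‖v‖ ≤ 1) : u - v ∈ Λ := by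
  rw [sub_eq_add_neg]
  exact h.add_mem _ hu _ (h.neg_mem _ hv) (by rwa [norm_neg])

section Lattice
variable {E : Type*} [NormedAddCommGroup E] [NormedSpace ℝ E] [FiniteDimensional ℝ E]

open Module MeasureTheory Metric in
open scoped Function ENNReal in
theorem card_le_of_separated_of_norm_lt (T : Finset E) {R l : ℝ} (hl : 0 < l) (hlR : l ≤ R)
    (hT : ∀ c ∈ T, ‖c‖ < R) (h : ∀ c ∈ T, ∀ d ∈ T, c ≠ d → l ≤ ‖c - d‖) :
    (T.card : ℝ) ≤ (3 * R / l) ^ finrank ℝ E := by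
  borelize E
  let μ : Measure E := Measure.addHaar
  have ρpos : 0 < 3 * R / 2 := by linarith
  have D : Set.Pairwise (T : Set E) (Disjoint on fun c => ball (c : E) (l / 2)) := by
    rintro c hc d hd hcd
    apply ball_disjoint_ball
    rw [dist_eq_norm]
    linarith [h c hc d hd hcd]
  have hsub : (⋃ c ∈ T, ball (c : E) (l / 2)) ⊆ ball (0 : E) (3 * R / 2) := by
    refine Set.iUnion₂_subset fun x hx => ?_
    apply ball_subset_ball'
    rw [dist_zero_right]
    linarith [hT x hx]
  have I : (T.card : ℝ≥0∞) * ENNReal.ofReal ((l / 2) ^ finrank ℝ E) * μ (ball 0 1) ≤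
      ENNReal.ofReal ((3 * R / 2) ^ finrank ℝ E) * μ (ball 0 1) :=
    calc
      _ = μ (⋃ c ∈ T, ball (c : E) (l / 2)) := by
        rw [measure_biUnion_finset D fun c _ => measurableSet_ball]
        simp only [μ.addHaar_ball_of_pos _ (half_pos hl)]
        simp only [Finset.sum_const, nsmul_eq_mul, mul_assoc]
      _ ≤ μ (ball (0 : E) (3 * R / 2)) := measure_mono hsub
      _ = _ := by simp only [μ.addHaar_ball_of_pos _ ρpos]
  have J := (ENNReal.mul_le_mul_iff_left (measure_ball_pos μ _ zero_lt_one).ne'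
    measure_ball_lt_top.ne).1 I
  have K := ENNReal.toReal_le_of_le_ofReal (pow_nonneg ρpos.le _) J
  rw [ENNReal.toReal_mul, ENNReal.toReal_ofReal (by positivity)] at K
  simp only [ENNReal.toReal_natCast] at K
  rw [show 3 * R / l = (3 * R / 2) / (l / 2) by field_simp, div_pow, le_div_iff₀ (by positivity)]
  exact K

open Module in
theorem card_le_of_separated_of_subspace (p : Submodule ℝ E) (T : Finset E) (hp : ∀ c ∈ T, c ∈ p)
    {R l : ℝ} (hl : 0 < l) (hlR : l ≤ R)
    (hT : ∀ c ∈ T, ‖c‖ < R) (h : ∀ c ∈ T, ∀ d ∈ T, c ≠ d → l ≤ ‖c - d‖) :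
    (T.card : ℝ) ≤ (3 * R / l) ^ finrank ℝ p := by
  classical
  have := card_le_of_separated_of_norm_lt (E := p)
    (T.attach.image fun c => (⟨c.1, hp c.1 c.2⟩ : p)) hl hlR (by
      simp only [Finset.mem_image, Finset.mem_attach, true_and, Subtype.exists]
      rintro _ ⟨c, hc, rfl⟩
      exact hT c hc) (by
      simp only [Finset.mem_image, Finset.mem_attach, true_and, Subtype.exists]
      rintro _ ⟨c, hc, rfl⟩ _ ⟨d, hd, rfl⟩ hcd
      exact h c hc d hd fun e => hcd (by simp [e]))
  have hinj : Function.Injective fun c : T => (⟨c.1, hp c.1 c.2⟩ : p) := fun a b hab =>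
    Subtype.ext (congrArg (fun c : p => (c : E)) hab)
  rwa [Finset.card_image_of_injective _ hinj, Finset.card_attach] at this

theorem exists_maximal_subset {α : Type*} (s : Finset α) (r : α → α → Prop) (hr : ∀ a, r a a)
    (hs : ∀ a b, r a b → r b a) :
    ∃ T ⊆ s, (∀ a ∈ T, ∀ b ∈ T, a ≠ b → ¬ r a b) ∧ ∀ a ∈ s, ∃ b ∈ T, r a b := by
  classical
  obtain ⟨T, hT, hmax⟩ := Finset.exists_max_image
    (s.powerset.filter fun T => ∀ a ∈ T, ∀ b ∈ T, a ≠ b → ¬ r a b) Finset.card ⟨∅, by simp⟩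
  simp only [Finset.mem_filter, Finset.mem_powerset] at hT hmax
  refine ⟨T, hT.1, hT.2, fun a ha => ?_⟩
  by_contra! hc
  have haT : a ∉ T := fun h => hc a h (hr a)
  have := hmax (insert a T) ⟨Finset.insert_subset ha hT.1, by
    intro x hx y hy hxy
    rw [Finset.mem_insert] at hx hy
    rcases hx with rfl | hx <;> rcases hy with rfl | hy
    · exact absurd rfl hxy
    · exact hc y hy
    · exact fun h => hc x hx (hs _ _ h)
    · exact hT.2 x hx y hy hxy⟩
  rw [Finset.card_insert_of_notMem haT] at this
  omega

open Module in
theorem LocalLattice.exists_minima {Λ : Finset E} (h : LocalLattice Λ) (k : ℕ) : ∀ {R : ℝ}, 0 < R →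
    R ≤ 1 / 2 → finrank ℝ (Submodule.span ℝ (Λ.filter (‖·‖ < R) : Set E)) = k →
    ∃ U : Finset E, U ⊆ Λ.filter (‖·‖ < R) ∧ LinearIndepOn ℝ id (U : Set E) ∧ U.card = k ∧
      ((Λ.filter (‖·‖ < R)).card : ℝ) * ∏ u ∈ U, ‖u‖ ≤ 3 ^ (k ^ 2 + k) * R ^ k := by
  classical
  induction k using Nat.strong_induction_on with
  | _ k ih =>
  intro R hR hR2 hk
  rcases Nat.eq_zero_or_pos k with rfl | hkpos
  · refine ⟨∅, by simp, by simp [LinearIndepOn], rfl, ?_⟩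
    have hbot := Submodule.finrank_eq_zero.1 hk
    have : Λ.filter (‖·‖ < R) ⊆ {0} := by
      intro x hx
      have : x ∈ Submodule.span ℝ (Λ.filter (‖·‖ < R) : Set E) := Submodule.subset_span hx
      rw [hbot] at this
      simpa using this
    have := Finset.card_le_card this
    simp only [Finset.card_singleton] at this
    simpa using (by exact_mod_cast this : ((Λ.filter (‖·‖ < R)).card : ℝ) ≤ 1)
  have h0R : (0 : E) ∈ Λ.filter (‖·‖ < R) := by simp [h.zero_mem, hR]
  have key : ∀ S : Finset E, S.Nonempty → ∃ v ∈ S, ∀ w ∈ S, ‖w‖ ≤ ‖v‖ := fun S hS =>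
    Finset.exists_max_image S (‖·‖) hS
  obtain ⟨v, hv, hvmin⟩ := Finset.exists_min_image
    ((Λ.filter (‖·‖ < R)).filter fun v => Submodule.span ℝ (Λ.filter (‖·‖ < R) : Set E) ≤
      Submodule.span ℝ (Λ.filter (‖·‖ ≤ ‖v‖) : Set E)) (‖·‖) (by
    obtain ⟨v, hv, hmax⟩ := key _ ⟨0, h0R⟩
    refine ⟨v, Finset.mem_filter.2 ⟨hv, Submodule.span_mono ?_⟩⟩
    intro w hw
    have hw' := hmax w hw
    simp only [Finset.coe_filter, Set.mem_ofPred_eq] at hw ⊢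
    exact ⟨hw.1, hw'⟩)
  simp only [Finset.mem_filter, and_imp] at hv hvmin
  obtain ⟨⟨hvΛ, hvR⟩, hvspan⟩ := hv
  have hspan : Submodule.span ℝ (Λ.filter (‖·‖ ≤ ‖v‖) : Set E) =
      Submodule.span ℝ (Λ.filter (‖·‖ < R) : Set E) := by
    refine le_antisymm (Submodule.span_mono ?_) hvspan
    intro w hw
    simp only [Finset.coe_filter, Set.mem_ofPred_eq] at hw ⊢
    exact ⟨hw.1, hw.2.trans_lt hvR⟩
  have hvpos : 0 < ‖v‖ := by
    rcases (norm_nonneg v).eq_or_lt with h0 | h0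
    · exfalso
      have : Submodule.span ℝ (Λ.filter (‖·‖ ≤ ‖v‖) : Set E) = ⊥ := by
        rw [Submodule.span_eq_bot]
        intro x hx
        simp only [Finset.coe_filter, Set.mem_ofPred_eq, ← h0] at hx
        simpa using hx.2
      rw [← hspan, this, finrank_bot] at hk
      omega
    · exact h0
  have hle : Submodule.span ℝ (Λ.filter (‖·‖ < ‖v‖) : Set E) ≤
      Submodule.span ℝ (Λ.filter (‖·‖ < R) : Set E) := by
    refine Submodule.span_mono ?_
    intro w hw
    simp only [Finset.coe_filter, Set.mem_ofPred_eq] at hw ⊢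
    exact ⟨hw.1, hw.2.trans hvR⟩
  have hlt : Submodule.span ℝ (Λ.filter (‖·‖ < ‖v‖) : Set E) <
      Submodule.span ℝ (Λ.filter (‖·‖ < R) : Set E) := by
    refine lt_of_le_of_ne hle fun heq => ?_
    obtain ⟨v', hv', hmax⟩ := key (Λ.filter (‖·‖ < ‖v‖)) ⟨0, by simp [h.zero_mem, hvpos]⟩
    rw [Finset.mem_filter] at hv'
    refine absurd (hvmin v' hv'.1 (hv'.2.trans hvR) ?_) (not_le.2 hv'.2)
    rw [← heq]
    refine Submodule.span_mono ?_
    intro w hw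
    have hw' := hmax w hw
    simp only [Finset.coe_filter, Set.mem_ofPred_eq] at hw ⊢
    exact ⟨hw.1, hw'⟩
  obtain ⟨k', hk'⟩ : ∃ k', finrank ℝ (Submodule.span ℝ (Λ.filter (‖·‖ < ‖v‖) : Set E)) = k' :=
    ⟨_, rfl⟩
  have hk'k : k' < k := by
    rw [← hk, ← hk']
    exact Submodule.finrank_lt_finrank_of_lt hlt
  obtain ⟨U', hU', hUi, hUc, hUprod⟩ := ih k' hk'k hvpos (hvR.le.trans hR2) hk'
  obtain ⟨b, hbt, hUb, htb, hbi⟩ := exists_linearIndepOn_id_extension hUi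
    (t := (Λ.filter (‖·‖ ≤ ‖v‖) : Set E)) (by
      intro w hw
      have := Finset.mem_filter.1 (hU' hw)
      simp only [Finset.coe_filter, Set.mem_ofPred_eq]
      exact ⟨this.1, this.2.le⟩)
  obtain ⟨U, rfl⟩ : ∃ U : Finset E, (U : Set E) = b :=
    ⟨_, (((Λ.filter (‖·‖ ≤ ‖v‖)).finite_toSet.subset hbt)).coe_toFinset⟩
  have hUspan : Submodule.span ℝ (U : Set E) =
      Submodule.span ℝ (Λ.filter (‖·‖ < R) : Set E) := by
    rw [← hspan]
    exact le_antisymm (Submodule.span_mono hbt) (Submodule.span_le.2 htb)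
  have hUcard : U.card = k := by
    rw [← finrank_span_finset_eq_card hbi, hUspan, hk]
  have hUle : ∀ u ∈ U, u ∈ Λ ∧ ‖u‖ ≤ ‖v‖ := fun u hu => by
    simpa using hbt hu
  have hUU : U' ⊆ U := by exact_mod_cast hUb
  refine ⟨U, fun u hu => Finset.mem_filter.2 ⟨(hUle u hu).1, (hUle u hu).2.trans_lt hvR⟩, hbi,
    hUcard, ?_⟩
  have hprod : ∏ u ∈ U, ‖u‖ ≤ (∏ u ∈ U', ‖u‖) * ‖v‖ ^ (k - k') := by
    rw [← Finset.prod_sdiff hUU, mul_comm]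
    refine mul_le_mul_of_nonneg_left ?_ (Finset.prod_nonneg fun _ _ => norm_nonneg _)
    refine (Finset.prod_le_prod (fun _ _ => norm_nonneg _) fun u hu =>
      (hUle u (Finset.mem_sdiff.1 hu).1).2).trans_eq ?_
    rw [Finset.prod_const, Finset.card_sdiff_of_subset hUU, hUcard, hUc]
  obtain ⟨T, hTs, hTsep, hTcov⟩ := exists_maximal_subset (Λ.filter (‖·‖ < R))
    (fun a b => ‖a - b‖ < ‖v‖) (fun a => by simpa using hvpos) (fun a b => by
      intro h
      rwa [norm_sub_rev])
  have hTcard := card_le_of_separated_of_subspace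
    (Submodule.span ℝ (Λ.filter (‖·‖ < R) : Set E)) T
    (fun c hc => Submodule.subset_span (hTs hc)) hvpos hvR.le
    (fun c hc => (Finset.mem_filter.1 (hTs hc)).2) (fun c hc d hd hcd => not_lt.1 (hTsep c hc d hd hcd))
  rw [hk] at hTcard
  have hcov : Λ.filter (‖·‖ < R) ⊆ T + Λ.filter (‖·‖ < ‖v‖) := by
    intro x hx
    obtain ⟨t, ht, hxt⟩ := hTcov x hx
    have hx' := Finset.mem_filter.1 hx
    have ht' := Finset.mem_filter.1 (hTs ht)
    refine Finset.mem_add.2 ⟨t, ht, x - t, Finset.mem_filter.2 ⟨?_, hxt⟩, by abel⟩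
    exact h.sub_mem hx'.1 ht'.1 (by linarith [hx'.2, ht'.2])
  have hcard : ((Λ.filter (‖·‖ < R)).card : ℝ) ≤ T.card * (Λ.filter (‖·‖ < ‖v‖)).card := by
    exact_mod_cast (Finset.card_le_card hcov).trans (Finset.card_add_le)
  have hpos : 0 ≤ ∏ u ∈ U', ‖u‖ := Finset.prod_nonneg fun _ _ => norm_nonneg _
  calc ((Λ.filter (‖·‖ < R)).card : ℝ) * ∏ u ∈ U, ‖u‖
      ≤ ((3 * R / ‖v‖) ^ k * (Λ.filter (‖·‖ < ‖v‖)).card) *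
          ((∏ u ∈ U', ‖u‖) * ‖v‖ ^ (k - k')) := by
        refine mul_le_mul (hcard.trans (mul_le_mul_of_nonneg_right hTcard (by positivity))) hprod
          (Finset.prod_nonneg fun _ _ => norm_nonneg _) (by positivity)
    _ = (3 * R / ‖v‖) ^ k * ‖v‖ ^ (k - k') *
          ((Λ.filter (‖·‖ < ‖v‖)).card * (∏ u ∈ U', ‖u‖)) := by ring
    _ ≤ (3 * R / ‖v‖) ^ k * ‖v‖ ^ (k - k') * (3 ^ (k' ^ 2 + k') * ‖v‖ ^ k') :=
        mul_le_mul_of_nonneg_left hUprod (by positivity)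
    _ = 3 ^ (k + (k' ^ 2 + k')) * R ^ k := by
        have : ‖v‖ ^ (k - k') * ‖v‖ ^ k' = ‖v‖ ^ k := by rw [← pow_add]; congr 1; omega
        rw [div_pow, mul_pow, pow_add]
        field_simp
        rw [← this]
        ring
    _ ≤ 3 ^ (k ^ 2 + k) * R ^ k := by
        refine mul_le_mul_of_nonneg_right (pow_le_pow_right₀ (by norm_num) ?_) (by positivity)
        nlinarith

open Module in
theorem LocalLattice.finrank_mul_card_le {Λ : Finset E} (h : LocalLattice Λ) :
    finrank ℝ (Submodule.span ℝ (Λ.filter (‖·‖ < 1 / 4) : Set E)) *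
      (Λ.filter (‖·‖ < 1 / 8)).card ≤ Λ.card := by
  classical
  obtain ⟨Y, hYs, hYsep, hYcov⟩ := exists_maximal_subset (Λ.filter (‖·‖ < 1 / 2))
    (fun y z => ∃ a ∈ Λ.filter (‖·‖ < 1 / 8), ∃ b ∈ Λ.filter (‖·‖ < 1 / 8), y + a = z + b)
    (fun y => ⟨0, by simp [h.zero_mem], 0, by simp [h.zero_mem], rfl⟩)
    (fun y z ⟨a, ha, b, hb, hab⟩ => ⟨b, hb, a, ha, hab.symm⟩)
  have hcard : Y.card * (Λ.filter (‖·‖ < 1 / 8)).card ≤ Λ.card := by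
    rw [← Finset.card_product]
    refine Finset.card_le_card_of_injOn (fun p => p.1 + p.2) ?_ ?_
    · rintro ⟨y, a⟩ hp
      simp only [Finset.coe_product, Set.mem_prod, Finset.mem_coe] at hp
      have hy := Finset.mem_filter.1 (hYs hp.1)
      have ha := Finset.mem_filter.1 hp.2
      exact h.add_mem _ hy.1 _ ha.1 (by linarith [hy.2, ha.2])
    · rintro ⟨y, a⟩ hp ⟨z, b⟩ hq hpq
      simp only [Finset.coe_product, Set.mem_prod, Finset.mem_coe] at hp hq hpq
      by_cases hyz : y = z
      · subst hyz
        simpa using hpq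
      · exact absurd ⟨a, hp.2, b, hq.2, hpq⟩ (hYsep y hp.1 z hq.1 hyz)
  have hsub : Submodule.span ℝ (Λ.filter (‖·‖ < 1 / 4) : Set E) ≤ Submodule.span ℝ (Y : Set E) := by
    refine Submodule.span_le.2 fun x hx => ?_
    by_contra hxn
    obtain ⟨l, hlx, hl⟩ := Submodule.exists_dual_map_eq_bot_of_notMem hxn inferInstance
    obtain ⟨w, hw, hmax⟩ := Finset.exists_max_image (Λ.filter (‖·‖ < 1 / 4)) (fun w => |l w|)
      ⟨x, hx⟩
    have hw' := Finset.mem_filter.1 hw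
    have h2w : w + w ∈ Λ.filter (‖·‖ < 1 / 2) := Finset.mem_filter.2
      ⟨h.add_mem _ hw'.1 _ hw'.1 (by linarith [hw'.2]),
        (norm_add_le _ _).trans_lt (by linarith [hw'.2])⟩
    obtain ⟨y, hy, a, ha, b, hb, hab⟩ := hYcov _ h2w
    have ha' := Finset.mem_filter.1 ha
    have hb' := Finset.mem_filter.1 hb
    have hba : b - a ∈ Λ.filter (‖·‖ < 1 / 4) := Finset.mem_filter.2
      ⟨h.sub_mem hb'.1 ha'.1 (by linarith [ha'.2, hb'.2]),
        (norm_sub_le _ _).trans_lt (by linarith [ha'.2, hb'.2])⟩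
    have hly : l y = 0 := by
      have : l y ∈ (Submodule.span ℝ (Y : Set E)).map l :=
        ⟨y, Submodule.subset_span hy, rfl⟩
      rw [hl] at this
      simpa using this
    have e : l w + l w = l (b - a) := by
      have : w + w = y + (b - a) := by rw [add_sub, ← hab]; abel
      rw [← map_add, this, map_add, hly, zero_add]
    have h1 := hmax _ hba
    have h2 := hmax _ hx
    have h3 : 0 < |l x| := abs_pos.2 hlx
    rw [← e] at h1
    have : |l w + l w| = 2 * |l w| := by rw [← two_mul, abs_mul]; norm_num
    linarith
  calc _ ≤ Y.card * (Λ.filter (‖·‖ < 1 / 8)).card := by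
        refine Nat.mul_le_mul_right _ ?_
        exact (Submodule.finrank_mono hsub).trans (finrank_span_finset_le_card Y)
    _ ≤ _ := hcard

/-- A local lattice of bounded doubling contains a large proper progression of bounded rank. -/
theorem LocalLattice.exists_progression {Λ : Finset E} (h : LocalLattice Λ) {M : ℝ}
    (hM : (Λ.card : ℝ) ≤ M * (Λ.filter (‖·‖ < 1 / 8)).card) :
    ∃ (d : ℕ) (u : Fin d → E) (L : Fin d → ℕ), (d : ℝ) ≤ M ∧ LinearIndependent ℝ u ∧
      (∀ i, u i ∈ Λ) ∧ ∑ i, L i * ‖u i‖ ≤ 1 / 2 ∧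
      ((Λ.filter (‖·‖ < 1 / 8)).card : ℝ) ≤ 3 ^ (d ^ 2 + d) * (d : ℝ) ^ d * ∏ i, (2 * (L i : ℝ) + 1) := by
  classical
  obtain ⟨U, hU, hUi, hUc, hprod⟩ := h.exists_minima _ (R := 1 / 4) (by norm_num) (by norm_num) rfl
  have hdim := h.finrank_mul_card_le
  rw [← hUc] at hdim hprod
  obtain ⟨d, hd⟩ : ∃ d, U.card = d := ⟨_, rfl⟩
  rw [hd] at hdim hprod
  let e := U.equivFinOfCardEq hd
  have hsum : ∀ f : E → ℝ, ∏ i, f (e.symm i) = ∏ u ∈ U, f u := fun f => by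
    rw [← Finset.prod_coe_sort U f]
    exact Equiv.prod_comp e.symm (fun x : U => f x)
  have hpos8 : 0 < (Λ.filter (‖·‖ < 1 / 8)).card :=
    Finset.card_pos.2 ⟨0, by simp [h.zero_mem]⟩
  have hind : LinearIndependent ℝ (fun i => (e.symm i : E)) := by
    exact LinearIndependent.comp hUi e.symm e.symm.injective
  have hne : ∀ i, 0 < ‖(e.symm i : E)‖ := fun i => norm_pos_iff.2 (hind.ne_zero i)
  refine ⟨d, fun i => e.symm i, fun i => ⌊1 / (2 * d) / ‖(e.symm i : E)‖⌋₊, ?_, hind,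
    fun i => (Finset.mem_filter.1 (hU (e.symm i).2)).1, ?_, ?_⟩
  · have h1 : (d : ℝ) * (Λ.filter (‖·‖ < 1 / 8)).card ≤ M * (Λ.filter (‖·‖ < 1 / 8)).card :=
      le_trans (by exact_mod_cast hdim) hM
    exact le_of_mul_le_mul_right h1 (by exact_mod_cast hpos8)
  · rcases Nat.eq_zero_or_pos d with rfl | hdpos
    · simp
    have hd' : (0 : ℝ) < d := by exact_mod_cast hdpos
    calc _ ≤ ∑ i : Fin d, 1 / (2 * (d : ℝ)) := by
          refine Finset.sum_le_sum fun i _ => ?_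
          rw [← le_div_iff₀ (hne i)]
          exact Nat.floor_le (by positivity)
      _ = 1 / 2 := by
          rw [Finset.sum_const, Finset.card_univ, Fintype.card_fin, nsmul_eq_mul]
          field_simp
  · have h48 : ((Λ.filter (‖·‖ < 1 / 8)).card : ℝ) ≤ (Λ.filter (‖·‖ < 1 / 4)).card := by
      exact_mod_cast Finset.card_le_card fun x hx => by
        rw [Finset.mem_filter] at hx ⊢
        exact ⟨hx.1, hx.2.trans (by norm_num)⟩
    refine h48.trans ?_
    have hPpos : 0 < ∏ u ∈ U, ‖u‖ := by
      rw [← hsum (‖·‖)]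
      exact Finset.prod_pos fun i _ => hne i
    rw [← le_div_iff₀ hPpos] at hprod
    refine hprod.trans ?_
    rw [div_le_iff₀ hPpos, ← hsum (‖·‖), mul_assoc, ← Finset.prod_mul_distrib, mul_assoc]
    refine mul_le_mul_of_nonneg_left ?_ (by positivity)
    rcases Nat.eq_zero_or_pos d with rfl | hdpos
    · simp
    have hd' : (0 : ℝ) < d := by exact_mod_cast hdpos
    have : ∏ i : Fin d, (1 / (2 * (d : ℝ))) ≤
        ∏ i : Fin d, (2 * ((⌊1 / (2 * d) / ‖(e.symm i : E)‖⌋₊ : ℕ) : ℝ) + 1) * ‖(e.symm i : E)‖ := by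
      refine Finset.prod_le_prod (fun i _ => by positivity) fun i _ => ?_
      rw [← div_le_iff₀ (hne i)]
      have := Nat.lt_floor_add_one (1 / (2 * d) / ‖(e.symm i : E)‖)
      have h0 : (0 : ℝ) ≤ ((⌊1 / (2 * d) / ‖(e.symm i : E)‖⌋₊ : ℕ) : ℝ) := Nat.cast_nonneg _
      linarith
    refine le_trans ?_ (mul_le_mul_of_nonneg_left this (by positivity))
    rw [Finset.prod_const, Finset.card_univ, Fintype.card_fin, ← mul_pow]
    refine pow_le_pow_left₀ (by norm_num) ?_ d
    field_simp
    norm_num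

end Lattice

/-- The segment `{x ^ l : |l| ≤ L}`. -/
def segment {G : Type*} [Group G] (x : G) (L : ℕ) : Set G := {g | ∃ l : ℤ, l.natAbs ≤ L ∧ g = x ^ l}

theorem exists_progression_of_coord {Q : Type*} [CommGroup Q] {E : Type*} [NormedAddCommGroup E]
    [NormedSpace ℝ E] [FiniteDimensional ℝ E] {B : Finset Q} {Φ : Q → E} (h1 : 1 ∈ B)
    (h0 : Φ 1 = 0) (hinv : ∀ x ∈ B, x⁻¹ ∈ B ∧ Φ x⁻¹ = -Φ x)
    (hmul : ∀ x ∈ B, ∀ y ∈ B, ‖Φ x‖ + ‖Φ y‖ ≤ 1 → x * y ∈ B ∧ Φ (x * y) = Φ x + Φ y)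
    (hker : ∀ x ∈ B, Φ x = 0 → x = 1) {X : Finset Q} (hX : X ⊆ B) (hX8 : ∀ x ∈ X, ‖Φ x‖ < 1 / 8)
    {M : ℝ} (hM0 : 0 ≤ M) (hM : (B.card : ℝ) ≤ M * X.card) :
    ∃ (d : ℕ) (x : Fin d → Q) (L : Fin d → ℕ), (d : ℝ) ≤ M ∧
      (∀ i, segment (x i) (L i) ⊆ B) ∧
      (X.card : ℝ) ≤ 3 ^ (d ^ 2 + d) * (d : ℝ) ^ d * (∏ i, segment (x i) (L i)).ncard := by
  classical
  have hloc : LocalLattice (B.image Φ) := by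
    refine ⟨Finset.mem_image.2 ⟨1, h1, h0⟩, ?_, ?_⟩
    · intro u hu
      obtain ⟨x, hx, rfl⟩ := Finset.mem_image.1 hu
      exact Finset.mem_image.2 ⟨x⁻¹, hinv x hx⟩
    · intro u hu v hv huv
      obtain ⟨x, hx, rfl⟩ := Finset.mem_image.1 hu
      obtain ⟨y, hy, rfl⟩ := Finset.mem_image.1 hv
      exact Finset.mem_image.2 ⟨x * y, hmul x hx y hy huv⟩
  have hinj : ∀ x ∈ B, ∀ y ∈ B, ‖Φ x‖ ≤ 1 / 2 → Φ x = Φ y → x = y := by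
    intro x hx y hy hxn hxy
    have h := hmul x hx y⁻¹ (hinv y hy).1 (by rw [(hinv y hy).2, norm_neg, ← hxy]; linarith)
    have := hker _ h.1 (by rw [h.2, (hinv y hy).2, hxy, add_neg_cancel])
    exact mul_inv_eq_one.1 this
  have hXc : X.card ≤ ((B.image Φ).filter (‖·‖ < 1 / 8)).card := by
    refine Finset.card_le_card_of_injOn Φ (fun x hx => ?_) fun x hx y hy hxy => ?_
    · exact Finset.mem_filter.2 ⟨Finset.mem_image_of_mem _ (hX hx), hX8 x hx⟩
    · exact hinj x (hX hx) y (hX hy) (by linarith [hX8 x hx]) hxy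
  obtain ⟨d, u, L, hd, hu, huΛ, hsum, hcard⟩ := hloc.exists_progression (M := M) (by
    refine le_trans (by exact_mod_cast Finset.card_image_le) (hM.trans ?_)
    exact mul_le_mul_of_nonneg_left (by exact_mod_cast hXc) hM0)
  choose x hxB hxu using fun i => Finset.mem_image.1 (huΛ i)
  have hpow : ∀ i, ∀ l : ℕ, l * ‖u i‖ ≤ 1 → x i ^ l ∈ B ∧ Φ (x i ^ l) = (l : ℝ) • u i := by
    intro i l
    induction l with
    | zero => intro _; simpa using ⟨h1, h0⟩
    | succ l ih =>
      intro hl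
      push_cast at hl
      have hl' : l * ‖u i‖ + ‖u i‖ ≤ 1 := by linarith
      have ih := ih (by linarith [norm_nonneg (u i)])
      have := hmul _ ih.1 _ (hxB i) (by
        rw [ih.2, hxu, norm_smul, Real.norm_natCast]; exact hl')
      rw [pow_succ]
      refine ⟨this.1, ?_⟩
      rw [this.2, ih.2, hxu]
      push_cast
      rw [add_smul, one_smul]
  have hzpow : ∀ i, ∀ l : ℤ, l.natAbs * ‖u i‖ ≤ 1 → x i ^ l ∈ B ∧ Φ (x i ^ l) = (l : ℝ) • u i := by
    intro i l hl
    obtain ⟨n, rfl | rfl⟩ := l.eq_nat_or_neg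
    · simpa using hpow i n (by simpa using hl)
    · have := hpow i n (by simpa using hl)
      rw [zpow_neg, zpow_natCast]
      refine ⟨(hinv _ this.1).1, ?_⟩
      rw [(hinv _ this.1).2, this.2]
      push_cast
      rw [neg_smul]
  have hLi : ∀ i, L i * ‖u i‖ ≤ 1 / 2 := fun i =>
    (Finset.single_le_sum (f := fun i => L i * ‖u i‖) (fun i _ => by positivity)
      (Finset.mem_univ i)).trans hsum
  have hseg : ∀ i, ∀ l : ℤ, l.natAbs ≤ L i → (l.natAbs : ℝ) * ‖u i‖ ≤ L i * ‖u i‖ :=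
    fun i l hl => mul_le_mul_of_nonneg_right (by exact_mod_cast hl) (norm_nonneg _)
  have hprod : ∀ l : Fin d → ℤ, (∀ i, (l i).natAbs ≤ L i) → ∀ s : Finset (Fin d),
      (∏ i ∈ s, x i ^ l i) ∈ B ∧ Φ (∏ i ∈ s, x i ^ l i) = ∑ i ∈ s, (l i : ℝ) • u i := by
    intro l hl s
    induction s using Finset.induction_on with
    | empty => simpa using ⟨h1, h0⟩
    | insert a s ha ih =>
      rw [Finset.prod_insert ha, Finset.sum_insert ha]
      have hz := hzpow a (l a) ((hseg a _ (hl a)).trans (by linarith [hLi a]))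
      have hn : ∀ i, ‖(l i : ℝ) • u i‖ ≤ L i * ‖u i‖ := fun i => by
        rw [norm_smul, Real.norm_eq_abs, ← Int.cast_abs, ← Nat.cast_natAbs]
        exact hseg i _ (hl i)
      have := hmul _ hz.1 _ ih.1 (by
        rw [hz.2, ih.2]
        have h2 : ‖∑ i ∈ s, (l i : ℝ) • u i‖ ≤ ∑ i, L i * ‖u i‖ :=
          (norm_sum_le _ _).trans ((Finset.sum_le_sum fun i _ => hn i).trans
            (Finset.sum_le_sum_of_subset_of_nonneg (Finset.subset_univ _)
              fun i _ _ => by positivity))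
        linarith [hn a, hLi a])
      exact ⟨this.1, by rw [this.2, hz.2, ih.2]⟩
  refine ⟨d, x, L, hd, ?_, ?_⟩
  · rintro i _ ⟨l, hl, rfl⟩
    exact (hzpow i l ((hseg i l hl).trans (by linarith [hLi i]))).1
  · refine le_trans (by exact_mod_cast hXc) (hcard.trans ?_)
    refine mul_le_mul_of_nonneg_left ?_ (by positivity)
    have hmem : ∀ l ∈ Fintype.piFinset fun i => Finset.Icc (-(L i : ℤ)) (L i),
        ∀ i, (l i).natAbs ≤ L i := by
      intro l hl i
      have := Finset.mem_Icc.1 (Fintype.mem_piFinset.1 hl i)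
      omega
    have hfin : (∏ i, segment (x i) (L i)).Finite := by
      refine Set.Finite.subset B.finite_toSet ?_
      intro g hg
      obtain ⟨f, hf, rfl⟩ := (Set.mem_fintype_prod _ _).1 hg
      choose l hl hfl using hf
      simp only [hfl]
      exact (hprod l hl Finset.univ).1
    have hle : (Fintype.piFinset fun i => Finset.Icc (-(L i : ℤ)) (L i)).card ≤
        (∏ i, segment (x i) (L i)).ncard := by
      rw [← Set.ncard_coe_finset]
      refine Set.ncard_le_ncard_of_injOn (fun l => ∏ i, x i ^ l i) ?_ ?_ hfin
      · intro l hl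
        exact (Set.mem_fintype_prod _ _).2 ⟨fun i => x i ^ l i,
          fun i => ⟨l i, hmem l hl i, rfl⟩, rfl⟩
      · intro l hl l' hl' hll
        have e1 := (hprod l (hmem l hl) Finset.univ).2
        have e2 := (hprod l' (hmem l' hl') Finset.univ).2
        simp only at hll
        rw [hll, e2, ← sub_eq_zero, ← Finset.sum_sub_distrib] at e1
        simp only [← sub_smul] at e1
        funext i
        have := Fintype.linearIndependent_iff.1 hu _ e1 i
        rw [sub_eq_zero] at this
        exact_mod_cast this.symm
    refine le_trans (le_of_eq ?_) (Nat.cast_le.2 hle)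
    rw [Fintype.card_piFinset]
    push_cast
    refine Finset.prod_congr rfl fun i _ => ?_
    rw [Int.card_Icc]
    have : ((L i : ℤ) + 1 - -(L i : ℤ)).toNat = 2 * L i + 1 := by omega
    rw [this]
    push_cast
    ring

theorem exists_finite_hom {Q : Type*} [CommGroup Q] [Group.FG Q] {x : Q} (hx : x ≠ 1) :
    ∃ (F : Type) (_ : CommGroup F) (_ : Finite F) (f : Q →* F), f x ≠ 1 := by
  obtain ⟨ι₀, ι, _, _, p, hp, e, ⟨φ⟩⟩ := CommGroup.equiv_free_prod_prod_multiplicative_zmod Q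
  have hφ : φ x ≠ 1 := by simpa using hx
  by_cases h1 : (φ x).1 = 1
  · have h2 : (φ x).2 ≠ 1 := fun h => hφ (Prod.ext h1 h)
    obtain ⟨i, hi⟩ := Function.ne_iff.1 h2
    have : NeZero (p i ^ e i) := ⟨pow_ne_zero _ (hp i).ne_zero⟩
    exact ⟨Multiplicative (ZMod (p i ^ e i)), inferInstance, inferInstance,
      ((Pi.evalMonoidHom _ i).comp (MonoidHom.snd _ _)).comp φ.toMonoidHom, hi⟩
  · obtain ⟨i, hi⟩ := Function.ne_iff.1 h1
    have hz : ((φ x).1 i).toAdd ≠ 0 := hi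
    set z := ((φ x).1 i).toAdd with hzdef
    have : NeZero (z.natAbs + 1) := ⟨by omega⟩
    refine ⟨Multiplicative (ZMod (z.natAbs + 1)), inferInstance, inferInstance,
      ((AddMonoidHom.toMultiplicative (Int.castAddHom (ZMod (z.natAbs + 1)))).comp
        ((Pi.evalMonoidHom _ i).comp (MonoidHom.fst _ _))).comp φ.toMonoidHom, fun h => ?_⟩
    have h' : ((z : ℤ) : ZMod (z.natAbs + 1)) = 0 := h
    rw [ZMod.intCast_zmod_eq_zero_iff_dvd] at h'
    have := Int.natAbs_dvd_natAbs.2 h'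
    have := Nat.le_of_dvd (by omega) this
    omega

theorem exists_finite_hom_injOn {Q : Type u} [CommGroup Q] {B : Set Q} (hB : B.Finite) {T : Set Q}
    (hT : T.Finite) :
    ∃ (F : Type u) (_ : AddCommGroup F) (_ : Finite F) (f : Q → F), f 1 = 0 ∧
      (∀ x ∈ Subgroup.closure B, ∀ y ∈ Subgroup.closure B, f (x * y) = f x + f y) ∧
      ∀ x ∈ T, x ∈ Subgroup.closure B → f x = 0 → x = 1 := by
  classical
  have : Group.FG (Subgroup.closure B) := by
    have := hB.to_subtype
    exact Group.closure_finite_fg B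
  let S : Set (Subgroup.closure B) := {x | (x : Q) ∈ T ∧ x ≠ 1}
  have hS : S.Finite := (hT.preimage Subtype.val_injective.injOn).subset fun x hx => hx.1
  have := hS.to_subtype
  choose F _ _ f hf using fun x : S => exists_finite_hom x.2.2
  let g := MonoidHom.mk' (fun y (x : S) => f x y) (fun a b => by funext x; simp)
  refine ⟨Additive (∀ x : S, F x), inferInstance, inferInstanceAs (Finite (∀ x : S, F x)),
    fun y => if h : y ∈ Subgroup.closure B then Additive.ofMul (g ⟨y, h⟩) else 0, ?_, ?_, ?_⟩
  · beta_reduce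
    rw [dif_pos (one_mem _)]
    exact map_one g
  · intro x hx y hy
    beta_reduce
    rw [dif_pos hx, dif_pos hy, dif_pos (mul_mem hx hy), ← ofMul_mul, ← map_mul]
    rfl
  · intro x hxT hx h
    beta_reduce at h
    rw [dif_pos hx] at h
    by_contra hne
    have hxS : (⟨x, hx⟩ : Subgroup.closure B) ∈ S := ⟨hxT, fun e => hne (congrArg Subtype.val e)⟩
    exact hf ⟨_, hxS⟩ (congrFun (show g ⟨x, hx⟩ = 1 from h) ⟨_, hxS⟩)

theorem pow_subset_subgroup {G : Type*} [Group G] {A : Set G} {C : Subgroup G}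
    (h : A ⊆ C) (m : ℕ) : A ^ m ⊆ C := by
  induction m with
  | zero => simp
  | succ m ih =>
    rw [pow_succ]
    rintro _ ⟨a, ha, b, hb, rfl⟩
    exact mul_mem (ih ha) (h hb)

section Bohr
variable {F : Type*} [AddCommGroup F]

/-- The arguments of the values of a family of characters. -/
noncomputable def argMap (Ξ : Finset (AddChar F ℂ)) (z : F) : Ξ → ℝ := fun ψ => (ψ.1 z).arg

theorem norm_argMap_le {Ξ : Finset (AddChar F ℂ)} {z : F} {r : ℝ} (hr : 0 ≤ r) :
    ‖argMap Ξ z‖ ≤ r ↔ ∀ ψ ∈ Ξ, |(ψ z).arg| ≤ r := by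
  rw [pi_norm_le_iff_of_nonneg hr]
  simp [argMap]

theorem argMap_zero (Ξ : Finset (AddChar F ℂ)) : argMap Ξ 0 = 0 := by
  funext ψ
  simp [argMap]

variable [Finite F]

theorem argMap_add {Ξ : Finset (AddChar F ℂ)} {z w : F} (h : ‖argMap Ξ z‖ + ‖argMap Ξ w‖ ≤ 1) :
    argMap Ξ (z + w) = argMap Ξ z + argMap Ξ w := by
  have := Fintype.ofFinite F
  funext ψ
  have h1 := norm_le_pi_norm (argMap Ξ z) ψ
  have h2 := norm_le_pi_norm (argMap Ξ w) ψ
  rw [Real.norm_eq_abs] at h1 h2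
  have h1' := abs_le.1 h1
  have h2' := abs_le.1 h2
  simp only [Pi.add_apply]
  simp only [argMap] at h1' h2' ⊢
  rw [AddChar.map_add_eq_mul, Complex.arg_mul]
  · exact norm_ne_zero_iff.1 (by rw [norm_addChar]; exact one_ne_zero)
  · exact norm_ne_zero_iff.1 (by rw [norm_addChar]; exact one_ne_zero)
  · constructor <;> linarith [Real.pi_gt_three]

theorem argMap_neg {Ξ : Finset (AddChar F ℂ)} {z : F} (h : ‖argMap Ξ z‖ ≤ 1) :
    argMap Ξ (-z) = -argMap Ξ z := by
  have := Fintype.ofFinite F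
  funext ψ
  have h1 := abs_le.1 (((Real.norm_eq_abs _).symm.le).trans ((norm_le_pi_norm (argMap Ξ z) ψ).trans h))
  simp only [Pi.neg_apply]
  simp only [argMap] at h1 ⊢
  rw [AddChar.map_neg_eq_inv, Complex.arg_inv, if_neg]
  intro h2
  linarith [Real.pi_gt_three]

theorem re_ge_half {Ξ : Finset (AddChar F ℂ)} {z : F} (h : ‖argMap Ξ z‖ ≤ 1) {ψ : AddChar F ℂ}
    (hψ : ψ ∈ Ξ) : 1 / 2 ≤ (ψ z).re := by
  have := Fintype.ofFinite F
  have h1 := (norm_argMap_le zero_le_one).1 h ψ hψ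
  have h2 := Complex.norm_mul_cos_arg (ψ z)
  rw [norm_addChar, one_mul] at h2
  rw [← h2]
  have h3 := Real.one_sub_sq_div_two_le_cos (x := (ψ z).arg)
  have h4 : (ψ z).arg ^ 2 ≤ 1 := by rw [← sq_abs]; exact pow_le_one₀ (abs_nonneg _) h1
  linarith

theorem abs_arg_le {ψ : AddChar F ℂ} {z : F} {r : ℝ} (h : ‖ψ z - 1‖ ≤ r) :
    |(ψ z).arg| ≤ 2 * r := by
  have := Fintype.ofFinite F
  have h1 := (Complex.norm_sub_mem_Icc_angle (norm_addChar ψ z) norm_one).1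
  rw [Complex.angle_one_right (norm_ne_zero_iff.1 (by rw [norm_addChar]; exact one_ne_zero))] at h1
  have hpi := Real.pi_pos
  have h2 : |(ψ z).arg| ≤ Real.pi / 2 * r := by
    have := h1.trans h
    rw [div_mul_eq_mul_div, div_le_iff₀ hpi] at this
    linarith
  have hr : 0 ≤ r := (norm_nonneg _).trans h
  nlinarith [Real.pi_le_four]

end Bohr

/-- The bound on the rank in `exists_progression_of_comm`. -/
def abelianRank (k : ℕ) : ℕ := k ^ 7 * (2 * k) ^ 2 ^ (128 * k ^ 3 + 1)

/-- The bound on the density in `exists_progression_of_comm`. -/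
def abelianConst (k : ℕ) : ℕ :=
  abelianRank k * (3 ^ (abelianRank k ^ 2 + abelianRank k) * abelianRank k ^ abelianRank k)

/-- An abelian approximate group without small subgroups contains a large progression. -/
theorem exists_progression_of_comm {Q : Type u} [CommGroup Q] {B : Set Q} {k : ℕ} (hB : Apx k B)
    (hnss : ∀ W : Subgroup Q, (W : Set Q) ⊆ B ^ 8 → W = ⊥) :
    ∃ (d : ℕ) (x : Fin d → Q) (L : Fin d → ℕ), d ≤ abelianRank k ∧
      (∀ i, segment (x i) (L i) ⊆ B ^ 8) ∧
      B.ncard ≤ abelianConst k * (∏ i, segment (x i) (L i)).ncard := by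
  classical
  have hkpos := hB.pos
  have hk : (1 : ℝ) ≤ k := by exact_mod_cast hkpos
  obtain ⟨F, _, _, f, f0, fmul, finj⟩ := exists_finite_hom_injOn hB.finite (hB.pow_finite 24)
  have := Fintype.ofFinite F
  have hcl : ∀ {m : ℕ} {x : Q}, x ∈ B ^ m → x ∈ Subgroup.closure B := fun {m x} hx =>
    pow_subset_subgroup Subgroup.subset_closure m hx
  have finv : ∀ x ∈ Subgroup.closure B, f x⁻¹ = - f x := fun x hx => by
    rw [eq_neg_iff_add_eq_zero, ← fmul _ (inv_mem hx) _ hx, inv_mul_cancel, f0]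
  have finj' : ∀ {m n : ℕ} {x y : Q}, m + n ≤ 24 → x ∈ B ^ m → y ∈ B ^ n → f x = f y → x = y := by
    intro m n x y hmn hx hy hxy
    refine mul_inv_eq_one.1 (finj _ (hB.pow_mono hmn (hB.mul_mem hx (hB.pow_inv_mem hy)))
      (mul_mem (hcl hx) (inv_mem (hcl hy))) ?_)
    rw [fmul _ (hcl hx) _ (inv_mem (hcl hy)), finv _ (hcl hy), hxy, add_neg_cancel]
  obtain ⟨Bf, rfl⟩ : ∃ Bf : Finset Q, (Bf : Set Q) = B := ⟨_, hB.finite.coe_toFinset⟩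
  set δ : ℝ := 1 / (128 * (k : ℝ) ^ 2) with hδ
  have hδ0 : 0 < δ := by positivity
  have hδ1 : δ < 1 := by
    rw [hδ, div_lt_one (by positivity)]
    nlinarith
  obtain ⟨S, X, hSB, hSne, hcard, hXB, hX⟩ := exists_almost_stable hB hδ0 hδ1
    (N := 128 * k ^ 3) (by
      have h1 : (1 - δ) ^ (128 * k ^ 3) ≤ Real.exp (-(k : ℝ)) := by
        refine (pow_le_pow_left₀ (by linarith) (Real.one_sub_le_exp_neg δ) _).trans_eq ?_
        rw [← Real.exp_nat_mul]
        congr 1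
        rw [hδ]
        push_cast
        field_simp
      have h2 : (k : ℝ) < Real.exp k := by linarith [Real.add_one_le_exp (k : ℝ)]
      calc _ ≤ Real.exp (-(k : ℝ)) * k := mul_le_mul_of_nonneg_right h1 (by linarith)
        _ < Real.exp (-(k : ℝ)) * Real.exp k := mul_lt_mul_of_pos_left h2 (Real.exp_pos _)
        _ = 1 := by rw [← Real.exp_add]; simp)
  have hSB2 : ∀ s ∈ S * Bf, s ∈ (Bf : Set Q) ^ 2 := by
    intro s hs
    obtain ⟨a, ha, b, hb, rfl⟩ := Finset.mem_mul.1 hs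
    rw [pow_two]
    exact Set.mul_mem_mul (hSB ha) hb
  have hXB2 : ∀ x ∈ X, x ∈ (Bf : Set Q) ^ 2 := by
    intro x hx
    have := hXB hx
    rw [pow_two]
    exact_mod_cast this
  set S' : Finset F := (S * Bf).image f with hS'
  have hS'c : S'.card = (S * Bf).card := Finset.card_image_of_injOn fun a ha b hb hab =>
    finj' (by norm_num) (hSB2 a ha) (hSB2 b hb) hab
  have hBne : Bf.Nonempty := ⟨1, hB.one⟩
  have hS'ne : S'.Nonempty := (hSne.mul hBne).image f
  have hK : ((S' + S').card : ℝ) ≤ (k : ℝ) ^ 3 * S'.card := by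
    have h1 : (S' + S') ⊆ ((hB.pow_finite 4).toFinset).image f := by
      intro z hz
      obtain ⟨a, ha, b, hb, rfl⟩ := Finset.mem_add.1 hz
      obtain ⟨s, hs, rfl⟩ := Finset.mem_image.1 ha
      obtain ⟨t, ht, rfl⟩ := Finset.mem_image.1 hb
      refine Finset.mem_image.2 ⟨s * t, ?_, fmul _ (hcl (hSB2 s hs)) _ (hcl (hSB2 t ht))⟩
      rw [Set.Finite.mem_toFinset]
      exact hB.mul_mem (hSB2 s hs) (hSB2 t ht)
    have h2 := (Finset.card_le_card h1).trans Finset.card_image_le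
    rw [← Set.ncard_eq_toFinset_card _ (hB.pow_finite 4)] at h2
    have h3 := hB.ncard_pow_le 3
    rw [Set.ncard_coe_finset] at h3
    have h4 : Bf.card ≤ S'.card := by
      rw [hS'c]
      exact Finset.card_le_card_mul_left hSne
    exact_mod_cast h2.trans (h3.trans (Nat.mul_le_mul_left _ h4))
  set ε : ℝ := 1 / (2 * (k : ℝ) ^ 2) with hε
  have hε0 : 0 < ε := by positivity
  have hεK : 3 * ε ^ 2 * (k : ℝ) ^ 3 < 1 := by
    have : 3 * ε ^ 2 * (k : ℝ) ^ 3 = 3 / (4 * k) := by rw [hε]; field_simp; norm_num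
    rw [this, div_lt_one (by positivity)]
    linarith
  set Ξ : Finset (AddChar F ℂ) := Finset.univ.filter fun ψ => ε * S'.card ≤ ‖hat S' ψ‖ with hΞ
  have hbohr : ∀ z : F, ‖argMap Ξ z‖ ≤ 1 → ∃ q ∈ (Bf : Set Q) ^ 8, f q = z := by
    intro z hz
    obtain ⟨a, ha, b, hb, c, hc, d, hd, rfl⟩ := bogolyubov hS'ne hK hεK (x := z)
      (fun ψ hψ => re_ge_half hz (Finset.mem_filter.2 ⟨Finset.mem_univ _, hψ⟩))
    obtain ⟨a, ha', rfl⟩ := Finset.mem_image.1 ha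
    obtain ⟨b, hb', rfl⟩ := Finset.mem_image.1 hb
    obtain ⟨c, hc', rfl⟩ := Finset.mem_image.1 hc
    obtain ⟨d, hd', rfl⟩ := Finset.mem_image.1 hd
    have ha := hSB2 a ha'
    have hb := hSB2 b hb'
    have hc := hSB2 c hc'
    have hd := hSB2 d hd'
    refine ⟨a * b⁻¹ * (c * d⁻¹), hB.mul_mem (m := 4) (n := 4) (hB.mul_mem (m := 2) (n := 2) ha (hB.pow_inv_mem hb))
      (hB.mul_mem (m := 2) (n := 2) hc (hB.pow_inv_mem hd)), ?_⟩
    have ha := hcl ha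
    have hb := hcl hb
    have hc := hcl hc
    have hd := hcl hd
    rw [fmul _ (mul_mem ha (inv_mem hb)) _ (mul_mem hc (inv_mem hd)), fmul _ ha _ (inv_mem hb),
      fmul _ hc _ (inv_mem hd), finv _ hb, finv _ hd, sub_eq_add_neg, sub_eq_add_neg]
  set C : Finset Q := (hB.pow_finite 8).toFinset.filter fun x => ‖argMap Ξ (f x)‖ ≤ 1 with hC
  have hCmem : ∀ x, x ∈ C ↔ x ∈ (Bf : Set Q) ^ 8 ∧ ‖argMap Ξ (f x)‖ ≤ 1 := fun x => by
    rw [hC, Finset.mem_filter, Set.Finite.mem_toFinset]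
  have hmul : ∀ x ∈ C, ∀ y ∈ C, ‖argMap Ξ (f x)‖ + ‖argMap Ξ (f y)‖ ≤ 1 →
      x * y ∈ C ∧ argMap Ξ (f (x * y)) = argMap Ξ (f x) + argMap Ξ (f y) := by
    intro x hx y hy hxy
    have hx' := (hCmem x).1 hx
    have hy' := (hCmem y).1 hy
    have e : argMap Ξ (f (x * y)) = argMap Ξ (f x) + argMap Ξ (f y) := by
      rw [fmul _ (hcl hx'.1) _ (hcl hy'.1), argMap_add hxy]
    have hn : ‖argMap Ξ (f (x * y))‖ ≤ 1 := by
      rw [e]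
      exact (norm_add_le _ _).trans hxy
    obtain ⟨q, hq, hqf⟩ := hbohr _ hn
    have := finj' (m := 8) (n := 16) (by norm_num) hq
      (hB.mul_mem (m := 8) (n := 8) hx'.1 hy'.1) hqf
    exact ⟨(hCmem _).2 ⟨this ▸ hq, hn⟩, e⟩
  have hinv : ∀ x ∈ C, x⁻¹ ∈ C ∧ argMap Ξ (f x⁻¹) = - argMap Ξ (f x) := by
    intro x hx
    have hx' := (hCmem x).1 hx
    have e : argMap Ξ (f x⁻¹) = - argMap Ξ (f x) := by
      rw [finv _ (hcl hx'.1), argMap_neg hx'.2]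
    exact ⟨(hCmem _).2 ⟨hB.pow_inv_mem hx'.1, by rw [e, norm_neg]; exact hx'.2⟩, e⟩
  have h1C : (1 : Q) ∈ C := (hCmem _).2 ⟨hB.one_pow 8, by rw [f0, argMap_zero, norm_zero]; norm_num⟩
  have hker : ∀ x ∈ C, argMap Ξ (f x) = 0 → x = 1 := by
    intro x hx hx0
    let W : Subgroup Q :=
      { carrier := {x | x ∈ C ∧ argMap Ξ (f x) = 0}
        one_mem' := ⟨h1C, by rw [f0, argMap_zero]⟩
        mul_mem' := fun {a b} ha hb => by
          have := hmul a ha.1 b hb.1 (by rw [ha.2, hb.2, norm_zero]; norm_num)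
          exact ⟨this.1, by rw [this.2, ha.2, hb.2, add_zero]⟩
        inv_mem' := fun {a} ha => ⟨(hinv a ha.1).1, by rw [(hinv a ha.1).2, ha.2, neg_zero]⟩ }
    have hW := hnss W fun a ha => ((hCmem a).1 ha.1).1
    have : x ∈ W := ⟨hx, hx0⟩
    rw [hW] at this
    simpa using this
  have hX16 : ∀ x ∈ X, ‖argMap Ξ (f x)‖ ≤ 1 / 16 := by
    intro x hx
    rw [norm_argMap_le (by norm_num)]
    intro ψ hψ
    have hψ' := (Finset.mem_filter.1 hψ).2
    have h := norm_sub_one_le hS'ne hε0 (x := f x) (δ := δ) (by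
      have hsub : ((x • (S * Bf)) ∩ (S * Bf)).image f ⊆ (f x +ᵥ S') ∩ S' := by
        intro z hz
        obtain ⟨y, hy, rfl⟩ := Finset.mem_image.1 hz
        obtain ⟨hy1, hy2⟩ := Finset.mem_inter.1 hy
        obtain ⟨s, hs, rfl⟩ := Finset.mem_smul_finset.1 hy1
        refine Finset.mem_inter.2 ⟨Finset.mem_vadd_finset.2 ⟨f s, Finset.mem_image_of_mem _ hs, ?_⟩,
          Finset.mem_image_of_mem _ hy2⟩
        exact (fmul _ (hcl (hXB2 x hx)) _ (hcl (hSB2 s hs))).symm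
      have hc := Finset.card_le_card hsub
      rw [Finset.card_image_of_injOn fun a ha b hb hab =>
        finj' (by norm_num) (hSB2 a (Finset.mem_inter.1 ha).2) (hSB2 b (Finset.mem_inter.1 hb).2)
          hab] at hc
      rw [hS'c]
      exact (hX x hx).trans (by exact_mod_cast hc)) hψ'
    have h2 : 2 * δ / ε = 1 / 32 := by rw [hδ, hε]; field_simp; norm_num
    rw [h2] at h
    exact (abs_arg_le h).trans (by norm_num)
  have hXC : X ⊆ C := fun x hx => (hCmem x).2
    ⟨hB.pow_mono (by norm_num) (hXB2 x hx), (hX16 x hx).trans (by norm_num)⟩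
  have hcardC : (C.card : ℝ) ≤ (abelianRank k : ℝ) * X.card := by
    have h1 : C.card ≤ k ^ 7 * Bf.card := by
      refine (Finset.card_le_card (Finset.filter_subset _ _)).trans ?_
      rw [← Set.ncard_eq_toFinset_card _ (hB.pow_finite 8)]
      have := hB.ncard_pow_le 7
      rwa [Set.ncard_coe_finset] at this
    have h2 : (C.card : ℝ) ≤ (k : ℝ) ^ 7 * Bf.card := by exact_mod_cast h1
    refine h2.trans ((mul_le_mul_of_nonneg_left hcard (by positivity)).trans_eq ?_)
    rw [abelianRank]
    push_cast
    ring
  obtain ⟨d, x, L, hd, hseg, hXcard⟩ := exists_progression_of_coord h1C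
    (by simp only [f0, argMap_zero]) hinv hmul hker hXC
    (fun x hx => (hX16 x hx).trans_lt (by norm_num)) (Nat.cast_nonneg _) hcardC
  have hd' : d ≤ abelianRank k := by exact_mod_cast hd
  refine ⟨d, x, L, hd', fun i => (hseg i).trans fun y hy => ((hCmem y).1 hy).1, ?_⟩
  rw [Set.ncard_coe_finset]
  have hXcard' : X.card ≤ 3 ^ (d ^ 2 + d) * d ^ d * (∏ i, segment (x i) (L i)).ncard := by
    exact_mod_cast hXcard
  have hR : 0 < abelianRank k := by unfold abelianRank; positivity
  have hBX : Bf.card ≤ abelianRank k * X.card := by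
    have h1 : Bf.card ≤ (2 * k) ^ 2 ^ (128 * k ^ 3 + 1) * X.card := by exact_mod_cast hcard
    refine h1.trans (Nat.mul_le_mul_right _ ?_)
    exact Nat.le_mul_of_pos_left _ (by positivity)
  refine hBX.trans ((Nat.mul_le_mul_left _ hXcard').trans ?_)
  rw [abelianConst, ← mul_assoc]
  refine Nat.mul_le_mul_right _ (Nat.mul_le_mul_left _ (Nat.mul_le_mul ?_ ?_))
  · exact Nat.pow_le_pow_right (by norm_num) (by gcongr)
  · exact (Nat.pow_le_pow_left hd' d).trans (Nat.pow_le_pow_right hR hd')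

section Progression
variable {G : Type*} [Group G]

theorem mul_mem_genProgression {r : ℕ} {x : Fin r → G} {L M N : Fin r → ℕ} {g h : G}
    (hg : g ∈ GenProgression x L) (hh : h ∈ GenProgression x M) (hN : ∀ i, L i + M i ≤ N i) :
    g * h ∈ GenProgression x N := by
  obtain ⟨w, hw, rfl⟩ := hg
  obtain ⟨w', hw', rfl⟩ := hh
  refine ⟨w ++ w', fun i => ?_, by simp⟩
  rw [List.map_append, List.count_append]
  exact (Nat.add_le_add (hw i) (hw' i)).trans (hN i)

theorem one_mem_genProgression {r : ℕ} (x : Fin r → G) (L : Fin r → ℕ) :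
    1 ∈ GenProgression x L := ⟨[], by simp, by simp⟩

theorem inv_mem_genProgression {r : ℕ} {x : Fin r → G} {L : Fin r → ℕ} {g : G}
    (hg : g ∈ GenProgression x L) : g⁻¹ ∈ GenProgression x L := by
  obtain ⟨w, hw, rfl⟩ := hg
  refine ⟨(w.map fun p => (p.1, !p.2)).reverse, fun i => ?_, ?_⟩
  · rw [List.map_reverse, List.count_reverse, List.map_map]
    exact hw i
  · rw [List.prod_inv_reverse, List.map_reverse, List.map_map, List.map_map]
    congr 2
    refine List.map_congr_left fun p _ => ?_
    obtain ⟨i, b⟩ := p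
    cases b <;> simp

theorem apply_mem_genProgression {r : ℕ} (x : Fin r → G) {L : Fin r → ℕ} {i : Fin r}
    (hi : 0 < L i) : x i ∈ GenProgression x L := by
  refine ⟨[(i, true)], fun j => ?_, by simp⟩
  simp only [List.map_cons, List.map_nil, List.count_singleton]
  split_ifs with h
  · have : i = j := by simpa using h
    subst this
    exact hi
  · exact Nat.zero_le _

theorem genProgression_subset_reindex {r r' : ℕ} {x : Fin r → G} {x' : Fin r' → G}
    {L : Fin r → ℕ} {L' : Fin r' → ℕ} (σ : Fin r → Fin r') (hσ : Function.Injective σ)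
    (hx : ∀ i, x' (σ i) = x i) (hL : ∀ i, L i ≤ L' (σ i)) :
    GenProgression x L ⊆ GenProgression x' L' := by
  rintro g ⟨w, hw, rfl⟩
  refine ⟨w.map fun p => (σ p.1, p.2), fun j => ?_, ?_⟩
  · rw [List.map_map, show (Prod.fst ∘ fun p : Fin r × Bool => (σ p.1, p.2)) = σ ∘ Prod.fst from rfl,
      ← List.map_map]
    by_cases hj : ∃ i, σ i = j
    · obtain ⟨i, rfl⟩ := hj
      rw [List.count_map_of_injective _ _ hσ]
      exact (hw i).trans (hL i)
    · rw [List.count_eq_zero_of_not_mem]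
      · exact Nat.zero_le _
      · intro h
        obtain ⟨i, _, hi⟩ := List.mem_map.1 h
        exact hj ⟨i, hi⟩
  · rw [List.map_map]
    congr 1
    refine List.map_congr_left fun p _ => ?_
    simp [hx]

theorem mul_mem_genProgression_append {r s : ℕ} {x : Fin r → G} {y : Fin s → G} {L : Fin r → ℕ}
    {M : Fin s → ℕ} {g h : G} (hg : g ∈ GenProgression x L) (hh : h ∈ GenProgression y M) :
    g * h ∈ GenProgression (Fin.append x y) (Fin.append L M) := by
  refine mul_mem_genProgression (L := Fin.append L 0) (M := Fin.append 0 M)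
    (genProgression_subset_reindex (Fin.castAdd s) (Fin.castAdd_injective r s) (by simp) (by simp) hg)
    (genProgression_subset_reindex (Fin.natAdd r) (Fin.natAdd_injective s r) (by simp) (by simp) hh)
    fun i => ?_
  refine Fin.addCases (fun i => ?_) (fun i => ?_) i <;> simp

theorem segment_two_mul (x : G) (L : ℕ) : segment x (2 * L) ⊆ segment x L * segment x L := by
  rintro _ ⟨l, hl, rfl⟩
  refine ⟨x ^ (l / 2), ⟨_, by omega, rfl⟩, x ^ (l - l / 2), ⟨_, by omega, rfl⟩, ?_⟩
  simp only
  rw [← zpow_add]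
  congr 1
  omega

theorem segment_mono {x : G} {L M : ℕ} (h : L ≤ M) : segment x L ⊆ segment x M := by
  rintro _ ⟨l, hl, rfl⟩
  exact ⟨l, hl.trans h, rfl⟩

/-- `S` is contained in a progression of rank at most `R` whose segments lie in `A ^ m`. -/
def Covered (A : Set G) (m R : ℕ) (S : Set G) : Prop :=
  ∃ r ≤ R, ∃ (x : Fin r → G) (L : Fin r → ℕ), (∀ i, segment (x i) (L i) ⊆ A ^ m) ∧
    S ⊆ GenProgression x L

theorem Covered.mul {A S T : Set G} {m R R' : ℕ} (hS : Covered A m R S) (hT : Covered A m R' T) :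
    Covered A m (R + R') (S * T) := by
  obtain ⟨r, hr, x, L, hx, hSx⟩ := hS
  obtain ⟨s, hs, y, M, hy, hTy⟩ := hT
  refine ⟨r + s, Nat.add_le_add hr hs, Fin.append x y, Fin.append L M, fun i => ?_, ?_⟩
  · refine Fin.addCases (fun i => ?_) (fun i => ?_) i
    · simpa using hx i
    · simpa using hy i
  · rintro _ ⟨g, hg, h, hh, rfl⟩
    exact mul_mem_genProgression_append (hSx hg) (hTy hh)

theorem covered_one (A : Set G) (m : ℕ) : Covered A m 0 1 :=
  ⟨0, le_rfl, Fin.elim0, Fin.elim0, fun i => i.elim0, by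
    rintro _ rfl
    exact one_mem_genProgression _ _⟩

theorem Covered.mono {A S T : Set G} {m m' R R' : ℕ} (h : Covered A m R S) (hA : 1 ∈ A)
    (hm : m ≤ m') (hR : R ≤ R') (hT : T ⊆ S) : Covered A m' R' T := by
  obtain ⟨r, hr, x, L, hx, hSx⟩ := h
  exact ⟨r, hr.trans hR, x, L, fun i => (hx i).trans (Set.pow_subset_pow_right hA hm),
    hT.trans hSx⟩

theorem covered_list_prod {A : Set G} {m R : ℕ} {l : List (Set G)} (h : ∀ S ∈ l, Covered A m R S) :
    Covered A m (l.length * R) l.prod := by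
  induction l with
  | nil => simpa using covered_one A m
  | cons S l ih =>
    rw [List.prod_cons, List.length_cons, add_mul, one_mul, add_comm]
    exact (h S (by simp)).mul (ih fun T hT => h T (List.mem_cons_of_mem _ hT))

theorem covered_segment {A : Set G} {m : ℕ} {x : G} {L : ℕ} (h : segment x L ⊆ A ^ m) :
    Covered A m 1 (segment x L) := by
  refine ⟨1, le_rfl, fun _ => x, fun _ => L, fun _ => h, ?_⟩
  rintro _ ⟨l, hl, rfl⟩
  refine ⟨List.replicate l.natAbs (0, decide (0 ≤ l)), fun i => ?_, ?_⟩
  · rw [List.map_replicate]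
    exact List.count_le_length.trans (by simpa using hl)
  · rw [List.map_replicate, List.prod_replicate]
    simp only [decide_eq_true_eq]
    split_ifs with h0
    · rw [← zpow_natCast]
      congr 1
      omega
    · rw [inv_pow, ← zpow_natCast, ← zpow_neg]
      congr 1
      omega

theorem covered_of_finset {A : Set G} {m : ℕ} {X : Finset G}
    (h : ∀ x ∈ X, segment x 1 ⊆ A ^ m) : Covered A m X.card X :=
  ⟨X.card, le_rfl, fun i => X.equivFin.symm i, fun _ => 1, fun i => h _ (X.equivFin.symm i).2,
    fun g hg => by
      have := apply_mem_genProgression (fun i => (X.equivFin.symm i : G)) (L := fun _ => 1)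
        (i := X.equivFin ⟨g, hg⟩) one_pos
      simpa using this⟩

/-- The strengthening of `Covered` needed to double the lengths. -/
def Covered₂ (A : Set G) (m R : ℕ) (S : Set G) : Prop :=
  ∃ r ≤ R, ∃ (x : Fin r → G) (L : Fin r → ℕ), (∀ i, segment (x i) (2 * L i) ⊆ A ^ m) ∧
    S ⊆ GenProgression x L

theorem Covered.two {A S : Set G} {m R : ℕ} (h : Covered A m R S) : Covered₂ A (2 * m) R S := by
  obtain ⟨r, hr, x, L, hx, hSx⟩ := h
  refine ⟨r, hr, x, L, fun i => (segment_two_mul _ _).trans ?_, hSx⟩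
  rw [two_mul, pow_add]
  exact Set.mul_subset_mul (hx i) (hx i)

theorem Covered₂.mul_inv {A S : Set G} {m R : ℕ} (h : Covered₂ A m R S) :
    Covered A m R (S * S⁻¹) := by
  obtain ⟨r, hr, x, L, hx, hSx⟩ := h
  refine ⟨r, hr, x, fun i => 2 * L i, hx, ?_⟩
  rintro _ ⟨g, hg, h, hh, rfl⟩
  have := inv_mem_genProgression (hSx hh)
  rw [inv_inv] at this
  exact mul_mem_genProgression (hSx hg) this fun i => by omega

theorem Covered₂.finset_mul {A S : Set G} {m R : ℕ} (h : Covered₂ A m R S) {X : Finset G}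
    (hX : ∀ x ∈ X, segment x 2 ⊆ A ^ m) : Covered₂ A m (R + X.card) ((X : Set G) * S) := by
  obtain ⟨r, hr, x, L, hx, hSx⟩ := h
  refine ⟨X.card + r, by omega, Fin.append (fun i => X.equivFin.symm i) x,
    Fin.append (fun _ => 1) L, fun i => ?_, ?_⟩
  · refine Fin.addCases (fun i => ?_) (fun i => ?_) i
    · simpa using hX _ (X.equivFin.symm i).2
    · simpa using hx i
  · rintro _ ⟨g, hg, h, hh, rfl⟩
    refine mul_mem_genProgression_append ?_ (hSx hh)
    have := apply_mem_genProgression (fun i => (X.equivFin.symm i : G)) (L := fun _ => 1)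
      (i := X.equivFin ⟨g, hg⟩) one_pos
    simpa using this

theorem segment_subset_pow {A : Set G} {k : ℕ} (hA : Apx k A) {m L : ℕ} {x : G} (hx : x ∈ A ^ m) :
    segment x L ⊆ A ^ (m * L) := by
  rintro _ ⟨l, hl, rfl⟩
  have key : ∀ n ≤ L, x ^ n ∈ A ^ (m * L) := fun n hn => by
    have : x ^ n ∈ A ^ (m * n) := by
      rw [pow_mul]
      exact Set.pow_mem_pow hx
    exact hA.pow_mono (Nat.mul_le_mul_left _ hn) this
  obtain ⟨n, rfl | rfl⟩ := l.eq_nat_or_neg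
  · rw [zpow_natCast]
    exact key n (by simpa using hl)
  · rw [zpow_neg, zpow_natCast]
    exact hA.pow_inv_mem (key n (by simpa using hl))

/-- Chang's covering argument. -/
theorem Apx.covered_of_large {A : Set G} {k : ℕ} (hA : Apx k A) (Γ : Subgroup G) {m : ℕ}
    (hm : 4 ≤ m) (T : ℕ) : ∀ (E : Set G) (s R : ℕ), E ⊆ A ^ s ∩ Γ → Covered₂ A m R E →
      (A ^ 2 ∩ Γ).ncard * k ^ s < 2 ^ T * E.ncard →
      Covered A m (R + T * (2 * k ^ 2)) (A ^ 2 ∩ Γ) := by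
  classical
  induction T with
  | zero =>
    intro E s R hE _ hlt
    exfalso
    obtain ⟨Y, hY, _, hYs⟩ := hA.cov_inter Γ s
    have h1 : Cov (k ^ s) E (A ^ 2 ∩ Γ) := ⟨Y, hY, hE.trans
      ((Set.inter_subset_inter_left _ (hA.pow_mono (Nat.le_succ s))).trans hYs)⟩
    have := h1.ncard_le ((hA.pow_finite 2).inter_of_left _)
    rw [pow_zero, one_mul, mul_comm] at hlt
    omega
  | succ T ih =>
    intro E s R hE hcov hlt
    have hBfin : (A ^ 2 ∩ (Γ : Set G)).Finite := (hA.pow_finite 2).inter_of_left _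
    have hEfin : E.Finite := ((hA.pow_finite s).inter_of_left _).subset hE
    have hEne : E.Nonempty := by
      by_contra h
      rw [Set.not_nonempty_iff_eq_empty] at h
      simp [h] at hlt
    obtain ⟨X, hXs, hXsep, hXcov⟩ := exists_maximal_subset hBfin.toFinset
      (fun a b => ∃ e ∈ E, ∃ e' ∈ E, a * e = b * e')
      (fun a => hEne.elim fun e he => ⟨e, he, e, he, rfl⟩)
      (fun a b ⟨e, he, e', he', h⟩ => ⟨e', he', e, he, h.symm⟩)
    have hXB : ∀ x ∈ X, x ∈ A ^ 2 ∩ (Γ : Set G) := fun x hx => by simpa using hXs hx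
    have hXseg : ∀ x ∈ X, segment x 2 ⊆ A ^ m := fun x hx =>
      (segment_subset_pow hA (hXB x hx).1).trans (hA.pow_mono hm)
    by_cases hcard : X.card ≤ 2 * k ^ 2
    · have h1 : A ^ 2 ∩ (Γ : Set G) ⊆ (X : Set G) * (E * E⁻¹) := by
        intro b hb
        obtain ⟨x, hx, e, he, e', he', h⟩ := hXcov b (by simpa using hb)
        refine ⟨x, hx, e' * e⁻¹, Set.mul_mem_mul he' (Set.inv_mem_inv.2 he), ?_⟩
        simp only
        rw [← mul_assoc, ← h, mul_inv_cancel_right]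
      have h2 := (covered_of_finset fun x hx => (segment_mono one_le_two).trans (hXseg x hx)).mul
        hcov.mul_inv
      refine h2.mono hA.one le_rfl ?_ h1
      rw [add_mul, one_mul]
      omega
    · obtain ⟨X', hX'X, hX'card⟩ := Finset.exists_subset_card_eq (not_le.1 hcard).le
      have hc := ih ((X' : Set G) * E) (s + 2) (R + X'.card) ?_
        (hcov.finset_mul fun x hx => hXseg x (hX'X hx)) ?_
      · refine hc.mono hA.one le_rfl ?_ le_rfl
        rw [add_mul, one_mul, hX'card]
        omega
      · rintro _ ⟨x, hx, e, he, rfl⟩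
        refine ⟨?_, Γ.mul_mem (hXB x (hX'X hx)).2 (hE he).2⟩
        rw [add_comm]
        exact hA.mul_mem (hXB x (hX'X hx)).1 (hE he).1
      · have h1 : ((X' : Set G) * E).ncard = X'.card * E.ncard := by
          obtain ⟨Ef, rfl⟩ : ∃ Ef : Finset G, (Ef : Set G) = E := ⟨_, hEfin.coe_toFinset⟩
          rw [← Finset.coe_mul, Set.ncard_coe_finset, Set.ncard_coe_finset, Finset.card_mul_iff]
          rintro ⟨x, e⟩ hp ⟨x', e'⟩ hp' h
          simp only [Set.mem_prod, Finset.mem_coe] at hp hp' h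
          by_cases hxx : x = x'
          · subst hxx
            simpa using h
          · exact absurd ⟨e, hp.2, e', hp'.2, h⟩ (hXsep x (hX'X hp.1) x' (hX'X hp'.1) hxx)
        rw [h1, hX'card]
        have hk : 0 < k ^ 2 := pow_pos hA.pos 2
        calc _ = ((A ^ 2 ∩ (Γ : Set G)).ncard * k ^ s) * k ^ 2 := by ring
          _ < (2 ^ (T + 1) * E.ncard) * k ^ 2 := Nat.mul_lt_mul_of_pos_right hlt hk
          _ = _ := by ring

end Progression

section Fibre
variable {H Q : Type*} [Group H] [Group Q]

theorem ncard_image_mul_ncard_le (f : H →* Q) {P E : Set H} (hP : P.Finite) (hE : E.Finite)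
    (hf : ∀ e ∈ E, f e = 1) : (f '' P).ncard * E.ncard ≤ (P * E).ncard := by
  rw [← Set.ncard_prod]
  choose! s hs hfs using fun (q : Q) (hq : q ∈ f '' P) => hq
  refine Set.ncard_le_ncard_of_injOn (fun p : Q × H => s p.1 * p.2) ?_ ?_ (hP.mul hE)
  · rintro ⟨q, e⟩ ⟨hq, he⟩
    exact Set.mul_mem_mul (hs q hq) he
  · rintro ⟨q, e⟩ ⟨hq, he⟩ ⟨q', e'⟩ ⟨hq', he'⟩ h
    simp only at h hq he hq' he'
    have h1 := congrArg f h
    rw [map_mul, map_mul, hf e he, hf e' he', hfs q hq, hfs q' hq', mul_one, mul_one] at h1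
    subst h1
    simpa using h

theorem ncard_le_ncard_image_mul (f : H →* Q) {B D : Set H} (hB : B.Finite) (hD : D.Finite)
    (hBD : ∀ a ∈ B, ∀ b ∈ B, f a = f b → a⁻¹ * b ∈ D) :
    B.ncard ≤ (f '' B).ncard * D.ncard := by
  rw [← Set.ncard_prod]
  choose! s hs hfs using fun (q : Q) (hq : q ∈ f '' B) => hq
  refine Set.ncard_le_ncard_of_injOn (fun g : H => (f g, (s (f g))⁻¹ * g)) ?_ ?_
    ((hB.image f).prod hD)
  · intro g hg
    have hq := Set.mem_image_of_mem f hg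
    exact ⟨hq, hBD _ (hs _ hq) g hg (hfs _ hq)⟩
  · intro g hg g' hg' h
    obtain ⟨h1, h2⟩ := Prod.mk.inj h
    rw [h1] at h2
    simpa using h2

end Fibre

section Step

theorem list_prod_subset_pow {G : Type*} [Monoid G] {A : Set G} {l : List (Set G)}
    (h : ∀ S ∈ l, S ⊆ A) : l.prod ⊆ A ^ l.length := by
  induction l with
  | nil => simp
  | cons S l ih =>
    rw [List.prod_cons, List.length_cons, pow_succ']
    exact Set.mul_subset_mul (h S (by simp)) (ih fun T hT => h T (List.mem_cons_of_mem _ hT))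

theorem card_finset_prod_le {Q ι : Type*} [CommMonoid Q] [DecidableEq Q] (s : Finset ι)
    (Y : ι → Finset Q) : (∏ i ∈ s, Y i).card ≤ ∏ i ∈ s, (Y i).card := by
  classical
  induction s using Finset.induction_on with
  | empty => simp
  | insert i s hi ih =>
    rw [Finset.prod_insert hi, Finset.prod_insert hi]
    exact Finset.card_mul_le.trans (Nat.mul_le_mul_left _ ih)

/-- One step of the ascent along the central series: lifting a large progression of an abelian
quotient. -/
theorem Apx.covered_step {G : Type u} [Group G] {A : Set G} {k : ℕ} (hA : Apx k A)
    {Γ : Subgroup G} {Q : Type u} [CommGroup Q] (f : Γ →* Q) {m R T : ℕ} (hm : 2 ≤ m)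
    (hT : abelianConst (k ^ 3) * k ^ (31 * abelianRank (k ^ 3) + 5) < 2 ^ T)
    (hnss : ∀ W : Subgroup Q, (W : Set Q) ⊆ (f '' ((↑) ⁻¹' (A ^ 2))) ^ 8 → W = ⊥)
    (hE : ∀ (y : Q) (l : ℕ), segment y l ⊆ (f '' ((↑) ⁻¹' (A ^ 2))) ^ 8 →
      ∃ (E : Set Γ) (Y : Finset Q), Y.card ≤ k ^ 15 ∧ (↑) '' E ⊆ A ^ 16 ∧
        Covered A m R ((↑) '' E) ∧ segment y l ⊆ Y * f '' E)
    (h0 : ∃ E : Set Γ, (∀ g ∈ E, f g = 1) ∧ (↑) '' E ⊆ A ^ 2 ∧ Covered A m R ((↑) '' E) ∧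
      {g : Γ | (g : G) ∈ A ^ 4 ∧ f g = 1}.ncard ≤ k ^ 3 * E.ncard) :
    Covered A (2 * m) ((abelianRank (k ^ 3) + 1) * R + T * (2 * k ^ 2)) (A ^ 2 ∩ Γ) := by
  classical
  obtain ⟨d, x, L, hd, hL, hcard⟩ :=
    exists_progression_of_comm ((hA.subgroup Γ le_rfl).image f) hnss
  obtain ⟨E₀, hE₀f, hE₀A, hE₀c, hE₀⟩ := h0
  choose E Y hY hEA hEc hEY using fun i => hE (x i) (L i) (hL i)
  set B : Set Γ := (↑) ⁻¹' (A ^ 2) with hBdef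
  set P : Set Γ := (List.ofFn E).prod with hPdef
  have hk : 0 < k := hA.pos
  have hinj : Function.Injective ((↑) : Γ → G) := Subtype.val_injective
  have hPval : (↑) '' P = (List.ofFn fun i => ((↑) '' E i : Set G)).prod := by
    have := Set.image_list_prod Γ.subtype (List.ofFn E)
    rw [List.map_ofFn] at this
    exact this
  have hPA : ((↑) '' P : Set G) ⊆ A ^ (16 * d) := by
    rw [hPval, pow_mul]
    refine (list_prod_subset_pow (A := A ^ 16) fun S hS => ?_).trans (by rw [List.length_ofFn])
    obtain ⟨i, rfl⟩ := (List.mem_ofFn' _ _).1 hS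
    exact hEA i
  have hPfin : P.Finite := Set.Finite.of_finite_image ((hA.pow_finite _).subset hPA) hinj.injOn
  have hE₀fin : E₀.Finite := Set.Finite.of_finite_image ((hA.pow_finite _).subset hE₀A) hinj.injOn
  have hFval : ((↑) '' (P * E₀) : Set G) = (↑) '' P * (↑) '' E₀ := Set.image_mul Γ.subtype
  have hFA : ((↑) '' (P * E₀) : Set G) ⊆ A ^ (16 * d + 2) ∩ Γ := by
    refine Set.subset_inter ?_ ?_
    · rw [hFval, pow_add]
      exact Set.mul_subset_mul hPA hE₀A
    · rintro _ ⟨g, _, rfl⟩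
      exact g.2
  have hFc : Covered A m ((abelianRank (k ^ 3) + 1) * R) ((↑) '' (P * E₀) : Set G) := by
    rw [hFval, hPval]
    have h1 := (covered_list_prod (A := A) (m := m) (R := R)
      (l := List.ofFn fun i => ((↑) '' E i : Set G)) ?_).mul hE₀c
    · refine h1.mono hA.one le_rfl ?_ le_rfl
      rw [List.length_ofFn, add_mul, one_mul]
      exact Nat.add_le_add_right (Nat.mul_le_mul_right _ hd) _
    · intro S hS
      obtain ⟨i, rfl⟩ := (List.mem_ofFn' _ _).1 hS
      exact hEc i
  have hseg : (∏ i, segment (x i) (L i)).ncard ≤ k ^ (15 * d) * (f '' P).ncard := by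
    have hfP : f '' P = ∏ i, f '' E i := by
      rw [hPdef, Set.image_list_prod, List.map_ofFn, List.prod_ofFn]
      rfl
    have h1 : Cov (k ^ (15 * d)) (∏ i, segment (x i) (L i)) (f '' P) := by
      refine ⟨∏ i, Y i, ?_, ?_⟩
      · refine (card_finset_prod_le _ _).trans ((Finset.prod_le_prod' fun i _ => hY i).trans ?_)
        simp [pow_mul]
      · rw [hfP, Finset.coe_prod, ← Finset.prod_mul_distrib]
        exact Set.finsetProd_subset_finsetProd _ _ _ fun i _ => hEY i
    exact h1.ncard_le (hPfin.image f)
  have hBval : A ^ 2 ∩ (Γ : Set G) = (↑) '' B := by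
    rw [Set.inter_comm]
    exact (Subtype.image_preimage_coe (Γ : Set G) (A ^ 2)).symm
  have hB : B.ncard ≤ (f '' B).ncard * {g : Γ | (g : G) ∈ A ^ 4 ∧ f g = 1}.ncard := by
    refine ncard_le_ncard_image_mul f ((hA.subgroup Γ le_rfl).finite)
      (Set.Finite.of_finite_image ((hA.pow_finite 4).subset ?_) hinj.injOn) ?_
    · rintro _ ⟨g, hg, rfl⟩
      exact hg.1
    · intro a ha b hb hab
      exact ⟨hA.mul_mem (hA.pow_inv_mem (m := 2) ha) (n := 2) hb,
        by rw [map_mul, map_inv, hab, inv_mul_cancel]⟩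
  refine hA.covered_of_large Γ (by omega) T _ (16 * d + 2) _ hFA hFc.two ?_
  rw [hBval, Set.ncard_image_of_injective _ hinj, Set.ncard_image_of_injective _ hinj]
  have hP := ncard_image_mul_ncard_le f hPfin hE₀fin hE₀f
  have hle : B.ncard * k ^ (16 * d + 2) ≤
      abelianConst (k ^ 3) * k ^ (31 * d + 5) * ((f '' P).ncard * E₀.ncard) := by
    calc B.ncard * k ^ (16 * d + 2)
        ≤ ((abelianConst (k ^ 3) * (k ^ (15 * d) * (f '' P).ncard)) * (k ^ 3 * E₀.ncard))
          * k ^ (16 * d + 2) := by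
          gcongr
          exact hB.trans (Nat.mul_le_mul (hcard.trans (Nat.mul_le_mul_left _ hseg)) hE₀)
      _ = _ := by ring
  have hF : 0 < (P * E₀).ncard := by
    refine lt_of_lt_of_le (Nat.pos_of_ne_zero fun h => ?_) hP
    rw [h, mul_zero] at hle
    have h1 : 0 < B.ncard := (hA.subgroup Γ le_rfl).ncard_pos
    have := Nat.mul_pos h1 (pow_pos hk (16 * d + 2))
    omega
  calc B.ncard * k ^ (16 * d + 2)
      ≤ abelianConst (k ^ 3) * k ^ (31 * abelianRank (k ^ 3) + 5) * (P * E₀).ncard := by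
        refine hle.trans (Nat.mul_le_mul (Nat.mul_le_mul_left _ (Nat.pow_le_pow_right hk ?_)) hP)
        change d ≤ abelianRank (k ^ 3) at hd
        omega
    _ < 2 ^ T * (P * E₀).ncard := Nat.mul_lt_mul_of_pos_right hT hF

end Step

section Ascent
variable {G : Type u} [Group G]

theorem exists_comm_quotient (Γ N : Subgroup G) [N.Normal] (h : ⁅Γ, Γ⁆ ≤ N) :
    ∃ (Q : Type u) (_ : CommGroup Q) (f : Γ →* Q), Function.Surjective f ∧
      ∀ g : Γ, f g = 1 ↔ (g : G) ∈ N := by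
  let Q := Γ ⧸ N.subgroupOf Γ
  let _ : CommGroup Q :=
    { (inferInstance : Group Q) with
      mul_comm := by
        intro a b
        induction a using QuotientGroup.induction_on with | H a => ?_
        induction b using QuotientGroup.induction_on with | H b => ?_
        rw [← QuotientGroup.mk_mul, ← QuotientGroup.mk_mul, QuotientGroup.eq,
          Subgroup.mem_subgroupOf]
        refine h ?_
        have := Subgroup.commutator_mem_commutator (Γ.inv_mem b.2) (Γ.inv_mem a.2)
        rw [commutatorElement_def] at this
        simpa [mul_assoc] using this }
  exact ⟨Q, inferInstance, QuotientGroup.mk' _, QuotientGroup.mk'_surjective _, fun g => by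
    rw [QuotientGroup.mk'_apply, QuotientGroup.eq_one_iff, Subgroup.mem_subgroupOf]⟩

theorem coe_mem_pow {A : Set G} {Γ : Subgroup G} {m n : ℕ} {b : Γ}
    (hb : b ∈ ((↑) ⁻¹' (A ^ m) : Set Γ) ^ n) : (b : G) ∈ A ^ (m * n) := by
  have h1 : (b : G) ∈ Γ.subtype '' (((↑) ⁻¹' (A ^ m) : Set Γ) ^ n) := ⟨b, hb, rfl⟩
  rw [Set.image_pow] at h1
  rw [pow_mul]
  exact Set.pow_subset_pow_left (Set.image_preimage_subset _ _) h1

theorem commutator_zpow_mul_mem {i : ℕ} {a z z' : G} (j l : ℤ)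
    (hz : z ∈ Subgroup.upperCentralSeries G (i + 1))
    (hz' : z' ∈ Subgroup.upperCentralSeries G (i + 1)) :
    ⁅a ^ j * z, a ^ l * z'⁆ ∈ Subgroup.upperCentralSeries G i := by
  let π := QuotientGroup.mk' (Subgroup.upperCentralSeries G i)
  have hc : ∀ p q : G, Commute (π p) (π q) ↔ ⁅p, q⁆ ∈ Subgroup.upperCentralSeries G i := by
    intro p q
    rw [← commutatorElement_eq_one_iff_commute, ← map_commutatorElement]
    exact QuotientGroup.eq_one_iff _
  have h1 : ∀ y, Commute (π z) (π y) := fun y =>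
    (hc z y).2 (Subgroup.mem_upperCentralSeries_succ_iff.1 hz y)
  have h2 : ∀ y, Commute (π z') (π y) := fun y =>
    (hc z' y).2 (Subgroup.mem_upperCentralSeries_succ_iff.1 hz' y)
  rw [← hc, map_mul π (a ^ j) z]
  refine Commute.mul_left ?_ (h1 _)
  rw [map_mul]
  refine Commute.mul_right ?_ (h2 _).symm
  rw [map_zpow, map_zpow]
  exact Commute.zpow_zpow_self _ _ _

/-- The rank of the progressions produced along the central series. -/
def ascentRank (D T : ℕ) : ℕ → ℕ
  | 0 => (D + 1) * 1 + T
  | i + 1 => (D + 1) * ascentRank D T i + T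

/-- If the upper central series absorbs small subgroups, then pieces of `A` are covered by
nilprogressions of bounded rank. -/
theorem Apx.covered_ascent {A : Set G} {k T n : ℕ} (hA : Apx k A)
    (hT : abelianConst (k ^ 3) * k ^ (31 * abelianRank (k ^ 3) + 5) < 2 ^ T)
    (hW : ∀ i ≤ n, ∀ W : Subgroup G, (W : Set G) ⊆ A ^ 16 * Subgroup.upperCentralSeries G i →
      W ≤ Subgroup.upperCentralSeries G i) : ∀ i ≤ n, ∀ Γ : Subgroup G,
    ⁅Γ, Γ⁆ ≤ Subgroup.upperCentralSeries G i →
    Covered A (2 ^ (i + 5)) (ascentRank (abelianRank (k ^ 3)) (T * (2 * k ^ 2)) i)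
      (A ^ 2 ∩ Γ) := by
  classical
  have hk := hA.pos
  have key : ∀ i ≤ n, ∀ Γ : Subgroup G, ∀ (Q : Type u) [CommGroup Q] (f : Γ →* Q),
      Function.Surjective f → (∀ g : Γ, f g = 1 ↔ (g : G) ∈ Subgroup.upperCentralSeries G i) →
      ∀ W : Subgroup Q, (W : Set Q) ⊆ (f '' ((↑) ⁻¹' (A ^ 2))) ^ 8 → W = ⊥ := by
    intro i hi Γ Q _ f hfs hf W hWs
    rw [← Set.image_pow] at hWs
    have h1 := hW i hi ((W.comap f).map Γ.subtype) ?_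
    · rw [eq_bot_iff]
      intro w hw
      obtain ⟨g, rfl⟩ := hfs w
      exact (hf g).2 (h1 ⟨g, hw, rfl⟩)
    · rintro _ ⟨g, hg, rfl⟩
      obtain ⟨b, hb, hbg⟩ := hWs hg
      refine ⟨b, coe_mem_pow hb, (b : G)⁻¹ * g, ?_, by simp⟩
      have := (hf (b⁻¹ * g)).1 (by rw [map_mul, map_inv, hbg, inv_mul_cancel])
      simpa using this
  intro i
  induction i with
  | zero =>
    intro hi Γ hΓ
    obtain ⟨Q, _, f, hfs, hf⟩ := exists_comm_quotient Γ _ hΓ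
    have hf1 : ∀ g h : Γ, f g = f h → g = h := by
      intro g h hgh
      have := (hf (g⁻¹ * h)).1 (by rw [map_mul, map_inv, hgh, inv_mul_cancel])
      rw [Subgroup.upperCentralSeries_zero, Subgroup.mem_bot] at this
      exact inv_mul_eq_one.1 (Subtype.ext this)
    refine hA.covered_step f (m := 16) (R := 1) (by norm_num) hT (key 0 hi Γ Q f hfs hf) ?_ ?_
    · intro y l hy
      rw [← Set.image_pow] at hy
      obtain ⟨a, rfl⟩ := hfs y
      have hEA : ((↑) '' (f ⁻¹' segment (f a) l) : Set G) ⊆ A ^ 16 := by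
        rintro _ ⟨g, hg, rfl⟩
        obtain ⟨b, hb, hbg⟩ := hy hg
        rw [← hf1 _ _ hbg]
        exact coe_mem_pow hb
      refine ⟨f ⁻¹' segment (f a) l, {1}, by simpa using Nat.one_le_pow _ _ hk, hEA, ?_, ?_⟩
      · refine (covered_segment (x := (a : G)) (L := l) ?_).mono hA.one le_rfl le_rfl ?_
        · rintro _ ⟨j, hj, rfl⟩
          exact hEA ⟨a ^ j, ⟨j, hj, map_zpow f a j⟩, by simp⟩
        · rintro _ ⟨g, ⟨j, hj, hg⟩, rfl⟩
          rw [← map_zpow] at hg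
          exact ⟨j, hj, by rw [hf1 _ _ hg, Subgroup.coe_zpow]⟩
      · rw [Finset.coe_singleton, Set.singleton_one, one_mul,
          Set.image_preimage_eq _ hfs]
    · refine ⟨{1}, by simp, by simpa using hA.one_pow 2,
        (covered_one A 16).mono hA.one le_rfl (Nat.zero_le _) (by simp), ?_⟩
      have h1 : {g : Γ | (g : G) ∈ A ^ 4 ∧ f g = 1} ⊆ {1} := by
        rintro g ⟨_, hg⟩
        exact hf1 _ _ (hg.trans (map_one f).symm)
      refine (Set.ncard_le_ncard h1).trans ?_
      rw [Set.ncard_singleton, mul_one]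
      exact Nat.one_le_pow _ _ hk
  | succ i ih =>
    intro hi Γ hΓ
    obtain ⟨Q, _, f, hfs, hf⟩ := exists_comm_quotient Γ _ hΓ
    have hinj : Function.Injective ((↑) : Γ → G) := Subtype.val_injective
    let C : Q → Subgroup G := fun y => ((Subgroup.zpowers y).comap f).map Γ.subtype
    have hC : ∀ y, ⁅C y, C y⁆ ≤ Subgroup.upperCentralSeries G i := by
      intro y
      obtain ⟨a, rfl⟩ := hfs y
      have hel : ∀ g ∈ C (f a), ∃ j : ℤ, ∃ z ∈ Subgroup.upperCentralSeries G (i + 1),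
          g = (a : G) ^ j * z := by
        rintro _ ⟨g, ⟨j, hj⟩, rfl⟩
        refine ⟨j, ((a : G) ^ j)⁻¹ * g, ?_, by simp⟩
        have := (hf ((a ^ j)⁻¹ * g)).1 (by
          rw [map_mul, map_inv, map_zpow, ← hj, inv_mul_cancel])
        simpa using this
      rw [Subgroup.commutator_le]
      intro g hg h hh
      obtain ⟨j, z, hz, rfl⟩ := hel g hg
      obtain ⟨l, z', hz', rfl⟩ := hel h hh
      exact commutator_zpow_mul_mem j l hz hz'
    have hval : ∀ y m, ((↑) '' {g : Γ | (g : G) ∈ A ^ m ∧ f g ∈ Subgroup.zpowers y} : Set G) =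
        A ^ m ∩ C y := by
      intro y m
      ext g
      constructor
      · rintro ⟨g, ⟨h1, h2⟩, rfl⟩
        exact ⟨h1, g, h2, rfl⟩
      · rintro ⟨h1, g, h2, rfl⟩
        exact ⟨g, ⟨h1, h2⟩, rfl⟩
    have hcov := fun y => ih (Nat.le_of_succ_le hi) (C y) (hC y)
    rw [show 2 ^ (i + 1 + 5) = 2 * 2 ^ (i + 5) by ring]
    refine hA.covered_step f ?_ hT (key _ hi Γ Q f hfs hf) ?_ ?_
    · calc 2 = 2 ^ 1 := rfl
        _ ≤ 2 ^ (i + 5) := Nat.pow_le_pow_right (by norm_num) (by omega)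
    · intro y l hy
      rw [← Set.image_pow] at hy
      obtain ⟨Y, hY, hYC, hAY⟩ := hA.cov_inter (C y) 15
      have hYΓ : ∀ g ∈ Y, g ∈ Γ := fun g hg => by
        obtain ⟨g, _, rfl⟩ := (hYC hg).2
        exact g.2
      refine ⟨{g : Γ | (g : G) ∈ A ^ 2 ∧ f g ∈ Subgroup.zpowers y},
        (Y.preimage (↑) hinj.injOn).image f, ?_, ?_, ?_, ?_⟩
      · refine Finset.card_image_le.trans (le_trans ?_ hY)
        rw [Finset.card_preimage]
        exact Finset.card_filter_le _ _
      · rw [hval]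
        exact Set.inter_subset_left.trans (hA.pow_mono (by norm_num))
      · rw [hval]
        exact hcov y
      · intro q hq
        obtain ⟨b, hb, rfl⟩ := hy hq
        have hbC : f b ∈ Subgroup.zpowers y := by
          obtain ⟨j, _, hj⟩ := hq
          exact ⟨j, hj.symm⟩
        obtain ⟨g, hg, h, hh, hgh⟩ := hAY ⟨coe_mem_pow hb, b, hbC, rfl⟩
        rw [← hval] at hh
        obtain ⟨h, hh, rfl⟩ := hh
        refine ⟨f ⟨g, hYΓ g hg⟩, ?_, f h, ⟨h, hh, rfl⟩, ?_⟩
        · rw [Finset.coe_image]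
          exact ⟨_, by simpa using hg, rfl⟩
        · simp only
          rw [← map_mul]
          congr 1
          exact Subtype.ext hgh
    · have h1 : ∀ m, {g : Γ | (g : G) ∈ A ^ m ∧ f g = 1} =
          {g : Γ | (g : G) ∈ A ^ m ∧ f g ∈ Subgroup.zpowers (1 : Q)} := by
        simp
      refine ⟨{g : Γ | (g : G) ∈ A ^ 2 ∧ f g = 1}, fun g hg => hg.2, ?_, ?_, ?_⟩
      · rw [h1, hval]
        exact Set.inter_subset_left
      · rw [h1, hval]
        exact hcov 1
      · rw [h1, h1, ← Set.ncard_image_of_injective _ hinj, hval,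
          ← Set.ncard_image_of_injective _ hinj, hval]
        obtain ⟨Y, hY, -, hAY⟩ := hA.cov_inter (C 1) 3
        exact Cov.ncard_le ⟨Y, hY, hAY⟩ ((hA.pow_finite 2).inter_of_left _)

end Ascent

section Model
variable {G Q : Type*} [Group G] [Group Q]

/-- Left-normed commutators of weight `n + 1` in elements of `X`. -/
def leftComm (X : Set G) : ℕ → Set G
  | 0 => X
  | n + 1 => {g | ∃ c ∈ leftComm X n, ∃ x ∈ X, ⁅c, x⁆ = g}

theorem image_leftComm (f : G →* Q) (X : Set G) (n : ℕ) :
    f '' leftComm X n = leftComm (f '' X) n := by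
  induction n with
  | zero => rfl
  | succ n ih =>
    ext q
    constructor
    · rintro ⟨_, ⟨c, hc, x, hx, rfl⟩, rfl⟩
      exact ⟨f c, ih ▸ ⟨c, hc, rfl⟩, f x, ⟨x, hx, rfl⟩, (map_commutatorElement f c x).symm⟩
    · rintro ⟨d, hd, _, ⟨x, hx, rfl⟩, rfl⟩
      rw [← ih] at hd
      obtain ⟨c, hc, rfl⟩ := hd
      exact ⟨⁅c, x⁆, ⟨c, hc, x, hx, rfl⟩, map_commutatorElement f c x⟩

theorem leftComm_subset_lowerCentralSeries (X : Set G) (n : ℕ) :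
    leftComm X n ⊆ (⊤ : Subgroup G).lowerCentralSeries n := by
  induction n with
  | zero => simp
  | succ n ih =>
    rintro _ ⟨c, hc, x, _, rfl⟩
    exact Subgroup.commutator_mem_commutator (ih hc) (Subgroup.mem_top x)

theorem upperCentralSeries_eq_top_of_leftComm {X : Set G} (hX : Subgroup.closure X = ⊤) {n : ℕ}
    (h : leftComm X n ⊆ {1}) : Subgroup.upperCentralSeries G n = ⊤ := by
  have key : ∀ j ≤ n, leftComm X (n - j) ⊆ Subgroup.upperCentralSeries G j := by
    intro j
    induction j with
    | zero =>
      intro _ c hc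
      rw [Subgroup.upperCentralSeries_zero]
      exact h hc
    | succ j ih =>
      intro hj c hc
      refine Subgroup.mem_upperCentralSeries_succ_iff.2 fun y => ?_
      let π := QuotientGroup.mk' (Subgroup.upperCentralSeries G j)
      have hπ : ∀ y, ⁅c, y⁆ ∈ Subgroup.upperCentralSeries G j ↔
          y ∈ (Subgroup.centralizer {π c}).comap π := by
        intro y
        rw [Subgroup.mem_comap, Subgroup.mem_centralizer_singleton_iff, eq_comm,
          ← commutatorElement_eq_one_iff_mul_comm, ← map_commutatorElement]
        exact (QuotientGroup.eq_one_iff _).symm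
      rw [hπ]
      have hle : Subgroup.closure X ≤ (Subgroup.centralizer {π c}).comap π := by
        rw [Subgroup.closure_le]
        intro x hx
        refine (hπ x).1 (ih (Nat.le_of_succ_le hj) ?_)
        rw [show n - j = n - (j + 1) + 1 by omega]
        exact ⟨c, hc, x, hx, rfl⟩
      exact hle (hX ▸ Subgroup.mem_top y)
  have h1 := key n le_rfl
  rw [Nat.sub_self] at h1
  rw [eq_top_iff, ← hX, Subgroup.closure_le]
  exact h1

/-- `A` is covered by `N` translates of a coset nilprogression, described by elements of `G`. -/
def HasModel (A : Set G) (m r n N : ℕ) : Prop :=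
  ∃ (V : Subgroup G) (x : Fin r → G) (L : Fin r → ℕ), (V : Set G) ⊆ A ^ m ∧
    (∀ i, ∀ v ∈ V, x i * v * (x i)⁻¹ ∈ V ∧ (x i)⁻¹ * v * x i ∈ V) ∧
    leftComm (Set.range x) n ⊆ V ∧ (∀ i, 0 < L i) ∧ GenProgression x L ⊆ A ^ m ∧
    Cov N A (GenProgression x L * V)

theorem image_genProgression (f : G →* Q) {r : ℕ} (x : Fin r → G) (L : Fin r → ℕ) :
    f '' GenProgression x L = GenProgression (fun i => f (x i)) L := by
  have key : ∀ w : List (Fin r × Bool),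
      f (w.map fun p => if p.2 then x p.1 else (x p.1)⁻¹).prod =
        (w.map fun p => if p.2 then f (x p.1) else (f (x p.1))⁻¹).prod := by
    intro w
    rw [map_list_prod, List.map_map]
    congr 1
    refine List.map_congr_left fun p _ => ?_
    simp only [Function.comp_apply]
    split_ifs
    · rfl
    · exact map_inv f _
  ext q
  constructor
  · rintro ⟨_, ⟨w, hw, rfl⟩, rfl⟩
    exact ⟨w, hw, (key w).symm⟩
  · rintro ⟨w, hw, rfl⟩
    exact ⟨_, ⟨w, hw, rfl⟩, key w⟩

theorem HasModel.isCosetNilprogression {A : Set G} {m r n N : ℕ} (h : HasModel A m r n N) :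
    ∃ P, IsCosetNilprogression r n P ∧ P ⊆ A ^ (2 * m) ∧ Cov N A P := by
  obtain ⟨V, x, L, hVA, hxV, hcomm, hL, hxA, hcov⟩ := h
  refine ⟨GenProgression x L * V, ?_, ?_, hcov⟩
  · let C : Subgroup G := Subgroup.closure (Set.range x ∪ V)
    have hVC : V ≤ C := fun v hv => Subgroup.subset_closure (Or.inr hv)
    have hxC : ∀ i, x i ∈ C := fun i => Subgroup.subset_closure (Or.inl ⟨i, rfl⟩)
    have hCV : C ≤ Subgroup.normalizer (V : Set G) := by
      rw [Subgroup.closure_le]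
      rintro g (⟨i, rfl⟩ | hg)
      · refine Subgroup.mem_normalizer_iff.2 fun v => ⟨fun hv => (hxV i v hv).1, fun hv => ?_⟩
        have := (hxV i _ hv).2
        simpa [mul_assoc] using this
      · exact Subgroup.le_normalizer hg
    let H : Subgroup C := V.subgroupOf C
    have hH : H.Normal := Subgroup.normal_subgroupOf_iff_le_normalizer hVC |>.2 hCV
    let y : Fin r → C := fun i => ⟨x i, hxC i⟩
    let π : C →* C ⧸ H := QuotientGroup.mk' H
    have hy : C.subtype '' Set.range y = Set.range x := by
      rw [← Set.range_comp]
      rfl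
    refine ⟨C, H, hH, GenProgression (fun i => π (y i)) L, ⟨fun i => π (y i), L, hL, ?_, rfl⟩, ?_⟩
    · set D := Subgroup.closure (Set.range fun i => π (y i)) with hD
      refine upperCentralSeries_eq_top_of_leftComm
        (X := ((↑) ⁻¹' Set.range fun i => π (y i) : Set D)) ?_ ?_
      · exact Subgroup.closure_closure_coe_preimage
      · intro d hd
        have h1 : D.subtype d ∈ D.subtype '' leftComm _ n := ⟨d, hd, rfl⟩
        rw [image_leftComm] at h1
        have h2 : D.subtype '' ((↑) ⁻¹' Set.range fun i => π (y i) : Set D) = π '' Set.range y := by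
          rw [← Set.range_comp]
          exact (Subtype.image_preimage_coe (D : Set (C ⧸ H)) _).trans
            (Set.inter_eq_right.2 Subgroup.subset_closure)
        rw [h2, ← image_leftComm] at h1
        obtain ⟨c, hc, hcd⟩ := h1
        have h3 : C.subtype c ∈ C.subtype '' leftComm _ n := ⟨c, hc, rfl⟩
        rw [image_leftComm, hy] at h3
        have h4 : π c = 1 := (QuotientGroup.eq_one_iff c).2 (Subgroup.mem_subgroupOf.2 (hcomm h3))
        rw [h4] at hcd
        exact Subtype.ext hcd.symm
    · have h5 : GenProgression x L = C.subtype '' GenProgression y L :=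
        (image_genProgression C.subtype y L).symm
      rw [← image_genProgression π y L, h5]
      ext g
      constructor
      · rintro ⟨_, ⟨c, hc, rfl⟩, v, hv, rfl⟩
        refine ⟨c * ⟨v, hVC hv⟩, ⟨c, hc, ?_⟩, rfl⟩
        refine QuotientGroup.eq.2 ?_
        rw [inv_mul_cancel_left]
        exact hv
      · rintro ⟨g, ⟨c, hc, hcg⟩, rfl⟩
        have hcH : c⁻¹ * g ∈ H := QuotientGroup.eq.1 hcg
        exact ⟨c, ⟨c, hc, rfl⟩, (c : G)⁻¹ * g, hcH, by simp⟩
  · rw [two_mul, pow_add]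
    exact Set.mul_subset_mul hxA hVA

/-- Models can be pulled back along homomorphisms injective on a large power of `A`. -/
theorem HasModel.of_image {A : Set G} {k m r n N M : ℕ} (hA : Apx k A) (π : G →* Q)
    (hπ : ∀ g ∈ A ^ M, π g = 1 → g = 1) (hM : 4 ^ n * m + 5 * m + 2 ≤ M)
    (h : HasModel (π '' A) m r n N) : HasModel A m r n N := by
  classical
  obtain ⟨V, y, L, hVA, hyV, hcomm, hL, hyA, X, hX, hXA⟩ := h
  have hinj : ∀ {a b : ℕ} {g h : G}, g ∈ A ^ a → h ∈ A ^ b → a + b ≤ M → π g = π h → g = h := by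
    intro a b g h hg hh hab hgh
    refine mul_inv_eq_one.1 (hπ _ (hA.pow_mono hab (hA.mul_mem hg (hA.pow_inv_mem hh))) ?_)
    rw [map_mul, map_inv, hgh, mul_inv_cancel]
  have hlift : ∀ {a : ℕ} {q : Q}, q ∈ (π '' A) ^ a → ∃ g ∈ A ^ a, π g = q := by
    intro a q hq
    rwa [← Set.image_pow] at hq
  have hV : ∀ {a : ℕ} {g : G}, g ∈ A ^ a → a + m ≤ M → π g ∈ V → g ∈ A ^ m := by
    intro a g hg ha hgV
    obtain ⟨h, hh, hgh⟩ := hlift (hVA hgV)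
    rwa [hinj hg hh ha hgh.symm]
  let W : Subgroup G :=
    { carrier := {g | g ∈ A ^ m ∧ π g ∈ V}
      one_mem' := ⟨hA.one_pow m, by simp⟩
      mul_mem' := by
        rintro g h ⟨hg, hgV⟩ ⟨hh, hhV⟩
        have h1 : π (g * h) ∈ V := by
          rw [map_mul]
          exact V.mul_mem hgV hhV
        exact ⟨hV (hA.mul_mem hg hh) (by omega) h1, h1⟩
      inv_mem' := by
        rintro g ⟨hg, hgV⟩
        exact ⟨hA.pow_inv_mem hg, by simpa using hgV⟩ }
  have hW : ∀ {a : ℕ} {g : G}, g ∈ A ^ a → a + m ≤ M → π g ∈ V → g ∈ W :=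
    fun hg ha hgV => ⟨hV hg ha hgV, hgV⟩
  choose x hxA hxy using fun i => hlift (hyA (apply_mem_genProgression y (hL i)))
  have hxA' : ∀ i, (x i)⁻¹ ∈ A ^ m := fun i => hA.pow_inv_mem (hxA i)
  obtain rfl : (fun i => π (x i)) = y := funext hxy
  have hpow : ∀ j, m ≤ 4 ^ j * m := fun j => Nat.le_mul_of_pos_left _ (by positivity)
  have hrange : π '' Set.range x = Set.range fun i => π (x i) := by
    rw [← Set.range_comp]
    rfl
  have hcA : ∀ j, leftComm (Set.range x) j ⊆ A ^ (4 ^ j * m) := by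
    intro j
    induction j with
    | zero =>
      rintro _ ⟨i, rfl⟩
      simpa using hxA i
    | succ j ih =>
      rintro _ ⟨c, hc, _, ⟨i, rfl⟩, rfl⟩
      rw [commutatorElement_def]
      refine hA.pow_mono ?_ (hA.mul_mem (hA.mul_mem (hA.mul_mem (ih hc) (hxA i))
        (hA.pow_inv_mem (ih hc))) (hxA' i))
      have := hpow j
      rw [pow_succ]
      linarith
  have hword : ∀ w : List (Fin r × Bool), (∀ i : Fin r, (w.map Prod.fst).count i ≤ L i) →
      (w.map fun p => if p.2 then x p.1 else (x p.1)⁻¹).prod ∈ A ^ m := by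
    intro w
    induction w with
    | nil => exact fun _ => by simpa using hA.one_pow m
    | cons p w ih =>
      intro hw
      have h1 := ih fun i => le_trans (by
        rw [List.map_cons, List.count_cons]
        exact Nat.le_add_right _ _) (hw i)
      have h2 : π ((p :: w).map fun p => if p.2 then x p.1 else (x p.1)⁻¹).prod ∈ (π '' A) ^ m := by
        apply hyA
        rw [← image_genProgression]
        exact ⟨_, ⟨_, hw, rfl⟩, rfl⟩
      obtain ⟨g, hg, hgw⟩ := hlift h2
      have h3 : (if p.2 then x p.1 else (x p.1)⁻¹) ∈ A ^ m := by
        split_ifs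
        · exact hxA _
        · exact hxA' _
      have h4 := hinj (a := m + m) (b := m) (by
        rw [List.map_cons, List.prod_cons]
        exact hA.mul_mem h3 h1) hg (by omega) hgw.symm
      rwa [h4]
  refine ⟨W, x, L, fun g hg => hg.1, fun i v hv => ⟨?_, ?_⟩, ?_, hL, ?_, ?_⟩
  · refine hW (hA.mul_mem (hA.mul_mem (hxA i) hv.1) (hxA' i)) (by omega) ?_
    simpa using (hyV i _ hv.2).1
  · refine hW (hA.mul_mem (hA.mul_mem (hxA' i) hv.1) (hxA i)) (by omega) ?_
    simpa using (hyV i _ hv.2).2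
  · intro c hc
    refine hW (hcA n hc) (by omega) (hcomm ?_)
    rw [← hrange, ← image_leftComm]
    exact ⟨c, hc, rfl⟩
  · rintro _ ⟨w, hw, rfl⟩
    exact hword w hw
  · choose! s hs using fun (q : Q) (hq : q ∈ (π '' A) ^ (1 + 2 * m)) => hlift hq
    refine ⟨X.image s, Finset.card_image_le.trans hX, fun a ha => ?_⟩
    obtain ⟨z, hz, _, ⟨p, hp, v, hv, rfl⟩, hzpv⟩ := hXA ⟨a, ha, rfl⟩
    simp only at hzpv
    obtain ⟨v', hv', rfl⟩ := hlift (hVA hv)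
    rw [← image_genProgression] at hp
    obtain ⟨_, ⟨w, hw, rfl⟩, rfl⟩ := hp
    set p := (w.map fun p => if p.2 then x p.1 else (x p.1)⁻¹).prod with hpdef
    have hpA : p ∈ A ^ m := hword w hw
    have hz' : z = π (a * (p * v')⁻¹) := by
      rw [map_mul, map_inv, map_mul, ← hzpv, mul_inv_cancel_right]
    have hzA : z ∈ (π '' A) ^ (1 + 2 * m) := by
      rw [hz', ← Set.image_pow]
      refine ⟨_, ?_, rfl⟩
      rw [two_mul]
      exact hA.mul_mem (by simpa using ha) (hA.pow_inv_mem (hA.mul_mem hpA hv'))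
    obtain ⟨h1, h2⟩ := hs z hzA
    refine ⟨s z, ?_, p * v', ⟨p, ⟨w, hw, rfl⟩, v', ⟨hv', hv⟩, rfl⟩, ?_⟩
    · rw [Finset.coe_image]
      exact ⟨z, hz, rfl⟩
    · refine hinj (hA.mul_mem h1 (hA.mul_mem hpA hv')) (b := 1) (by simpa using ha) (by omega) ?_
      rw [map_mul, h2, map_mul]
      exact hzpv

end Model

section Nilpotent

theorem genProgression_subset_of_pos {G : Type*} [Group G] {r : ℕ} {x y : Fin r → G}
    {L M : Fin r → ℕ} (hxy : ∀ i, 0 < L i → y i = x i) (hL : ∀ i, L i ≤ M i) :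
    GenProgression x L ⊆ GenProgression y M := by
  rintro _ ⟨w, hw, rfl⟩
  refine ⟨w, fun i => (hw i).trans (hL i), ?_⟩
  congr 1
  refine List.map_congr_left fun p hp => ?_
  rw [hxy p.1 (lt_of_lt_of_le ?_ (hw p.1))]
  exact List.count_pos_iff.2 (List.mem_map_of_mem hp)

theorem Covered.exists_pos {G : Type*} [Group G] {A S : Set G} {m R : ℕ} (h : Covered A m R S)
    (hA : 1 ∈ A) : ∃ r ≤ R, ∃ (x : Fin r → G) (L : Fin r → ℕ), (∀ i, 0 < L i) ∧
      (∀ i, segment (x i) (L i) ⊆ A ^ m) ∧ S ⊆ GenProgression x L := by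
  obtain ⟨r, hr, x, L, hx, hS⟩ := h
  refine ⟨r, hr, fun i => if L i = 0 then 1 else x i, fun i => max (L i) 1,
    fun i => by simp, fun i => ?_, hS.trans (genProgression_subset_of_pos ?_ ?_)⟩
  · by_cases h0 : L i = 0
    · rintro _ ⟨l, _, rfl⟩
      simpa [h0] using Set.one_mem_pow hA
    · simp only [h0, if_false]
      rw [max_eq_left (by omega)]
      exact hx i
  · intro i hi
    rw [if_neg hi.ne']
  · intro i
    exact le_max_left _ _

theorem ascentRank_mono (D T : ℕ) : Monotone (ascentRank D T) :=
  monotone_nat_of_le_succ fun n => by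
    rw [ascentRank]
    nlinarith

/-- Coset nilprogressions covering an approximate subgroup of a nilpotent group. -/
theorem exists_model_of_isNilpotent (k T : ℕ)
    (hT : abelianConst ((k ^ 11) ^ 3) * (k ^ 11) ^ (31 * abelianRank ((k ^ 11) ^ 3) + 5) < 2 ^ T) :
    ∃ m, ∀ (G : Type u) [Group G] [Group.IsNilpotent G] (A : Set G), Apx k A →
      ∃ r ≤ ascentRank (abelianRank ((k ^ 11) ^ 3)) (T * (2 * (k ^ 11) ^ 2)) (k ^ 6),
      ∃ n ≤ k ^ 6, HasModel A m r n (k ^ (15 * k ^ 6)) := by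
  classical
  choose F hF using exists_genProgression_subset.{u}
  set R := ascentRank (abelianRank ((k ^ 11) ^ 3)) (T * (2 * (k ^ 11) ^ 2)) (k ^ 6) with hR
  set N := k ^ 6 with hN
  set q := trapExp 34 N with hq
  set p := 2 + (q + 4) * (k ^ 11) ^ (q + 4) with hp
  set Φ := ∑ r ∈ Finset.range (R + 1), ∑ s ∈ Finset.range (N + 1), F r s with hΦ
  set M := 2 ^ (N + 5) * Φ with hM
  refine ⟨6 * (M + p), fun G _ _ A hA => ?_⟩
  obtain ⟨n, hn, C, H, hHC, hC, htower, hCH, hcov⟩ := exists_tower hA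
  set B : Set C := (↑) ⁻¹' (A ^ 6) with hBdef
  have hB : Apx (k ^ 11) B := hA.subgroup C (m := 6) (by norm_num)
  have hBgen : Subgroup.closure B = ⊤ := by
    refine Subgroup.map_injective C.subtype_injective ?_
    rw [MonoidHom.map_closure, ← MonoidHom.range_eq_map, Subgroup.range_subtype]
    have h1 : C.subtype '' B = A ^ 6 ∩ C :=
      (Subtype.image_preimage_coe (C : Set G) (A ^ 6)).trans (Set.inter_comm _ _)
    rw [h1]
    exact le_antisymm ((Subgroup.closure_le _).2 Set.inter_subset_right) hC
  obtain ⟨V, hV, hVB, hVW⟩ := exists_collapse hB q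
  let f : C →* C ⧸ V := QuotientGroup.mk' V
  have hf : Function.Surjective f := QuotientGroup.mk'_surjective V
  have hfV : ∀ g h : C, f g = f h ↔ g⁻¹ * h ∈ V := fun g h => QuotientGroup.eq
  have hB' := hB.image f
  have hgen : Subgroup.closure (f '' B) = ⊤ := by
    rw [← MonoidHom.map_closure, hBgen, Subgroup.map_top_of_surjective f hf]
  have hlift : ∀ {j : ℕ} {g : C}, f g ∈ (f '' B) ^ j → g ∈ B ^ j * (V : Set C) := by
    intro j g hg
    rw [← Set.image_pow] at hg
    obtain ⟨b, hb, hbg⟩ := hg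
    exact ⟨b, hb, b⁻¹ * g, (hfV b g).1 hbg, by simp⟩
  have htrap₀ : Trap (f '' B) q 0 := by
    intro W hW hWB
    rw [Subgroup.upperCentralSeries_zero, Subgroup.coe_bot, Set.singleton_one, mul_one] at hWB
    have h1 := hVW (W.comap f) inferInstance fun g hg => hlift (hWB hg)
    rw [Subgroup.upperCentralSeries_zero]
    intro w hw
    obtain ⟨g, rfl⟩ := hf w
    exact (QuotientGroup.eq_one_iff g).2 (h1 hw)
  have htrap : ∀ i ≤ n, Trap (f '' B) 34 i := fun i hi =>
    trap_of_zero hB' hgen htrap₀ (hi.trans hn)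
  have hZ : Subgroup.upperCentralSeries (C ⧸ V) n = ⊤ := by
    have hle := htower.map_le hHC f hf (B := f '' B)
      (fun g hg => ⟨g, hA.pow_mono (m := 2) (n := 6) (by norm_num) hg, rfl⟩)
      fun i hi => (htrap i hi).mono hB'.one (by norm_num)
    rw [eq_top_iff]
    refine (htrap n le_rfl).mono hB'.one (q' := 1) (by norm_num) ⊤ inferInstance fun x _ => ?_
    obtain ⟨g, rfl⟩ := hf x
    obtain ⟨a, ha, h, hh, hah⟩ := hCH g.2
    have haC : a ∈ C := by
      have : a = g * h⁻¹ := by rw [← hah, mul_inv_cancel_right]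
      rw [this]
      exact C.mul_mem g.2 (C.inv_mem (hHC hh))
    have hg : g = ⟨a, haC⟩ * ⟨h, hHC hh⟩ := Subtype.ext hah.symm
    rw [hg, map_mul, pow_one]
    exact Set.mul_mem_mul ⟨_, hA.pow_mono (m := 2) (n := 6) (by norm_num) ha, rfl⟩
      (hle ⟨_, hh, rfl⟩)
  have hasc := hB'.covered_ascent hT (n := n) (fun i _ W hW => le_of_trap hB' hgen htrap hZ hW)
    n le_rfl ⊤ (by rw [hZ]; exact le_top)
  obtain ⟨r, hr, x, L, hL, hxL, hBx⟩ := hasc.exists_pos hB'.one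
  have hrR : r ≤ R := hr.trans (ascentRank_mono _ _ hn)
  have hxM : GenProgression x L ⊆ (f '' B) ^ M := by
    refine (hF r n _ (Subgroup.lowerCentralSeries_eq_bot_iff_upperCentralSeries_eq_top.2 hZ)
      x L).trans ?_
    have h1 : ({1} ∪ {g | ∃ (i : Fin r) (j : ℤ), j.natAbs ≤ L i ∧ g = x i ^ j} : Set (C ⧸ V)) ⊆
        (f '' B) ^ 2 ^ (N + 5) := by
      rintro g (rfl | ⟨i, j, hj, rfl⟩)
      · exact hB'.one_pow _
      · exact hB'.pow_mono (Nat.pow_le_pow_right (by norm_num) (by omega)) (hxL i ⟨j, hj, rfl⟩)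
    refine (Set.pow_subset_pow_left h1).trans ?_
    rw [← pow_mul]
    refine hB'.pow_mono (Nat.mul_le_mul_left _ ?_)
    calc F r n ≤ ∑ s ∈ Finset.range (N + 1), F r s :=
          Finset.single_le_sum (f := F r) (fun _ _ => Nat.zero_le _) (Finset.mem_range.2 (by omega))
      _ ≤ Φ := Finset.single_le_sum (f := fun r => ∑ s ∈ Finset.range (N + 1), F r s)
          (fun _ _ => Nat.zero_le _) (Finset.mem_range.2 (by omega))
  choose y hy using fun i => hf (x i)
  obtain rfl : (fun i => f (y i)) = x := funext hy
  have hyval : GenProgression (fun i => (y i : G)) L = C.subtype '' GenProgression y L :=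
    (image_genProgression C.subtype y L).symm
  have hrange : Set.range (fun i => (y i : G)) = C.subtype '' Set.range y := by
    rw [← Set.range_comp]
    rfl
  refine ⟨r, hrR, n, hn, V.map C.subtype, fun i => (y i : G), L, ?_, ?_, ?_, hL, ?_, ?_⟩
  · rintro _ ⟨v, hv, rfl⟩
    exact hA.pow_mono (by omega) (coe_mem_pow (hVB hv))
  · rintro i _ ⟨v, hv, rfl⟩
    exact ⟨⟨_, hV.conj_mem v hv (y i), rfl⟩, ⟨_, hV.conj_mem' v hv (y i), rfl⟩⟩
  · rw [hrange, ← image_leftComm]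
    rintro _ ⟨c, hc, rfl⟩
    refine ⟨c, ?_, rfl⟩
    have h1 : f c ∈ leftComm (f '' Set.range y) n := by
      rw [← image_leftComm]
      exact ⟨c, hc, rfl⟩
    have h2 := leftComm_subset_lowerCentralSeries _ _ h1
    rw [Subgroup.lowerCentralSeries_eq_bot_iff_upperCentralSeries_eq_top.2 hZ] at h2
    exact (QuotientGroup.eq_one_iff c).1 h2
  · rw [hyval]
    rintro _ ⟨c, hc, rfl⟩
    have h1 : f c ∈ (f '' B) ^ M := hxM (by
      rw [← image_genProgression]
      exact ⟨c, hc, rfl⟩)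
    obtain ⟨b, hb, v, hv, rfl⟩ := hlift h1
    have h2 : b * v ∈ B ^ (M + p) := by
      rw [pow_add]
      exact Set.mul_mem_mul hb (hVB hv)
    exact coe_mem_pow h2
  · have hk := hA.pos
    refine hcov.mono (Nat.pow_le_pow_right hk (by omega)) le_rfl ?_
    rintro a ⟨ha, haC⟩
    have h1 : f ⟨a, haC⟩ ∈ GenProgression (fun i => f (y i)) L := by
      refine hBx ⟨?_, Subgroup.mem_top _⟩
      refine hB'.pow_mono (m := 1) one_le_two ?_
      rw [pow_one]
      exact ⟨_, hA.pow_mono (m := 2) (n := 6) (by norm_num) ha, rfl⟩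
    rw [← image_genProgression] at h1
    obtain ⟨c, hc, hca⟩ := h1
    rw [hyval]
    exact ⟨c, ⟨c, hc, rfl⟩, _, ⟨c⁻¹ * ⟨a, haC⟩, (hfV _ _).1 hca, rfl⟩, by simp⟩

end Nilpotent

section Main

theorem exists_separating_hom {G : Type u} [Group G] (hG : ResiduallyNilpotent G) {S : Set G}
    (hS : S.Finite) : ∃ (Q : Type u) (_ : Group Q) (π : G →* Q), Group.IsNilpotent Q ∧
      ∀ g ∈ S, π g = 1 → g = 1 := by
  classical
  have : Finite S := hS
  have hG' : ∀ g : G, ∃ (N : Type u) (_ : Group N) (π : G →* N),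
      Group.IsNilpotent N ∧ (π g = 1 → g = 1) := by
    intro g
    by_cases hg : g = 1
    · exact ⟨PUnit, inferInstance, 1, inferInstance, fun _ => hg⟩
    · obtain ⟨N, i, π, hN, hπ⟩ := hG g hg
      exact ⟨N, i, π, hN, fun h => absurd h hπ⟩
  choose N i π hN hπ using hG'
  refine ⟨∀ s : S, N s, inferInstance, MonoidHom.pi fun s => π s, inferInstance, fun g hg h => ?_⟩
  exact hπ g (congrFun h ⟨g, hg⟩)

theorem exists_model_of_residuallyNilpotent (k T : ℕ)
    (hT : abelianConst ((k ^ 11) ^ 3) * (k ^ 11) ^ (31 * abelianRank ((k ^ 11) ^ 3) + 5) < 2 ^ T) :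
    ∃ m, ∀ (G : Type u) [Group G], ResiduallyNilpotent G → ∀ A : Set G, Apx k A →
      ∃ r ≤ ascentRank (abelianRank ((k ^ 11) ^ 3)) (T * (2 * (k ^ 11) ^ 2)) (k ^ 6),
      ∃ n ≤ k ^ 6, HasModel A m r n (k ^ (15 * k ^ 6)) := by
  obtain ⟨m, hm⟩ := exists_model_of_isNilpotent.{u} k T hT
  refine ⟨m, fun G _ hG A hA => ?_⟩
  obtain ⟨Q, _, π, _, hπ⟩ := exists_separating_hom hG
    (hA.pow_finite (4 ^ (k ^ 6) * m + 5 * m + 2))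
  obtain ⟨r, hr, n, hn, h⟩ := hm Q (π '' A) (hA.image π)
  refine ⟨r, hr, n, hn, h.of_image hA π hπ ?_⟩
  have : 4 ^ n * m ≤ 4 ^ (k ^ 6) * m :=
    Nat.mul_le_mul_right _ (Nat.pow_le_pow_right (by norm_num) hn)
  omega

theorem ascentRank_le (D T i : ℕ) : ascentRank D T i ≤ (D + 1 + T) ^ (i + 1) := by
  induction i with
  | zero => simp [ascentRank]
  | succ i ih =>
    rw [ascentRank, pow_succ', add_mul (D + 1) T]
    exact Nat.add_le_add (Nat.mul_le_mul_left _ ih)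
      (Nat.le_mul_of_pos_right _ (Nat.pow_pos (by positivity)))

/-- The number of doublings needed in Chang's covering argument. -/
def changSteps (k D : ℕ) : ℕ := D + 2 * (D ^ 2 + D) + D * D + k ^ 11 * (31 * D + 5)

theorem abelianConst_mul_lt (k : ℕ) :
    abelianConst ((k ^ 11) ^ 3) * (k ^ 11) ^ (31 * abelianRank ((k ^ 11) ^ 3) + 5) <
      2 ^ changSteps k (abelianRank ((k ^ 11) ^ 3)) := by
  rw [abelianConst]
  set D := abelianRank ((k ^ 11) ^ 3)
  have h1 : D < 2 ^ D := Nat.lt_two_pow_self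
  have h2 : 3 ^ (D ^ 2 + D) ≤ 2 ^ (2 * (D ^ 2 + D)) := by
    rw [pow_mul]
    exact Nat.pow_le_pow_left (by norm_num) _
  have h3 : D ^ D ≤ 2 ^ (D * D) := by
    rw [pow_mul]
    exact Nat.pow_le_pow_left h1.le _
  have h4 : (k ^ 11) ^ (31 * D + 5) ≤ 2 ^ (k ^ 11 * (31 * D + 5)) := by
    rw [pow_mul]
    exact Nat.pow_le_pow_left Nat.lt_two_pow_self.le _
  rw [changSteps, pow_add 2 (D + 2 * (D ^ 2 + D) + D * D), pow_add 2 (D + 2 * (D ^ 2 + D)),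
    pow_add 2 D]
  calc D * (3 ^ (D ^ 2 + D) * D ^ D) * (k ^ 11) ^ (31 * D + 5)
      ≤ D * (2 ^ (2 * (D ^ 2 + D)) * 2 ^ (D * D)) * 2 ^ (k ^ 11 * (31 * D + 5)) := by gcongr
    _ < 2 ^ D * (2 ^ (2 * (D ^ 2 + D)) * 2 ^ (D * D)) * 2 ^ (k ^ 11 * (31 * D + 5)) := by
        gcongr
    _ = _ := by ring

/-- The doubly exponential scale on which ranks are measured. -/
def scale (k a : ℕ) : ℕ := 2 ^ 2 ^ k ^ a

section Scale
variable {k : ℕ}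

theorem pow_le_scale (k a : ℕ) : k ^ a ≤ scale k a :=
  Nat.lt_two_pow_self.le.trans Nat.lt_two_pow_self.le

theorem scale_mono (hk : 2 ≤ k) {a b : ℕ} (h : a ≤ b) : scale k a ≤ scale k b :=
  Nat.pow_le_pow_right (by norm_num) (Nat.pow_le_pow_right (by norm_num)
    (Nat.pow_le_pow_right (by omega) h))

theorem scale_sq_le (hk : 2 ≤ k) (a : ℕ) : scale k a ^ 2 ≤ scale k (a + 1) := by
  rw [scale, scale, ← pow_mul, ← pow_succ]
  refine Nat.pow_le_pow_right (by norm_num) (Nat.pow_le_pow_right (by norm_num) ?_)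
  have : 0 < k ^ a := Nat.pow_pos (by omega)
  rw [pow_succ]
  nlinarith

theorem scale_pow_le (hk : 2 ≤ k) (a b : ℕ) : scale k a ^ k ^ b ≤ scale k (a + b + 1) := by
  have h1 : 0 < k ^ a := Nat.pow_pos (by omega)
  have h2 : 0 < k ^ b := Nat.pow_pos (by omega)
  have h3 : k ^ a ≤ k ^ (a + b) := Nat.pow_le_pow_right (by omega) (by omega)
  have h4 : k ^ b ≤ k ^ (a + b) := Nat.pow_le_pow_right (by omega) (by omega)
  rw [scale, scale, ← pow_mul]
  refine Nat.pow_le_pow_right (by norm_num) ?_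
  calc 2 ^ k ^ a * k ^ b ≤ 2 ^ k ^ a * 2 ^ k ^ b := Nat.mul_le_mul_left _ Nat.lt_two_pow_self.le
    _ = 2 ^ (k ^ a + k ^ b) := (pow_add _ _ _).symm
    _ ≤ 2 ^ k ^ (a + b + 1) := by
      refine Nat.pow_le_pow_right (by norm_num) ?_
      rw [pow_succ]
      nlinarith

theorem abelianRank_le_scale (hk : 2 ≤ k) : abelianRank ((k ^ 11) ^ 3) ≤ scale k 233 := by
  have h1 : 2 ^ (128 * ((k ^ 11) ^ 3) ^ 3 + 1) ≤ 2 ^ k ^ 107 := by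
    refine Nat.pow_le_pow_right (by norm_num) ?_
    have h7 : 2 ^ 7 ≤ k ^ 7 := Nat.pow_le_pow_left hk 7
    have h106 : 0 < k ^ 106 := Nat.pow_pos (by omega)
    calc 128 * ((k ^ 11) ^ 3) ^ 3 + 1 ≤ k ^ 7 * ((k ^ 11) ^ 3) ^ 3 + 1 := by
          gcongr
          exact h7
      _ = k ^ 106 + 1 := by ring
      _ ≤ k ^ 106 * k := by nlinarith
      _ = k ^ 107 := by ring
  have h2 : 2 * (k ^ 11) ^ 3 ≤ 2 ^ k ^ 34 := by
    calc 2 * (k ^ 11) ^ 3 ≤ k * (k ^ 11) ^ 3 := by gcongr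
      _ = k ^ 34 := by ring
      _ ≤ _ := Nat.lt_two_pow_self.le
  have h3 : (2 * (k ^ 11) ^ 3) ^ 2 ^ (128 * ((k ^ 11) ^ 3) ^ 3 + 1) ≤ scale k 232 := by
    calc _ ≤ (2 ^ k ^ 34) ^ 2 ^ k ^ 107 :=
          (Nat.pow_le_pow_left h2 _).trans (Nat.pow_le_pow_right (by positivity) h1)
      _ = 2 ^ (k ^ 34 * 2 ^ k ^ 107) := (pow_mul _ _ _).symm
      _ ≤ scale k 232 := by
        refine Nat.pow_le_pow_right (by norm_num) ?_
        calc k ^ 34 * 2 ^ k ^ 107 ≤ 2 ^ k ^ 34 * 2 ^ k ^ 107 :=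
              Nat.mul_le_mul_right _ Nat.lt_two_pow_self.le
          _ = 2 ^ (k ^ 34 + k ^ 107) := (pow_add _ _ _).symm
          _ ≤ 2 ^ k ^ 232 := by
            refine Nat.pow_le_pow_right (by norm_num) ?_
            have h5 : k ^ 34 ≤ k ^ 231 := Nat.pow_le_pow_right (by omega) (by norm_num)
            have h6 : k ^ 107 ≤ k ^ 231 := Nat.pow_le_pow_right (by omega) (by norm_num)
            have h7 : k ^ 231 * 2 ≤ k ^ 231 * k := Nat.mul_le_mul_left _ hk
            rw [pow_succ k 231]
            omega
  calc abelianRank ((k ^ 11) ^ 3)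
      = k ^ 231 * (2 * (k ^ 11) ^ 3) ^ 2 ^ (128 * ((k ^ 11) ^ 3) ^ 3 + 1) := by
        rw [abelianRank]
        congr 1
        ring
    _ ≤ scale k 232 * scale k 232 :=
        Nat.mul_le_mul ((pow_le_scale k 231).trans (scale_mono hk (by norm_num))) h3
    _ = scale k 232 ^ 2 := (sq _).symm
    _ ≤ scale k 233 := scale_sq_le hk 232

theorem ascentRank_le_scale (hk : 2 ≤ k) :
    ascentRank (abelianRank ((k ^ 11) ^ 3))
      (changSteps k (abelianRank ((k ^ 11) ^ 3)) * (2 * (k ^ 11) ^ 2)) (k ^ 6) ≤ scale k 246 := by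
  have hD := abelianRank_le_scale hk
  set D := abelianRank ((k ^ 11) ^ 3)
  refine (ascentRank_le _ _ _).trans ?_
  have h6 : k ^ 6 + 1 ≤ k ^ 7 := by
    have : 0 < k ^ 6 := Nat.pow_pos (by omega)
    rw [pow_succ k 6]
    nlinarith
  have hX : 2 ^ 32 ≤ scale k 233 := by
    have h5 : 2 ^ 5 ≤ 2 ^ k ^ 233 := by
      refine Nat.pow_le_pow_right (by norm_num) ?_
      calc 5 ≤ 2 ^ 233 := by norm_num
        _ ≤ k ^ 233 := Nat.pow_le_pow_left hk _
    exact Nat.pow_le_pow_right (by norm_num) h5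
  have hk11 : k ^ 11 ≤ scale k 233 := (pow_le_scale k 11).trans (scale_mono hk (by norm_num))
  have h16 : scale k 233 ^ 16 ≤ scale k 237 := by
    calc scale k 233 ^ 16 = (((scale k 233 ^ 2) ^ 2) ^ 2) ^ 2 := by ring
      _ ≤ ((scale k 234 ^ 2) ^ 2) ^ 2 := by gcongr; exact scale_sq_le hk _
      _ ≤ (scale k 235 ^ 2) ^ 2 := by gcongr; exact scale_sq_le hk _
      _ ≤ scale k 236 ^ 2 := by gcongr; exact scale_sq_le hk _
      _ ≤ scale k 237 := scale_sq_le hk _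
  set X := scale k 233
  have hT : changSteps k D ≤ X ^ 4 := by
    calc changSteps k D ≤ X + 2 * (X ^ 2 + X) + X * X + X * (31 * X + 5) := by
          rw [changSteps]; gcongr
      _ ≤ X ^ 4 := by
        have h2 : 2 ^ 32 * X ≤ X ^ 2 := by nlinarith
        have h4 : 2 ^ 32 * X ^ 2 ≤ X ^ 4 := by nlinarith
        nlinarith
  have hbase : D + 1 + changSteps k D * (2 * (k ^ 11) ^ 2) ≤ X ^ 16 := by
    calc D + 1 + changSteps k D * (2 * (k ^ 11) ^ 2) ≤ X + 1 + X ^ 4 * (X * X ^ 2) := by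
          gcongr
          omega
      _ ≤ X ^ 8 := by
        have h7 : X ≤ X ^ 7 := Nat.le_self_pow (by norm_num) X
        have h8 : 2 ^ 32 * X ^ 7 ≤ X * X ^ 7 := Nat.mul_le_mul_right _ hX
        ring_nf at h8 ⊢
        omega
      _ ≤ X ^ 16 := Nat.pow_le_pow_right (by omega) (by norm_num)
  calc (D + 1 + changSteps k D * (2 * (k ^ 11) ^ 2)) ^ (k ^ 6 + 1)
      ≤ scale k 237 ^ (k ^ 6 + 1) := Nat.pow_le_pow_left (hbase.trans h16) _
    _ ≤ scale k 237 ^ k ^ 7 := Nat.pow_le_pow_right (Nat.pow_pos (by norm_num)) h6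
    _ ≤ scale k 245 := scale_pow_le hk 237 7
    _ ≤ scale k 246 := scale_mono hk (by norm_num)

end Scale

theorem Apx.hasModel_of_one {G : Type*} [Group G] {A : Set G} (hA : Apx 1 A) :
    HasModel A 1 0 0 1 := by
  have hAA : A * A = A := by
    refine (Set.eq_of_subset_of_ncard_le (t := A * A)
      (fun a ha => ⟨a, ha, 1, hA.one, mul_one a⟩) ?_
      (hA.finite.mul hA.finite)).symm
    simpa using hA.cov.ncard_le hA.finite
  let V : Subgroup G :=
    { carrier := A
      one_mem' := hA.one
      mul_mem' := fun {a b} ha hb => hAA ▸ Set.mul_mem_mul ha hb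
      inv_mem' := fun {a} ha => hA.inv_mem ha }
  refine ⟨V, Fin.elim0, Fin.elim0, by rw [pow_one]; exact le_rfl, fun i => i.elim0, ?_,
    fun i => i.elim0, ?_, ?_⟩
  · rintro _ ⟨i, _⟩
    exact i.elim0
  · rintro _ ⟨w, _, rfl⟩
    cases w with
    | nil => simpa using hA.one
    | cons p _ => exact p.1.elim0
  · exact (Cov.refl A).mono le_rfl le_rfl fun a ha =>
      ⟨1, one_mem_genProgression _ _, a, ha, one_mul a⟩

theorem exists_model (k : ℕ) : ∃ m, ∀ (G : Type u) [Group G], ResiduallyNilpotent G →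
    ∀ A : Set G, Apx k A → ∃ r ≤ scale k 246, ∃ n ≤ k ^ 6, ∃ N ≤ 2 ^ k ^ 11,
      HasModel A m r n N := by
  rcases Nat.lt_or_ge k 2 with hk | hk
  · refine ⟨1, fun G _ _ A hA => ?_⟩
    obtain rfl : k = 1 := le_antisymm (by omega) hA.pos
    exact ⟨0, Nat.zero_le _, 0, Nat.zero_le _, 1, by norm_num, hA.hasModel_of_one⟩
  · obtain ⟨m, hm⟩ := exists_model_of_residuallyNilpotent.{u} k _ (abelianConst_mul_lt k)
    refine ⟨m, fun G _ hG A hA => ?_⟩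
    obtain ⟨r, hr, n, hn, h⟩ := hm G hG A hA
    refine ⟨r, hr.trans (ascentRank_le_scale hk), n, hn, _, ?_, h⟩
    calc k ^ (15 * k ^ 6) ≤ (2 ^ k) ^ (15 * k ^ 6) :=
          Nat.pow_le_pow_left Nat.lt_two_pow_self.le _
      _ = 2 ^ (15 * k ^ 7) := by rw [← pow_mul]; ring_nf
      _ ≤ 2 ^ k ^ 11 := by
        refine Nat.pow_le_pow_right (by norm_num) ?_
        have h4 : 2 ^ 4 ≤ k ^ 4 := Nat.pow_le_pow_left hk 4
        calc 15 * k ^ 7 ≤ k ^ 4 * k ^ 7 := Nat.mul_le_mul_right _ (by omega)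
          _ = k ^ 11 := by ring

theorem two_pow_le_exp (n : ℕ) : (2 : ℝ) ^ n ≤ Real.exp n := by
  rw [← Real.exp_one_pow]
  exact pow_le_pow_left₀ (by norm_num) (by linarith [Real.add_one_le_exp (1 : ℝ)]) n

end Main

end NilApprox

open NilApprox in
theorem statement_1 :
    ∃ (c : ℝ) (m : ℝ → ℕ), 0 < c ∧
      ∀ (G : Type*) [Group G], ResiduallyNilpotent G →
        ∀ K : ℝ, 1 ≤ K → ∀ A : Set G, IsKApproximateSubgroup K A →
          ∃ (P : Set G) (r s : ℕ), IsCosetNilprogression r s P ∧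
            (r : ℝ) ≤ Real.exp (Real.exp (K ^ c)) ∧ (s : ℝ) ≤ K ^ 6 ∧
            P ⊆ A ^ m K ∧
            ∃ X : Set G, X.Finite ∧ (X.ncard : ℝ) ≤ Real.exp (K ^ c) ∧ A ⊆ X * P := by
  choose m hm using exists_model
  refine ⟨(246 : ℕ), fun K => 2 * m ⌊K⌋₊, by norm_num, fun G _ hG K hK A hA => ?_⟩
  have hK0 : 0 ≤ K := zero_le_one.trans hK
  have hpow : ∀ a ≤ 246, ((⌊K⌋₊ ^ a : ℕ) : ℝ) ≤ K ^ ((246 : ℕ) : ℝ) := by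
    intro a ha
    rw [Real.rpow_natCast, Nat.cast_pow]
    exact (pow_le_pow_left₀ (Nat.cast_nonneg _) (Nat.floor_le hK0) a).trans
      (pow_le_pow_right₀ hK ha)
  have hexp : ∀ a ≤ 246, (2 : ℝ) ^ (⌊K⌋₊ ^ a) ≤ Real.exp (K ^ ((246 : ℕ) : ℝ)) := fun a ha =>
    (two_pow_le_exp _).trans (Real.exp_le_exp.2 (hpow a ha))
  have hA' : Apx ⌊K⌋₊ A := by
    obtain ⟨h1, h2, h3, X, hX, hXK, hXA⟩ := hA
    refine ⟨h1, h2, h3, hX.toFinset, ?_, by simpa using hXA⟩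
    rw [← Set.ncard_eq_toFinset_card X hX]
    exact Nat.le_floor hXK
  obtain ⟨r, hr, n, hn, N, hN, h⟩ := hm ⌊K⌋₊ G hG A hA'
  obtain ⟨P, hP, hPA, X, hX, hXA⟩ := h.isCosetNilprogression
  refine ⟨P, r, n, hP, ?_, ?_, hPA, X, X.finite_toSet, ?_, hXA⟩
  · refine le_trans ?_ (Real.exp_le_exp.2 (hexp 246 le_rfl))
    have h1 : (r : ℝ) ≤ (2 : ℝ) ^ (2 ^ ⌊K⌋₊ ^ 246) := by
      rw [scale] at hr
      exact_mod_cast hr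
    refine h1.trans ((two_pow_le_exp _).trans ?_)
    rw [Nat.cast_pow, Nat.cast_ofNat]
  · have h1 : (n : ℝ) ≤ (⌊K⌋₊ : ℝ) ^ 6 := by exact_mod_cast hn
    exact h1.trans (pow_le_pow_left₀ (Nat.cast_nonneg _) (Nat.floor_le hK0) 6)
  · rw [Set.ncard_coe_finset]
    have h1 : (X.card : ℝ) ≤ (2 : ℝ) ^ (⌊K⌋₊ ^ 11) := by exact_mod_cast hX.trans hN
    exact h1.trans (hexp 11 (by norm_num))
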